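/- Let Ω be an n-connected quadrature domain of finite area with C^∞ smooth boundary, and let S be its Szegő kernel. Then for each fixed w ∈ Ω the function z ↦ S(z, w) is algebraic: there exists a nonzero polynomial P ∈ ℂ[X,Y] (depending on w) such that P(z, S(z, w)) = 0 for all z ∈ Ω. -/

import Mathlib

open MeasureTheory Complex ComplexConjugate Metric Set

noncomputable section

/-- `f` belongs to the Bergman space `A²(Ω)`. -/
def BergmanFun (Ω : Set ℂ) (f : ℂ → ℂ) : Prop :=
  DifferentiableOn ℂ f Ω ∧ IntegrableOn (fun z => ‖f z‖ ^ 2) Ω volume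

/-- `Ω` is a finitely connected domain none of whose complementary components is a point. -/
def IsFinConnDomain (Ω : Set ℂ) : Prop :=
  IsOpen Ω ∧ IsConnected Ω ∧
  {C : Set ℂ | ∃ x ∈ Ωᶜ, C = connectedComponentIn Ωᶜ x}.Finite ∧
  ∀ x ∈ Ωᶜ, ¬ (connectedComponentIn Ωᶜ x).Subsingleton

/-- `Ω` is a quadrature domain. -/
def IsQuadratureDomain (Ω : Set ℂ) : Prop :=
  ∃ N : ℕ, 0 < N ∧ ∃ (w : Fin N → ℂ) (n : Fin N → ℕ) (c : Fin N → ℕ → ℂ),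
    (∀ j, w j ∈ Ω) ∧
    ∀ f : ℂ → ℂ, BergmanFun Ω f →
      (∫ z in Ω, f z) =
        ∑ j, ∑ k ∈ Finset.range (n j + 1), c j k * iteratedDerivWithin k f Ω (w j)

/-- `fa` is an Ahlfors map of `Ω` at `a`. -/
def IsAhlforsMap (Ω : Set ℂ) (a : ℂ) (fa : ℂ → ℂ) : Prop :=
  DifferentiableOn ℂ fa Ω ∧ (∀ z ∈ Ω, ‖fa z‖ < 1) ∧
  (deriv fa a).im = 0 ∧ 0 < (deriv fa a).re ∧
  ∀ g : ℂ → ℂ, DifferentiableOn ℂ g Ω → (∀ z ∈ Ω, ‖g z‖ < 1) →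
    ‖deriv g a‖ ≤ (deriv fa a).re

/-- `Ω` is bounded with `C^∞` smooth boundary consisting of finitely many disjoint
simple closed curves. -/
def HasSmoothBoundary (Ω : Set ℂ) : Prop :=
  Bornology.IsBounded Ω ∧
  ∃ (n : ℕ) (γ : Fin n → ℝ → ℂ),
    (∀ i, ContDiff ℝ (⊤ : ℕ∞) (γ i)) ∧
    (∀ i, Function.Periodic (γ i) (2 * Real.pi)) ∧
    (∀ i, InjOn (γ i) (Ico 0 (2 * Real.pi))) ∧
    (∀ i t, deriv (γ i) t ≠ 0) ∧
    (Pairwise fun i j => Disjoint (range (γ i)) (range (γ j))) ∧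
    frontier Ω = ⋃ i, range (γ i)

/-- Partial derivative in the `x`-direction of a real-valued function on `ℂ`. -/
def pdx (u : ℂ → ℝ) (z : ℂ) : ℝ := deriv (fun t : ℝ => u (z + (t : ℂ))) 0

/-- Partial derivative in the `y`-direction of a real-valued function on `ℂ`. -/
def pdy (u : ℂ → ℝ) (z : ℂ) : ℝ := deriv (fun t : ℝ => u (z + (t : ℂ) * Complex.I)) 0

/-- `f` is a proper holomorphic map of `Ω` onto the open unit disc. -/
def IsProperOntoDisc (Ω : Set ℂ) (f : ℂ → ℂ) : Prop :=
  DifferentiableOn ℂ f Ω ∧ f '' Ω = ball (0 : ℂ) 1 ∧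
  ∀ L : Set ℂ, L ⊆ ball (0 : ℂ) 1 → IsCompact L → IsCompact (Ω ∩ f ⁻¹' L)

/-- `g` is `(m, δ)`-close to the identity on `closure Ω`. -/
def CloseToId (Ω : Set ℂ) (m : ℕ) (δ : ℝ) (g : ℂ → ℂ) : Prop :=
  ∀ k ≤ m, ∀ z ∈ closure Ω, ‖iteratedFDeriv ℝ k (fun w => g w - w) z‖ ≤ δ

/-- `σ : [0,1] → ℂ` is a piecewise continuously differentiable curve. -/
def PiecewiseC1On01 (σ : ℝ → ℂ) : Prop :=
  ContinuousOn σ (Icc 0 1) ∧ ∃ s : Finset ℝ, ContDiffOn ℝ 1 σ (Icc (0 : ℝ) 1 \ s)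

/-- `Ω` is a generalized quadrature domain. -/
def IsGenQuadratureDomain (Ω : Set ℂ) : Prop :=
  ∃ (N M : ℕ) (w : Fin N → ℂ) (n : Fin N → ℕ) (c : Fin N → ℕ → ℂ)
    (b : Fin M → ℂ) (σ : Fin M → ℝ → ℂ),
    (∀ j, w j ∈ Ω) ∧
    (∀ m, PiecewiseC1On01 (σ m)) ∧
    (∀ m, ∀ t ∈ Icc (0 : ℝ) 1, σ m t ∈ Ω) ∧
    ∀ f : ℂ → ℂ, BergmanFun Ω f →
      (∫ z in Ω, f z) =
        (∑ j, ∑ k ∈ Finset.range (n j + 1), c j k * iteratedDerivWithin k f Ω (w j)) +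
        ∑ m, b m * ∫ t in (0 : ℝ)..1, f (σ m t) * deriv (σ m) t


section Helpers
open Filter Topology

/-- Maximum principle for `exp (-Im H)`: if `Im H` tends to `0` at the boundary, then `H` has
nonnegative imaginary part. -/
lemma im_nonneg_of_tendsto_frontier {Ω : Set ℂ} (hb : Bornology.IsBounded Ω)
    (ho : IsOpen Ω) {H : ℂ → ℂ} (hH : DifferentiableOn ℂ H Ω)
    (hlim : ∀ z ∈ frontier Ω, ∃ l : ℂ, l.im = 0 ∧ Tendsto H (𝓝[Ω] z) (𝓝 l)) :
    ∀ z ∈ Ω, 0 ≤ (H z).im := by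
  have hcl : ∀ z ∈ closure Ω, ∃ l, Tendsto H (𝓝[Ω] z) (𝓝 l) := by
    intro z hz
    by_cases h : z ∈ Ω
    · exact ⟨_, hH.continuousOn z h⟩
    · obtain ⟨l, _, hl⟩ := hlim z ⟨hz, by rwa [ho.interior_eq]⟩
      exact ⟨l, hl⟩
  have hc := continuousOn_extendFrom Subset.rfl hcl
  have heq := extendFrom_extends hH.continuousOn
  have hd : DiffContOnCl ℂ (fun z => exp (I * extendFrom Ω H z)) Ω := by
    constructor
    · have : DifferentiableOn ℂ (fun z => exp (I * H z)) Ω := (hH.const_mul I).cexp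
      exact this.congr (fun z hz => by simp only [heq z hz])
    · exact (continuousOn_const.mul hc).cexp
  intro z hz
  have := norm_le_of_forall_mem_frontier_norm_le hb hd (C := 1) (fun w hw => ?_)
    (subset_closure hz)
  · simp only [heq z hz, norm_exp] at this
    simp at this
    linarith
  · obtain ⟨l, hl0, hl⟩ := hlim w hw
    rw [extendFrom_eq hw.1 hl, norm_exp]
    simp [hl0]

lemma im_eq_zero_of_tendsto_frontier {Ω : Set ℂ} (hb : Bornology.IsBounded Ω)
    (ho : IsOpen Ω) {H : ℂ → ℂ} (hH : DifferentiableOn ℂ H Ω)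
    (hlim : ∀ z ∈ frontier Ω, ∃ l : ℂ, l.im = 0 ∧ Tendsto H (𝓝[Ω] z) (𝓝 l)) :
    ∀ z ∈ Ω, (H z).im = 0 := by
  intro z hz
  refine le_antisymm ?_ (im_nonneg_of_tendsto_frontier hb ho hH hlim z hz)
  have := im_nonneg_of_tendsto_frontier hb ho hH.neg (fun w hw => by
    obtain ⟨l, hl0, hl⟩ := hlim w hw
    exact ⟨-l, by simp [hl0], hl.neg⟩) z hz
  simpa using this

lemma exists_const_of_tendsto_frontier {Ω : Set ℂ} (hb : Bornology.IsBounded Ω)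
    (ho : IsOpen Ω) (hp : IsPreconnected Ω) {H : ℂ → ℂ} (hH : DifferentiableOn ℂ H Ω)
    (hlim : ∀ z ∈ frontier Ω, ∃ l : ℂ, l.im = 0 ∧ Tendsto H (𝓝[Ω] z) (𝓝 l)) :
    ∃ c, ∀ z ∈ Ω, H z = c := by
  have him := im_eq_zero_of_tendsto_frontier hb ho hH hlim
  refine ho.exists_is_const_of_deriv_eq_zero hp hH fun z hz => ?_
  rcases Ω.eq_empty_or_nonempty with h | ⟨a, ha⟩
  · simp [h] at hz
  have hmax : IsMaxOn (norm ∘ fun z => exp (I * H z)) Ω a := by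
    intro w hw
    simp [norm_exp, him w hw, him a ha]
  have hE : DifferentiableOn ℂ (fun z => exp (I * H z)) Ω := (hH.const_mul I).cexp
  have hconst := eqOn_of_isPreconnected_of_isMaxOn_norm hp ho hE ha hmax
  have hd : HasDerivAt (fun z => exp (I * H z)) (exp (I * H z) * (I * deriv H z)) z :=
    (((hH z hz).differentiableAt (ho.mem_nhds hz)).hasDerivAt.const_mul I).cexp
  have h0 : HasDerivAt (fun z => exp (I * H z)) 0 z :=
    (hasDerivAt_const z (exp (I * H a))).congr_of_eventuallyEq
      (hconst.eventuallyEq_of_mem (ho.mem_nhds hz))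
  have := hd.unique h0
  simpa [exp_ne_zero] using this

/-- Two holomorphic functions whose boundary values are conjugate to each other are constant. -/
lemma exists_const_of_conj_frontier {Ω : Set ℂ} (hb : Bornology.IsBounded Ω)
    (ho : IsOpen Ω) (hp : IsPreconnected Ω) {F E : ℂ → ℂ}
    (hF : DifferentiableOn ℂ F Ω) (hE : DifferentiableOn ℂ E Ω)
    (hlim : ∀ z ∈ frontier Ω, ∃ l : ℂ, Tendsto F (𝓝[Ω] z) (𝓝 l) ∧
      Tendsto E (𝓝[Ω] z) (𝓝 (conj l))) :
    ∃ c, ∀ z ∈ Ω, F z = c := by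
  obtain ⟨c₁, h₁⟩ := exists_const_of_tendsto_frontier hb ho hp (hF.add hE) (fun z hz => by
    obtain ⟨l, h1, h2⟩ := hlim z hz
    exact ⟨l + conj l, by simp, h1.add h2⟩)
  obtain ⟨c₂, h₂⟩ := exists_const_of_tendsto_frontier hb ho hp
    ((hF.sub hE).const_mul I) (fun z hz => by
      obtain ⟨l, h1, h2⟩ := hlim z hz
      exact ⟨I * (l - conj l), by simp, (h1.sub h2).const_mul I⟩)
  refine ⟨(c₁ + -I * c₂) / 2, fun z hz => ?_⟩
  have e1 := h₁ z hz
  have e2 := h₂ z hz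
  simp only [Pi.add_apply, Pi.sub_apply] at e1 e2
  rw [← e1, ← e2]
  linear_combination (F z - E z) / 2 * I_sq

/-- The space of functions that are holomorphic on `Ω`. -/
def holSubmodule (Ω : Set ℂ) : Submodule ℂ (ℂ → ℂ) where
  carrier := {f | DifferentiableOn ℂ f Ω}
  add_mem' hf hg := DifferentiableOn.add hf hg
  zero_mem' := differentiableOn_const 0
  smul_mem' c _ hf := DifferentiableOn.const_smul hf c

/-- Divided difference at a point of an open set, as a linear map on holomorphic functions. -/
def dslopeHol {Ω : Set ℂ} (ho : IsOpen Ω) {a : ℂ} (ha : a ∈ Ω) :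
    holSubmodule Ω →ₗ[ℂ] holSubmodule Ω where
  toFun f := ⟨dslope f.1 a, (differentiableOn_dslope (ho.mem_nhds ha)).2 f.2⟩
  map_add' f g := by
    have hf : DifferentiableAt ℂ f.1 a := DifferentiableOn.differentiableAt f.2 (ho.mem_nhds ha)
    have hg : DifferentiableAt ℂ g.1 a := DifferentiableOn.differentiableAt g.2 (ho.mem_nhds ha)
    ext z
    by_cases h : z = a
    · subst h
      simp [dslope_same, deriv_add hf hg]
    · simp [dslope_of_ne _ h, slope_def_field]
      ring
  map_smul' c f := by
    have hf : DifferentiableAt ℂ f.1 a := DifferentiableOn.differentiableAt f.2 (ho.mem_nhds ha)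
    ext z
    by_cases h : z = a
    · subst h
      simp [dslope_same, deriv_const_smul_field]
    · simp [dslope_of_ne _ h, slope_def_field]
      ring

/-- The monic polynomial function with the given list of roots. -/
def prodSub (l : List ℂ) (z : ℂ) : ℂ := (l.map fun a => z - a).prod

@[simp] lemma prodSub_nil (z : ℂ) : prodSub [] z = 1 := rfl

lemma prodSub_cons (a : ℂ) (l : List ℂ) (z : ℂ) : prodSub (a :: l) z = (z - a) * prodSub l z := by
  simp [prodSub]

lemma prodSub_append (l k : List ℂ) (z : ℂ) : prodSub (l ++ k) z = prodSub l z * prodSub k z := by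
  simp [prodSub]

lemma prodSub_ne_zero {l : List ℂ} {z : ℂ} (h : z ∉ l) : prodSub l z ≠ 0 := by
  induction l with
  | nil => simp
  | cons a l ih =>
    rw [List.mem_cons, not_or] at h
    rw [prodSub_cons]
    exact mul_ne_zero (sub_ne_zero.2 h.1) (ih h.2)

lemma differentiable_prodSub (l : List ℂ) : Differentiable ℂ (prodSub l) := by
  induction l with
  | nil => exact differentiable_const 1
  | cons a l ih =>
    have : prodSub (a :: l) = fun z => (z - a) * prodSub l z := funext (prodSub_cons a l)
    rw [this]
    exact (differentiable_id.sub_const a).mul ih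

lemma prodSub_replicate_flatten (l : List ℂ) (n : ℕ) (z : ℂ) :
    prodSub (List.replicate n l).flatten z = prodSub l z ^ n := by
  induction n with
  | zero => simp
  | succ n ih => rw [List.replicate_succ, List.flatten_cons, prodSub_append, ih, pow_succ']

/-- Divisibility by a polynomial with roots `l` in `Ω` is implied by `l.length` linear
conditions. -/
lemma exists_linear_conditions {Ω : Set ℂ} (ho : IsOpen Ω) (l : List ℂ) (hl : ∀ a ∈ l, a ∈ Ω) :
    ∃ φ : holSubmodule Ω →ₗ[ℂ] (Fin l.length → ℂ), ∀ E, φ E = 0 →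
      ∃ F : ℂ → ℂ, DifferentiableOn ℂ F Ω ∧ ∀ z ∈ Ω, E.1 z = prodSub l z * F z := by
  induction l with
  | nil => exact ⟨0, fun E _ => ⟨E.1, E.2, by simp [prodSub]⟩⟩
  | cons a l ih =>
    obtain ⟨φ, hφ⟩ := ih fun b hb => hl b (List.mem_cons_of_mem _ hb)
    have ha : a ∈ Ω := hl a List.mem_cons_self
    let ev : holSubmodule Ω →ₗ[ℂ] ℂ := (LinearMap.proj a).comp (holSubmodule Ω).subtype
    let ψ := φ.comp (dslopeHol ho ha)
    refine ⟨LinearMap.pi (Fin.cons ev fun i => (LinearMap.proj i).comp ψ), fun E hE => ?_⟩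
    have h0 : E.1 a = 0 := by
      have := congrFun hE 0
      simpa [ev] using this
    have h1 : φ (dslopeHol ho ha E) = 0 := by
      ext i
      have := congrFun hE i.succ
      simpa [ψ] using this
    obtain ⟨F, hF, hEF⟩ := hφ _ h1
    refine ⟨F, hF, fun z hz => ?_⟩
    have h2 : dslope E.1 a z = prodSub l z * F z := hEF z hz
    have h3 := sub_smul_dslope E.1 a z
    rw [h0, h2] at h3
    rw [prodSub_cons]
    rw [smul_eq_mul, sub_zero] at h3
    rw [← h3]
    ring


/-- Dimension count: two holomorphic functions whose conjugates have, on the boundary, the same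
values as meromorphic functions with finitely many poles satisfy a polynomial relation. -/
lemma exists_relation {Ω : Set ℂ} (hb : Bornology.IsBounded Ω)
    (ho : IsOpen Ω) (hc : IsConnected Ω) {h e₁ e₂ : ℂ → ℂ} (hh : DifferentiableOn ℂ h Ω)
    (he₁ : DifferentiableOn ℂ e₁ Ω) (he₂ : DifferentiableOn ℂ e₂ Ω) (l : List ℂ)
    (hl : ∀ a ∈ l, a ∈ Ω)
    (hlim : ∀ z ∈ frontier Ω, ∃ b, Tendsto h (𝓝[Ω] z) (𝓝 b) ∧
      Tendsto e₁ (𝓝[Ω] z) (𝓝 (prodSub l z * conj z)) ∧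
      Tendsto e₂ (𝓝[Ω] z) (𝓝 (prodSub l z * conj b))) :
    ∃ (m : ℕ) (c : Fin m × Fin m → ℂ), c ≠ 0 ∧
      ∀ z ∈ Ω, ∑ p, c p * (z ^ (p.1 : ℕ) * h z ^ (p.2 : ℕ)) = 0 := by
  obtain ⟨a₀, ha₀⟩ := hc.nonempty
  set d := l.length with hd
  set m := 2 * d + 2 with hm
  set N := 2 * (2 * d + 1) with hN
  obtain ⟨φ, hφ⟩ := exists_linear_conditions ho (List.replicate N l).flatten (by
    intro a ha
    rw [List.mem_flatten] at ha
    obtain ⟨k, hk, hak⟩ := ha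
    exact hl a ((List.eq_of_mem_replicate hk) ▸ hak))
  have hr := differentiable_prodSub l
  let mon : Fin m × Fin m → holSubmodule Ω := fun p =>
    ⟨fun z => e₁ z ^ (p.1 : ℕ) * e₂ z ^ (p.2 : ℕ) * prodSub l z ^ (N - p.1 - p.2),
      ((he₁.pow _).mul (he₂.pow _)).mul (hr.differentiableOn.pow _)⟩
  let T : (Fin m × Fin m → ℂ) →ₗ[ℂ] holSubmodule Ω := Fintype.linearCombination ℂ mon
  let ev : (Fin m × Fin m → ℂ) →ₗ[ℂ] ℂ := Fintype.linearCombination ℂ fun p =>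
    conj (a₀ ^ (p.1 : ℕ) * h a₀ ^ (p.2 : ℕ))
  have hker : ((φ.comp T).prod ev).ker ≠ ⊥ := by
    apply LinearMap.ker_ne_bot_of_finrank_lt
    simp only [Module.finrank_prod, Module.finrank_fintype_fun_eq_card, Fintype.card_fin,
      Module.finrank_self, Fintype.card_prod, List.length_flatten, List.map_replicate,
      List.sum_replicate, smul_eq_mul, ← hd]
    rw [hm, hN]
    nlinarith
  obtain ⟨c, hcker, hc0⟩ := (Submodule.ne_bot_iff _).1 hker
  have hc1 : φ (T c) = 0 ∧ ev c = 0 := by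
    simpa [LinearMap.mem_ker, Prod.ext_iff] using hcker
  refine ⟨m, fun p => conj (c p), fun h0 => hc0 ?_, ?_⟩
  · ext p
    simpa using congrFun h0 p
  obtain ⟨Fs, hFs, hTF⟩ := hφ _ hc1.1
  have hT : ∀ z, (T c).1 z =
      ∑ p, c p * (e₁ z ^ (p.1 : ℕ) * e₂ z ^ (p.2 : ℕ) * prodSub l z ^ (N - p.1 - p.2)) := by
    intro z
    have hTc : T c = ∑ p, c p • mon p := Fintype.linearCombination_apply ℂ mon c
    simp [hTc, mon]
  obtain ⟨κ, hκ⟩ := exists_const_of_conj_frontier hb ho hc.isPreconnected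
    (F := fun z => ∑ p, conj (c p) * (z ^ (p.1 : ℕ) * h z ^ (p.2 : ℕ))) (E := Fs)
    (by fun_prop) hFs (by
      intro z hz
      obtain ⟨b, hb1, hb2, hb3⟩ := hlim z hz
      have hzl : z ∉ l := fun hzl => by
        rw [ho.frontier_eq] at hz
        exact hz.2 (hl z hzl)
      have hid : Tendsto (fun z : ℂ => z) (𝓝[Ω] z) (𝓝 z) := tendsto_id.mono_left nhdsWithin_le_nhds
      have hrl : Tendsto (prodSub l) (𝓝[Ω] z) (𝓝 (prodSub l z)) :=
        hr.continuous.continuousAt.tendsto.mono_left nhdsWithin_le_nhds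
      have hr0 := prodSub_ne_zero hzl
      refine ⟨∑ p, conj (c p) * (z ^ (p.1 : ℕ) * b ^ (p.2 : ℕ)), ?_, ?_⟩
      · exact tendsto_finsetSum _ fun p _ => ((hid.pow _).mul (hb1.pow _)).const_mul _
      · have h1 : Tendsto (fun z => (∑ p, c p * (e₁ z ^ (p.1 : ℕ) * e₂ z ^ (p.2 : ℕ) *
            prodSub l z ^ (N - p.1 - p.2))) / prodSub l z ^ N) (𝓝[Ω] z)
            (𝓝 ((∑ p, c p * ((prodSub l z * conj z) ^ (p.1 : ℕ) *
              (prodSub l z * conj b) ^ (p.2 : ℕ) *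
            prodSub l z ^ (N - p.1 - p.2))) / prodSub l z ^ N)) := by
          refine Tendsto.div ?_ (hrl.pow _) (pow_ne_zero _ hr0)
          exact tendsto_finsetSum _ fun p _ =>
            (((hb2.pow _).mul (hb3.pow _)).mul (hrl.pow _)).const_mul _
        have h2 : (∑ p, c p * ((prodSub l z * conj z) ^ (p.1 : ℕ) *
              (prodSub l z * conj b) ^ (p.2 : ℕ) *
            prodSub l z ^ (N - p.1 - p.2))) / prodSub l z ^ N =
            conj (∑ p : Fin m × Fin m, conj (c p) * (z ^ (p.1 : ℕ) * b ^ (p.2 : ℕ))) := by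
          rw [map_sum, Finset.sum_div]
          refine Finset.sum_congr rfl fun p _ => ?_
          have hp : N = p.1 + p.2 + (N - p.1 - p.2) := by
            have := p.1.2
            have := p.2.2
            omega
          rw [div_eq_iff (pow_ne_zero _ hr0)]
          simp only [map_mul, conj_conj, map_pow]
          conv_rhs => rw [hp]
          rw [pow_add, pow_add, mul_pow, mul_pow]
          ring
        rw [← h2]
        refine h1.congr' ?_
        have hev : ∀ᶠ w in 𝓝[Ω] z, prodSub l w ≠ 0 := hrl.eventually_ne hr0
        filter_upwards [hev, self_mem_nhdsWithin] with w hw hwΩ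
        rw [← hT, hTF w hwΩ, prodSub_replicate_flatten]
        field_simp)
  have hκ0 : κ = 0 := by
    rw [← hκ a₀ ha₀]
    have hev : ev c = ∑ p, c p • conj (a₀ ^ (p.1 : ℕ) * h a₀ ^ (p.2 : ℕ)) :=
      Fintype.linearCombination_apply ℂ _ c
    have := congrArg conj (hev.symm.trans hc1.2)
    simpa using this
  intro z hz
  rw [hκ z hz, hκ0]

lemma frontier_nonempty_of_isBounded {Ω : Set ℂ} (hb : Bornology.IsBounded Ω)
    (hne : Ω.Nonempty) : (frontier Ω).Nonempty := by
  rw [nonempty_frontier_iff]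
  refine ⟨hne, fun h => ?_⟩
  rw [h] at hb
  exact NormedSpace.unbounded_univ ℝ ℂ hb

lemma prodSub_replicate (b : ℂ) (n : ℕ) (z : ℂ) :
    prodSub (List.replicate n b) z = (z - b) ^ n := by
  simp [prodSub]

/-- Removing the zeros of a holomorphic function at finitely many points. -/
lemma exists_factor_finset {Ω : Set ℂ} (ho : IsOpen Ω) {D : ℂ → ℂ}
    (hD : DifferentiableOn ℂ D Ω) (hnz : ∀ z ∈ Ω, ¬ ∀ᶠ w in 𝓝 z, D w = 0)
    (s : Finset ℂ) (hs : ∀ z ∈ s, z ∈ Ω) :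
    ∃ (l : List ℂ) (D₁ : ℂ → ℂ), (∀ a ∈ l, a ∈ Ω) ∧ DifferentiableOn ℂ D₁ Ω ∧
      (∀ z ∈ Ω, D z = prodSub l z * D₁ z) ∧ ∀ z ∈ s, D₁ z ≠ 0 := by
  classical
  induction s using Finset.induction_on with
  | empty => exact ⟨[], D, by simp, hD, by simp, by simp⟩
  | insert b s hbs ih =>
    obtain ⟨l, D₁, hl, hD₁, hfac, hne⟩ := ih fun z hz => hs z (Finset.mem_insert_of_mem hz)
    have hb : b ∈ Ω := hs b (Finset.mem_insert_self _ _)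
    have han : AnalyticAt ℂ D₁ b := hD₁.analyticAt (ho.mem_nhds hb)
    have hnz1 : ¬ ∀ᶠ w in 𝓝 b, D₁ w = 0 := fun h => hnz b hb <| by
      filter_upwards [h, ho.mem_nhds hb] with w hw hwΩ
      rw [hfac w hwΩ, hw, mul_zero]
    obtain ⟨n, g, hg, hgb, hgeq⟩ := han.exists_eventuallyEq_pow_smul_nonzero_iff.2 hnz1
    let D₂ : ℂ → ℂ := fun z => if z = b then g b else D₁ z / (z - b) ^ n
    have hD₂ : ∀ z, z ≠ b → D₂ z = D₁ z / (z - b) ^ n := fun z hz => if_neg hz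
    have hD₂b : D₂ b = g b := if_pos rfl
    have hD₂eq : ∀ᶠ z in 𝓝 b, D₂ z = g z := by
      filter_upwards [hgeq] with z hz
      by_cases h : z = b
      · rw [h, hD₂b]
      · rw [hD₂ z h, hz, smul_eq_mul, mul_div_cancel_left₀]
        exact pow_ne_zero _ (sub_ne_zero.2 h)
    refine ⟨List.replicate n b ++ l, D₂, ?_, ?_, ?_, ?_⟩
    · intro a ha
      rcases List.mem_append.1 ha with h | h
      · rwa [List.eq_of_mem_replicate h]
      · exact hl a h
    · intro z hz
      by_cases h : z = b
      · subst h
        exact (hg.differentiableAt.congr_of_eventuallyEq hD₂eq).differentiableWithinAt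
      · have h1 : DifferentiableAt ℂ (fun z => D₁ z / (z - b) ^ n) z := by
          refine (hD₁.differentiableAt (ho.mem_nhds hz)).div (by fun_prop) ?_
          exact pow_ne_zero _ (sub_ne_zero.2 h)
        refine (h1.congr_of_eventuallyEq ?_).differentiableWithinAt
        filter_upwards [isOpen_ne.mem_nhds h] with w hw using hD₂ w hw
    · intro z hz
      rw [hfac z hz, prodSub_append, prodSub_replicate]
      by_cases h : z = b
      · subst h
        rw [hD₂b, hgeq.self_of_nhds, smul_eq_mul]
        ring
      · rw [hD₂ z h]
        have : (z - b) ^ n ≠ 0 := pow_ne_zero _ (sub_ne_zero.2 h)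
        field_simp
    · intro z hz
      by_cases h : z = b
      · rw [h, hD₂b]
        exact hgb
      · rw [hD₂ z h]
        exact div_ne_zero (hne z ((Finset.mem_insert.1 hz).resolve_left h))
          (pow_ne_zero _ (sub_ne_zero.2 h))

/-- A holomorphic function on a bounded domain with nonzero boundary values divides a polynomial
with roots in the domain. -/
lemma exists_prodSub_eq_mul {Ω : Set ℂ} (hb : Bornology.IsBounded Ω)
    (ho : IsOpen Ω) (hc : IsConnected Ω) {D : ℂ → ℂ} (hD : DifferentiableOn ℂ D Ω)
    (hlim : ∀ z ∈ frontier Ω, ∃ b, b ≠ 0 ∧ Tendsto D (𝓝[Ω] z) (𝓝 b)) :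
    ∃ (l : List ℂ) (k : ℂ → ℂ), (∀ a ∈ l, a ∈ Ω) ∧ DifferentiableOn ℂ k Ω ∧
      ∀ z ∈ Ω, prodSub l z = D z * k z := by
  have han : AnalyticOnNhd ℂ D Ω := hD.analyticOnNhd ho
  have hnot : ∀ z ∈ Ω, ¬ ∃ᶠ w in 𝓝[≠] z, D w = 0 := by
    intro z hz h
    have h0 := han.eqOn_zero_of_preconnected_of_frequently_eq_zero hc.isPreconnected hz h
    obtain ⟨w, hw⟩ := frontier_nonempty_of_isBounded hb hc.nonempty
    obtain ⟨b, hb0, hlb⟩ := hlim w hw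
    have : (𝓝[Ω] w).NeBot := mem_closure_iff_nhdsWithin_neBot.1 hw.1
    have h1 : Tendsto D (𝓝[Ω] w) (𝓝 0) :=
      tendsto_const_nhds.congr' (eventually_nhdsWithin_of_forall fun v hv => (h0 hv).symm)
    exact hb0 (tendsto_nhds_unique hlb h1)
  have hfin : {z ∈ Ω | D z = 0}.Finite := by
    by_contra hinf
    obtain ⟨x, hx, hacc⟩ := Set.Infinite.exists_accPt_of_subset_isCompact hinf
      hb.isCompact_closure (fun z hz => subset_closure hz.1)
    have hfr := accPt_iff_frequently.1 hacc
    by_cases hxΩ : x ∈ Ω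
    · refine hnot x hxΩ ?_
      rw [frequently_nhdsWithin_iff]
      exact hfr.mono fun y hy => ⟨hy.2.2, hy.1⟩
    · obtain ⟨b, hb0, hlb⟩ := hlim x ⟨hx, by rwa [ho.interior_eq]⟩
      have := eventually_nhdsWithin_iff.1 (hlb.eventually_ne hb0)
      obtain ⟨y, hy, hy'⟩ := (hfr.and_eventually this).exists
      exact hy' hy.2.1 hy.2.2
  obtain ⟨l, D₁, hl, hD₁, hfac, hne⟩ := exists_factor_finset ho hD
    (fun z hz h => hnot z hz (h.filter_mono nhdsWithin_le_nhds).frequently)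
    hfin.toFinset (by
      intro z hz
      rw [Set.Finite.mem_toFinset] at hz
      exact hz.1)
  have hD₁ne : ∀ z ∈ Ω, D₁ z ≠ 0 := by
    intro z hz h
    refine hne z ?_ h
    rw [Set.Finite.mem_toFinset]
    exact ⟨hz, by rw [hfac z hz, h, mul_zero]⟩
  refine ⟨l, fun z => (D₁ z)⁻¹, hl, hD₁.inv hD₁ne, fun z hz => ?_⟩
  rw [hfac z hz, mul_assoc, mul_inv_cancel₀ (hD₁ne z hz), mul_one]

lemma measurable_sub_inv (w : ℂ) : Measurable fun z : ℂ => (z - w)⁻¹ :=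
  (measurable_id.sub_const w).inv

/-- Cauchy transforms are holomorphic off any closed set carrying the measure. -/
lemma differentiableOn_cauchyTransform {μ : Measure ℂ} {φ : ℂ → ℂ} (hφ : Integrable φ μ)
    {K : Set ℂ} (hK : IsClosed K) (hμ : ∀ᵐ z ∂μ, z ∈ K) :
    DifferentiableOn ℂ (fun w => ∫ z, φ z * (z - w)⁻¹ ∂μ) Kᶜ := by
  intro w₀ hw₀
  obtain ⟨ε, hε, hball⟩ := Metric.isOpen_iff.1 hK.isOpen_compl w₀ hw₀
  have hdist : ∀ z ∈ K, ∀ w ∈ ball w₀ (ε / 2), ε / 2 ≤ ‖z - w‖ := by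
    intro z hz w hw
    by_contra hlt
    push Not at hlt
    refine hball (?_ : z ∈ ball w₀ ε) hz
    rw [mem_ball, dist_eq_norm] at *
    calc ‖z - w₀‖ = ‖(z - w) + (w - w₀)‖ := by ring_nf
      _ ≤ ‖z - w‖ + ‖w - w₀‖ := norm_add_le _ _
      _ < ε := by linarith
  have hbd : ∀ z ∈ K, ∀ w ∈ ball w₀ (ε / 2), ‖(z - w)⁻¹‖ ≤ (ε / 2)⁻¹ := by
    intro z hz w hw
    rw [norm_inv]
    exact inv_anti₀ (by positivity) (hdist z hz w hw)
  have hmeas : ∀ w, AEStronglyMeasurable (fun z => φ z * (z - w)⁻¹) μ := fun w =>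
    hφ.aestronglyMeasurable.mul (measurable_sub_inv w).aestronglyMeasurable
  have key := hasDerivAt_integral_of_dominated_loc_of_deriv_le (μ := μ) (𝕜 := ℂ)
    (F := fun w z => φ z * (z - w)⁻¹) (F' := fun w z => φ z * ((z - w) ^ 2)⁻¹)
    (x₀ := w₀) (s := ball w₀ (ε / 2)) (bound := fun z => ‖φ z‖ * ((ε / 2)⁻¹ ^ 2))
    (ball_mem_nhds _ (by positivity)) (Eventually.of_forall hmeas) ?_ ?_ ?_ ?_ ?_
  · exact key.2.differentiableAt.differentiableWithinAt
  · refine (hφ.norm.mul_const (ε / 2)⁻¹).mono' (hmeas w₀) ?_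
    filter_upwards [hμ] with z hz
    rw [norm_mul]
    gcongr
    exact hbd z hz w₀ (mem_ball_self (by positivity))
  · exact hφ.aestronglyMeasurable.mul
      ((measurable_id.sub_const w₀).pow_const 2).inv.aestronglyMeasurable
  · filter_upwards [hμ] with z hz w hw
    rw [norm_mul, ← inv_pow, norm_pow]
    gcongr
    exact hbd z hz w hw
  · exact hφ.norm.mul_const _
  · filter_upwards [hμ] with z hz w hw
    have hne : z - w ≠ 0 := fun h0 => by
      have := hdist z hz w hw
      rw [h0, norm_zero] at this
      linarith
    have h1 : HasDerivAt (fun w => z - w) (-1) w := by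
      simpa using (hasDerivAt_id w).const_sub z
    have h2 : HasDerivAt (fun w => φ z * (z - w)⁻¹) (φ z * (- -1 / (z - w) ^ 2)) w :=
      (h1.inv hne).const_mul (φ z)
    rwa [neg_neg, one_div] at h2

lemma integrableOn_norm_inv_ball (r : ℝ) :
    IntegrableOn (fun z : ℂ => ‖z‖⁻¹) (ball 0 r) := by
  rw [integrableOn_fun_norm_addHaar volume (f := fun y => y⁻¹)]
  have : IntegrableOn (fun _ : ℝ => (1 : ℝ)) (Ioo 0 r) := by simp
  refine this.congr_fun (fun y hy => ?_) measurableSet_Ioo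
  have : y ≠ 0 := hy.1.ne'
  simp [Complex.finrank_real_complex, this]

lemma integral_norm_inv_ball {r : ℝ} (hr : 0 ≤ r) :
    ∫ z in ball (0 : ℂ) r, ‖z‖⁻¹ = 2 * Real.pi * r := by
  have h1 : ∫ z in ball (0 : ℂ) r, ‖z‖⁻¹ = ∫ z : ℂ, (Iio r).indicator (fun y => y⁻¹) ‖z‖ := by
    rw [← integral_indicator measurableSet_ball]
    congr 1
    ext z
    simp [indicator]
  rw [h1, integral_fun_norm_addHaar volume (fun y => (Iio r).indicator (fun y => y⁻¹) y)]
  have h2 : ∫ y in Ioi (0 : ℝ), y ^ (Module.finrank ℝ ℂ - 1) •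
      (Iio r).indicator (fun y => y⁻¹) y =
        ∫ y in Ioi (0 : ℝ), (Iio r).indicator (fun _ => 1) y := by
    refine setIntegral_congr_fun measurableSet_Ioi fun y hy => ?_
    have : y ≠ 0 := (mem_Ioi.1 hy).ne'
    by_cases h : y < r <;> simp [Complex.finrank_real_complex, this, h]
  rw [h2, integral_indicator measurableSet_Iio, Measure.restrict_restrict measurableSet_Iio]
  simp [Complex.finrank_real_complex, Measure.real, Iio_inter_Ioi, hr]
  ring

lemma integrableOn_sub_inv {A : Set ℂ} (hA : Bornology.IsBounded A) (w : ℂ) :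
    IntegrableOn (fun z : ℂ => (z - w)⁻¹) A := by
  obtain ⟨r, hr⟩ := hA.subset_ball w
  refine IntegrableOn.mono_set ?_ hr
  have h0 : IntegrableOn (fun z : ℂ => z⁻¹) (ball 0 r) := by
    refine (integrableOn_norm_inv_ball r).mono' measurable_inv.aestronglyMeasurable ?_
    simp
  have h1 := (measurePreserving_sub_right (volume : Measure ℂ) w).integrableOn_comp_preimage
    (MeasurableEquiv.subRight w).measurableEmbedding (f := fun z => z⁻¹) (s := ball 0 r)
  have h2 : (fun x => x - w) ⁻¹' ball (0 : ℂ) r = ball w r := by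
    ext z
    simp [dist_eq_norm]
  rw [h2] at h1
  exact h1.2 h0

lemma setIntegral_ball_sub_eq (f : ℂ → ℂ) (w : ℂ) (r : ℝ) :
    ∫ z in ball w r, f (z - w) = ∫ z in ball 0 r, f z := by
  have h1 := (measurePreserving_sub_right (volume : Measure ℂ) w).setIntegral_preimage_emb
    (MeasurableEquiv.subRight w).measurableEmbedding f (ball 0 r)
  have h2 : (fun x => x - w) ⁻¹' ball (0 : ℂ) r = ball w r := by
    ext z
    simp [dist_eq_norm]
  rwa [h2] at h1

lemma circleAverage_sub_inv_of_lt {ρ : ℝ} (hρ : 0 < ρ) {w : ℂ} (h : ρ < ‖w‖) :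
    Real.circleAverage (fun z => (z - w)⁻¹) 0 ρ = -w⁻¹ := by
  have hd : DiffContOnCl ℂ (fun z => (z - w)⁻¹) (ball 0 |ρ|) := by
    have : ∀ z ∈ closedBall (0 : ℂ) |ρ|, z - w ≠ 0 := fun z hz h0 => by
      rw [mem_closedBall_zero_iff, abs_of_pos hρ, sub_eq_zero.1 h0] at hz
      linarith
    refine DifferentiableOn.diffContOnCl ?_
    intro z hz
    have hdz : DifferentiableAt ℂ (fun z => z - w) z := by fun_prop
    exact (hdz.inv
      (this z (closure_ball_subset_closedBall hz))).differentiableWithinAt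
  rw [hd.circleAverage]
  simp [inv_neg]

lemma circleAverage_sub_inv_of_gt {ρ : ℝ} {w : ℂ} (h : ‖w‖ < ρ) :
    Real.circleAverage (fun z => (z - w)⁻¹) 0 ρ = 0 := by
  have hρ : 0 < ρ := (norm_nonneg w).trans_lt h
  have hne : ∀ z ∈ closedBall (0 : ℂ) |ρ|, (ρ : ℂ) ^ 2 - conj w * z ≠ 0 := fun z hz h0 => by
    rw [mem_closedBall_zero_iff, abs_of_pos hρ] at hz
    have h1 : ‖(ρ : ℂ) ^ 2‖ = ‖conj w * z‖ := by rw [sub_eq_zero.1 h0]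
    rw [norm_mul, RCLike.norm_conj, norm_pow, norm_real, Real.norm_eq_abs, abs_of_pos hρ] at h1
    have := mul_le_mul_of_nonneg_left hz (norm_nonneg w)
    nlinarith
  have hd : DiffContOnCl ℂ (fun z => z / ((ρ : ℂ) ^ 2 - conj w * z)) (ball 0 |ρ|) := by
    refine DifferentiableOn.diffContOnCl ?_
    intro z hz
    have hdz : DifferentiableAt ℂ (fun z => (ρ : ℂ) ^ 2 - conj w * z) z := by fun_prop
    exact (differentiableAt_id.div hdz
      (hne z (closure_ball_subset_closedBall hz))).differentiableWithinAt
  have h1 : Real.circleAverage (fun z => (z - w)⁻¹) 0 ρ =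
      Real.circleAverage (fun z => conj (z / ((ρ : ℂ) ^ 2 - conj w * z))) 0 ρ := by
    refine Real.circleAverage_congr_sphere fun z hz => ?_
    have hzn : ‖z‖ = ρ := by simpa [abs_of_pos hρ] using hz
    have hz0 : z ≠ 0 := norm_pos_iff.1 (hzn ▸ hρ)
    have h2 : (ρ : ℂ) ^ 2 = z * conj z := by
      rw [mul_conj, normSq_eq_norm_sq, hzn]
      simp
    have h3 : (ρ : ℂ) ^ 2 - w * conj z ≠ 0 := by
      have := hne z (by simp [hzn, abs_of_pos hρ])
      intro h0
      apply this
      have := congrArg conj h0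
      simpa using this
    have h4 : z - w ≠ 0 := fun h0 => by
      rw [sub_eq_zero.1 h0] at hzn
      linarith
    have h5 : conj z ≠ 0 := by simpa using hz0
    simp only [map_div₀, map_sub, map_mul, map_pow, conj_conj, conj_ofReal]
    rw [inv_eq_one_div, div_eq_div_iff h4 h3, h2]
    ring
  have h2 : Real.circleAverage (fun z => conj (z / ((ρ : ℂ) ^ 2 - conj w * z))) 0 ρ =
      conj (Real.circleAverage (fun z => z / ((ρ : ℂ) ^ 2 - conj w * z)) 0 ρ) := by
    simp only [Real.circleAverage, intervalIntegral.integral_of_le Real.two_pi_pos.le,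
      integral_conj, real_smul, map_mul, conj_ofReal]
  rw [h1, h2, hd.circleAverage]
  simp

/-- Polar coordinates on discs, for integrable functions. -/
lemma setIntegral_ball_eq_circleAverage {f : ℂ → ℂ} (hm : Measurable f) {r : ℝ}
    (hf : IntegrableOn f (ball 0 r)) :
    ∫ z in ball 0 r, f z =
      ∫ ρ in Ioo 0 r, ((2 * Real.pi * ρ : ℝ) : ℂ) * Real.circleAverage f 0 ρ := by
  set F : ℂ → ℂ := (ball 0 r).indicator f with hF
  have hFm : Measurable F := hm.indicator measurableSet_ball
  have hpolm : Measurable fun p : ℝ × ℝ => Complex.polarCoord.symm p := by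
    simp only [Complex.polarCoord_symm_apply]
    fun_prop
  have hInt : IntegrableOn (fun p : ℝ × ℝ => p.1 • F (Complex.polarCoord.symm p))
      (Ioi 0 ×ˢ Ioo (-Real.pi) Real.pi) := by
    refine ⟨?_, ?_⟩
    · exact (measurable_fst.smul (hFm.comp hpolm)).aestronglyMeasurable
    · have h1 := Complex.lintegral_comp_polarCoord_symm fun z => ‖F z‖ₑ
      have ht : polarCoord.target = Ioi (0 : ℝ) ×ˢ Ioo (-Real.pi) Real.pi := rfl
      rw [ht] at h1
      have h2 : ∫⁻ p in Ioi 0 ×ˢ Ioo (-Real.pi) Real.pi,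
          ‖p.1 • F (Complex.polarCoord.symm p)‖ₑ =
          ∫⁻ p in Ioi (0 : ℝ) ×ˢ Ioo (-Real.pi) Real.pi,
            ENNReal.ofReal p.1 • ‖F (Complex.polarCoord.symm p)‖ₑ := by
        refine setLIntegral_congr_fun (measurableSet_Ioi.prod measurableSet_Ioo) fun p hp => ?_
        have : 0 ≤ p.1 := (mem_Ioi.1 hp.1).le
        rw [enorm_smul, smul_eq_mul, Real.enorm_of_nonneg this]
      rw [HasFiniteIntegral, h2, h1]
      have := ((integrable_indicator_iff measurableSet_ball).2 hf).2
      exact this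
  have ht : polarCoord.target = Ioi (0 : ℝ) ×ˢ Ioo (-Real.pi) Real.pi := rfl
  rw [← integral_indicator measurableSet_ball, ← hF, ← Complex.integral_comp_polarCoord_symm,
    ht, Measure.volume_eq_prod, setIntegral_prod _ hInt]
  have hInd : ∀ ρ ∈ Ioi (0 : ℝ), (∫ θ in Ioo (-Real.pi) Real.pi,
      ρ • F (Complex.polarCoord.symm (ρ, θ))) = (Iio r).indicator
        (fun ρ => ((2 * Real.pi * ρ : ℝ) : ℂ) * Real.circleAverage f 0 ρ) ρ := by
    intro ρ hρ
    have hρ0 : 0 < ρ := hρ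
    have hcm : ∀ θ : ℝ, Complex.polarCoord.symm (ρ, θ) = circleMap 0 ρ θ := fun θ => by
      rw [Complex.polarCoord_symm_apply, circleMap_zero, exp_mul_I]
      simp
    simp only [hcm]
    have hmem : ∀ θ, circleMap 0 ρ θ ∈ ball (0 : ℂ) r ↔ ρ < r := fun θ => by
      rw [mem_ball_zero_iff, norm_circleMap_zero, abs_of_pos hρ0]
    by_cases h : ρ < r
    · rw [indicator_of_mem (mem_Iio.2 h)]
      have e1 : ∀ θ, F (circleMap 0 ρ θ) = f (circleMap 0 ρ θ) := fun θ =>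
        indicator_of_mem ((hmem θ).2 h) _
      simp only [e1]
      rw [integral_smul, Real.circleAverage, ← integral_Ioc_eq_integral_Ioo,
        ← intervalIntegral.integral_of_le (by linarith [Real.pi_pos])]
      have hper : Function.Periodic (fun θ => f (circleMap 0 ρ θ)) (2 * Real.pi) := fun θ => by
        simp only [periodic_circleMap 0 ρ θ]
      have h3 := hper.intervalIntegral_add_eq (-Real.pi) 0
      rw [show -Real.pi + 2 * Real.pi = Real.pi by ring, zero_add] at h3
      rw [h3, real_smul, real_smul]
      push_cast
      have : (Real.pi : ℂ) ≠ 0 := ofReal_ne_zero.2 Real.pi_ne_zero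
      field_simp
    · rw [indicator_of_notMem (by simpa using h)]
      have e1 : ∀ θ, F (circleMap 0 ρ θ) = 0 := fun θ =>
        indicator_of_notMem (fun h' => h ((hmem θ).1 h')) _
      simp [e1]
  rw [setIntegral_congr_fun measurableSet_Ioi hInd, integral_indicator measurableSet_Iio,
    Measure.restrict_restrict measurableSet_Iio, Iio_inter_Ioi]

/-- The Cauchy transform of a disc, inside the disc. -/
lemma integral_ball_sub_inv {r : ℝ} {w : ℂ} (hw : ‖w‖ < r) :
    ∫ z in ball 0 r, (z - w)⁻¹ = -Real.pi * conj w := by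
  rw [setIntegral_ball_eq_circleAverage (measurable_sub_inv w)
    (integrableOn_sub_inv isBounded_ball w)]
  have h1 : ∫ ρ in Ioo 0 r, ((2 * Real.pi * ρ : ℝ) : ℂ) *
      Real.circleAverage (fun z => (z - w)⁻¹) 0 ρ =
      ∫ ρ in Ioo 0 r, (Iio ‖w‖).indicator
        (fun ρ : ℝ => ((2 * Real.pi * ρ : ℝ) : ℂ) * -w⁻¹) ρ := by
    refine integral_congr_ae ?_
    have hae : ∀ᵐ ρ : ℝ ∂volume.restrict (Ioo 0 r), ρ ≠ ‖w‖ :=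
      ae_restrict_of_ae (Measure.ae_ne volume ‖w‖)
    filter_upwards [hae, ae_restrict_mem measurableSet_Ioo] with ρ hne hρ
    rcases lt_or_gt_of_ne hne with h | h
    · rw [indicator_of_mem (mem_Iio.2 h), circleAverage_sub_inv_of_lt hρ.1 h]
    · rw [indicator_of_notMem (by simpa using h.le), circleAverage_sub_inv_of_gt h, mul_zero]
  rw [h1, integral_indicator measurableSet_Iio, Measure.restrict_restrict measurableSet_Iio]
  have h2 : Iio ‖w‖ ∩ Ioo 0 r = Ioo 0 ‖w‖ := by
    ext x
    simp only [mem_inter_iff, mem_Iio, mem_Ioo]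
    constructor
    · rintro ⟨a, b, c⟩
      exact ⟨b, a⟩
    · rintro ⟨a, b⟩
      exact ⟨b, a, b.trans hw⟩
  rw [h2, integral_mul_const, integral_complex_ofReal, ← integral_Ioc_eq_integral_Ioo,
    ← intervalIntegral.integral_of_le (norm_nonneg w), intervalIntegral.integral_const_mul,
    integral_id]
  by_cases h0 : w = 0
  · simp [h0]
  · have h3 : ((‖w‖ : ℝ) : ℂ) ^ 2 = w * conj w := by
      rw [mul_conj, normSq_eq_norm_sq]
      simp
    push_cast
    rw [h3]
    field_simp
    ring

/-- The Cauchy transform of the area measure of a set. -/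
def areaCauchy (Ω : Set ℂ) (w : ℂ) : ℂ := ∫ z in Ω, (z - w)⁻¹

lemma areaCauchy_union {A B : Set ℂ} (hA : Bornology.IsBounded A) (hB : Bornology.IsBounded B)
    (hBm : MeasurableSet B) (hd : Disjoint A B) (w : ℂ) :
    areaCauchy (A ∪ B) w = areaCauchy A w + areaCauchy B w :=
  setIntegral_union hd hBm (integrableOn_sub_inv hA w) (integrableOn_sub_inv hB w)

lemma differentiableOn_areaCauchy {A K : Set ℂ} (hA : Bornology.IsBounded A)
    (hAm : MeasurableSet A) (hK : IsClosed K) (hAK : A ⊆ K) :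
    DifferentiableOn ℂ (areaCauchy A) Kᶜ := by
  have hfin : IsFiniteMeasure (volume.restrict A) :=
    isFiniteMeasure_restrict.2 hA.measure_lt_top.ne
  have := differentiableOn_cauchyTransform (μ := volume.restrict A) (φ := fun _ => 1)
    (integrable_const 1) hK (by
      filter_upwards [ae_restrict_mem hAm] with z hz using hAK hz)
  simp only [one_mul] at this
  exact this

lemma areaCauchy_ball {c w : ℂ} {r : ℝ} (hw : w ∈ ball c r) :
    areaCauchy (ball c r) w = -Real.pi * conj (w - c) := by
  have h := setIntegral_ball_sub_eq (fun z => (z - (w - c))⁻¹) c r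
  rw [integral_ball_sub_inv (by rwa [mem_ball, dist_eq_norm] at hw)] at h
  rw [← h, areaCauchy]
  congr 1
  ext z
  ring_nf

/-- On `Ω`, the area Cauchy transform is `-π conj w` up to a holomorphic function. -/
lemma differentiableOn_areaCauchy_add_conj {Ω : Set ℂ} (hb : Bornology.IsBounded Ω)
    (ho : IsOpen Ω) :
    DifferentiableOn ℂ (fun w => areaCauchy Ω w + Real.pi * conj w) Ω := by
  intro c hc
  obtain ⟨r, hr, hball⟩ := Metric.isOpen_iff.1 ho c hc
  have hdec : ∀ w ∈ ball c r, areaCauchy Ω w + Real.pi * conj w =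
      areaCauchy (Ω \ ball c r) w + Real.pi * conj c := by
    intro w hw
    have h1 := areaCauchy_union (hb.subset Set.sdiff_subset) isBounded_ball
      measurableSet_ball (disjoint_sdiff_left (s := ball c r) (t := Ω)) w
    rw [Set.sdiff_union_of_subset hball, areaCauchy_ball hw] at h1
    rw [h1, map_sub]
    ring
  have hd := differentiableOn_areaCauchy (hb.subset Set.sdiff_subset)
    (ho.measurableSet.diff measurableSet_ball) isOpen_ball.isClosed_compl
    (fun z hz => hz.2 : Ω \ ball c r ⊆ (ball c r)ᶜ)
  rw [compl_compl] at hd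
  have hda := (hd.differentiableAt (ball_mem_nhds c hr)).add_const (Real.pi * conj c)
  refine (hda.congr_of_eventuallyEq ?_).differentiableWithinAt
  filter_upwards [ball_mem_nhds c hr] with w hw using hdec w hw

/-- The area Cauchy transform of a bounded set is continuous. -/
lemma continuous_areaCauchy {A : Set ℂ} (hA : Bornology.IsBounded A) :
    Continuous (areaCauchy A) := by
  have hfin : IsFiniteMeasure (volume.restrict A) :=
    isFiniteMeasure_restrict.2 hA.measure_lt_top.ne
  let k : ℝ → ℂ → ℂ := fun ε z => conj z / ((max ‖z‖ ε : ℝ) : ℂ) ^ 2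
  have hk_cont : ∀ ε, 0 < ε → Continuous (k ε) := by
    intro ε hε
    refine continuous_conj.div (by fun_prop) fun z => ?_
    have : 0 < max ‖z‖ ε := lt_max_of_lt_right hε
    exact pow_ne_zero _ (ofReal_ne_zero.2 this.ne')
  have hk_norm : ∀ ε, 0 < ε → ∀ z, ‖k ε z‖ = ‖z‖ / (max ‖z‖ ε) ^ 2 := by
    intro ε hε z
    have : 0 < max ‖z‖ ε := lt_max_of_lt_right hε
    simp only [k, norm_div, RCLike.norm_conj, norm_pow, norm_real, Real.norm_eq_abs,
      abs_of_pos this]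
  have hk_le : ∀ ε, 0 < ε → ∀ z, ‖k ε z‖ ≤ ε⁻¹ := by
    intro ε hε z
    have h0 : 0 < max ‖z‖ ε := lt_max_of_lt_right hε
    rw [hk_norm ε hε, div_le_iff₀ (by positivity), inv_mul_eq_div, le_div_iff₀ hε, pow_two]
    exact mul_le_mul (le_max_left _ _) (le_max_right _ _) hε.le h0.le
  have hk_le' : ∀ ε, 0 < ε → ∀ z, ‖k ε z‖ ≤ ‖z‖⁻¹ := by
    intro ε hε z
    have h0 : 0 < max ‖z‖ ε := lt_max_of_lt_right hε
    rcases eq_or_ne z 0 with rfl | hz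
    · rw [hk_norm ε hε]
      simp
    · have hz' := norm_pos_iff.2 hz
      rw [hk_norm ε hε, div_le_iff₀ (by positivity), inv_mul_eq_div, le_div_iff₀ hz', pow_two]
      exact mul_le_mul (le_max_left _ _) (le_max_left _ _) hz'.le h0.le
  have hk_eq : ∀ ε z, 0 < ε → ε ≤ ‖z‖ → k ε z = z⁻¹ := by
    intro ε z hε hz
    have hz0 : z ≠ 0 := norm_pos_iff.1 (hε.trans_le hz)
    simp only [k, max_eq_left hz]
    rw [inv_def, normSq_eq_norm_sq, div_eq_mul_inv]
    push_cast
    rfl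
  refine continuous_of_uniform_approx_of_continuous fun u hu => ?_
  obtain ⟨η, hη, hηu⟩ := Metric.mem_uniformity_dist.1 hu
  set ε : ℝ := η / (4 * Real.pi + 1) / 2 with hεdef
  have hε : 0 < ε := by positivity
  refine ⟨fun w => ∫ z in A, k ε (z - w), ?_, fun w => hηu ?_⟩
  · refine continuous_of_dominated (bound := fun _ => ε⁻¹) (fun w => ?_) (fun w => ?_)
      (integrable_const _) ?_
    · exact ((hk_cont ε hε).comp (by fun_prop)).aestronglyMeasurable
    · exact Eventually.of_forall fun z => hk_le ε hε _
    · exact Eventually.of_forall fun z => (hk_cont ε hε).comp (by fun_prop)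
  · rw [dist_eq_norm, areaCauchy]
    have hik : IntegrableOn (fun z => k ε (z - w)) A :=
      Integrable.mono' (integrable_const ε⁻¹)
        ((hk_cont ε hε).comp (by fun_prop)).aestronglyMeasurable
        (Eventually.of_forall fun z => hk_le ε hε _)
    rw [← integral_sub (integrableOn_sub_inv hA w) hik]
    have hib : IntegrableOn (fun z : ℂ => ‖z - w‖⁻¹) (ball w ε) := by
      have := (integrableOn_sub_inv (isBounded_ball (x := w) (r := ε)) w).norm
      simp only [norm_inv] at this
      exact this
    have hIb : Integrable ((ball w ε).indicator fun z : ℂ => 2 * ‖z - w‖⁻¹) :=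
      (integrable_indicator_iff measurableSet_ball).2 (hib.const_mul 2)
    calc ‖∫ z in A, ((z - w)⁻¹ - k ε (z - w))‖
        ≤ ∫ z in A, (ball w ε).indicator (fun z => 2 * ‖z - w‖⁻¹) z := by
          refine norm_integral_le_of_norm_le hIb.integrableOn (Eventually.of_forall fun z => ?_)
          by_cases hz : z ∈ ball w ε
          · rw [indicator_of_mem hz, two_mul]
            refine (norm_sub_le _ _).trans (add_le_add ?_ (hk_le' ε hε _))
            rw [norm_inv]
          · rw [indicator_of_notMem hz, hk_eq ε _ hε (by
              rw [mem_ball, dist_eq_norm, not_lt] at hz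
              exact hz)]
            simp
      _ ≤ ∫ z, (ball w ε).indicator (fun z => 2 * ‖z - w‖⁻¹) z := by
          refine setIntegral_le_integral hIb (Eventually.of_forall fun z => ?_)
          exact indicator_nonneg (fun z _ => by positivity) z
      _ = 2 * (2 * Real.pi * ε) := by
          rw [integral_indicator measurableSet_ball, integral_const_mul]
          congr 1
          have h1 := setIntegral_ball_sub_eq (fun z => ((‖z‖⁻¹ : ℝ) : ℂ)) w ε
          rw [integral_complex_ofReal, integral_complex_ofReal, integral_norm_inv_ball hε.le] at h1
          exact_mod_cast h1
      _ < η := by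
          rw [hεdef]
          have := Real.pi_pos
          have h2 : 2 * (2 * Real.pi * (η / (4 * Real.pi + 1) / 2)) =
              η * (2 * Real.pi / (4 * Real.pi + 1)) := by
            field_simp
          rw [h2]
          have h3 : 2 * Real.pi / (4 * Real.pi + 1) < 1 := by
            rw [div_lt_one (by positivity)]
            linarith
          nlinarith

/-- A finite sum of functions which are, on `T`, quotients with poles in `Ω` is again one. -/
lemma exists_prodSub_sum {ι : Type*} {Ω T : Set ℂ} (s : Finset ι) (F : ι → ℂ → ℂ)
    (h : ∀ i ∈ s, ∃ (p : ℂ → ℂ) (l : List ℂ), (∀ a ∈ l, a ∈ Ω) ∧ Differentiable ℂ p ∧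
      ∀ w ∈ T, F i w * prodSub l w = p w) :
    ∃ (p : ℂ → ℂ) (l : List ℂ), (∀ a ∈ l, a ∈ Ω) ∧ Differentiable ℂ p ∧
      ∀ w ∈ T, (∑ i ∈ s, F i w) * prodSub l w = p w := by
  classical
  induction s using Finset.induction_on with
  | empty => exact ⟨0, [], by simp, differentiable_const _, by simp⟩
  | insert i s hi ih =>
    obtain ⟨p, l, hl, hp, hpl⟩ := h i (Finset.mem_insert_self i s)
    obtain ⟨q, k, hk, hq, hqk⟩ := ih fun j hj => h j (Finset.mem_insert_of_mem hj)
    refine ⟨fun w => p w * prodSub k w + q w * prodSub l w, l ++ k, ?_, ?_, fun w hw => ?_⟩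
    · intro a ha
      rcases List.mem_append.1 ha with h | h
      exacts [hl a h, hk a h]
    · exact (hp.mul (differentiable_prodSub k)).add (hq.mul (differentiable_prodSub l))
    · beta_reduce
      rw [Finset.sum_insert hi, prodSub_append, ← hpl w hw, ← hqk w hw]
      ring

/-- The area Cauchy transform of a quadrature domain is, outside the domain, a quotient of an
entire function by a polynomial with zeros in the domain. -/
lemma IsQuadratureDomain.exists_areaCauchy_mul_prodSub {Ω : Set ℂ} (ho : IsOpen Ω)
    (hb : Bornology.IsBounded Ω) (hq : IsQuadratureDomain Ω) :
    ∃ (p : ℂ → ℂ) (l : List ℂ), (∀ a ∈ l, a ∈ Ω) ∧ Differentiable ℂ p ∧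
      ∀ w ∈ (closure Ω)ᶜ, areaCauchy Ω w * prodSub l w = p w := by
  obtain ⟨N, -, a, n, c, ha, hquad⟩ := hq
  have hder : ∀ w k, ∀ z ∈ Ω, iteratedDerivWithin k (fun ζ => (ζ - w)⁻¹) Ω z =
      (-1) ^ k * k.factorial * (z - w) ^ (-1 - k : ℤ) := by
    intro w k z hz
    rw [iteratedDerivWithin_of_isOpen ho hz, iteratedDeriv_eq_iterate]
    have := congrFun (iter_deriv_inv_linear_sub (𝕜 := ℂ) k 1 w) z
    simpa using this
  have key : ∀ w ∈ (closure Ω)ᶜ, areaCauchy Ω w = ∑ j, ∑ k ∈ Finset.range (n j + 1),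
      c j k * ((-1) ^ k * k.factorial * (a j - w) ^ (-1 - k : ℤ)) := by
    intro w hw
    have hne : ∀ z ∈ Ω, z - w ≠ 0 := fun z hz h =>
      hw (by rw [← sub_eq_zero.1 h]; exact subset_closure hz)
    have hB : BergmanFun Ω fun ζ => (ζ - w)⁻¹ := by
      refine ⟨fun z hz => ((differentiableAt_id.sub_const w).inv
        (hne z hz)).differentiableWithinAt, ?_⟩
      obtain ⟨ε, hε, hball⟩ := Metric.isOpen_iff.1 isClosed_closure.isOpen_compl w hw
      refine Measure.integrableOn_of_bounded (M := (ε⁻¹) ^ 2) hb.measure_lt_top.ne ?_ ?_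
      · exact ((measurable_sub_inv w).norm.pow_const 2).aestronglyMeasurable
      · filter_upwards [ae_restrict_mem ho.measurableSet] with z hz
        have h1 : ε ≤ ‖z - w‖ := by
          by_contra! h
          exact hball (by rwa [mem_ball, dist_eq_norm]) (subset_closure hz)
        rw [Real.norm_of_nonneg (by positivity), norm_inv]
        gcongr
    rw [areaCauchy, hquad _ hB]
    refine Finset.sum_congr rfl fun j _ => Finset.sum_congr rfl fun k _ => ?_
    rw [hder w k _ (ha j)]
  have hsum := exists_prodSub_sum (Ω := Ω) (T := (closure Ω)ᶜ) (Finset.univ : Finset (Fin N))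
    (fun j w => ∑ k ∈ Finset.range (n j + 1),
      c j k * ((-1) ^ k * k.factorial * (a j - w) ^ (-1 - k : ℤ))) fun j _ => by
    refine exists_prodSub_sum _ (fun k w =>
      c j k * ((-1) ^ k * k.factorial * (a j - w) ^ (-1 - k : ℤ))) fun k _ => ?_
    refine ⟨fun _ => c j k * ((-1) ^ k * k.factorial * (-1) ^ (k + 1)),
      List.replicate (k + 1) (a j), fun b hb => ?_, differentiable_const _, fun w hw => ?_⟩
    · rw [List.eq_of_mem_replicate hb]
      exact ha j
    · have hne : a j - w ≠ 0 := fun h =>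
        hw (by rw [← sub_eq_zero.1 h]; exact subset_closure (ha j))
      rw [prodSub_replicate, show (w - a j) = (-1) * (a j - w) by ring, mul_pow,
        show (-1 - k : ℤ) = -((k + 1 : ℕ) : ℤ) by push_cast; ring, zpow_neg, zpow_natCast]
      have : (a j - w) ^ (k + 1) ≠ 0 := pow_ne_zero _ hne
      field_simp
  obtain ⟨p, l, hl, hp, h⟩ := hsum
  exact ⟨p, l, hl, hp, fun w hw => by rw [key w hw]; exact h w hw⟩

/-- The difference of the Cauchy kernels at two points placed symmetrically about `c`. -/
def jumpKernel (ζ : ℝ → ℂ) (c : ℂ) (t x : ℝ) : ℂ :=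
  (ζ x - (c + t * I))⁻¹ - (ζ x - (c - t * I))⁻¹

/-- A primitive of the jump kernel, as a function of position on the curve. -/
def jumpLog (v : ℂ) (t : ℝ) : ℂ := log (I * (v - t * I)) - log (-(I * (v + t * I)))

lemma tendsto_jumpLog_of_re_pos {v : ℂ} (hv : 0 < v.re) :
    Tendsto (fun q : ℂ × ℝ => jumpLog (v - q.1) q.2) (𝓝 (0, 0)) (𝓝 (Real.pi * I)) := by
  have him : (I * v).im = v.re := by simp
  have h1 : I * v ∈ slitPlane := Or.inr (by rw [him]; exact hv.ne')
  have h2 : -(I * v) ∈ slitPlane := by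
    refine Or.inr ?_
    rw [neg_im, him]
    exact (neg_lt_zero.2 hv).ne
  have hval : jumpLog v 0 = Real.pi * I := by
    simp only [jumpLog, ofReal_zero, zero_mul, sub_zero, add_zero, log, norm_neg,
      arg_neg_eq_arg_sub_pi_of_im_pos (show 0 < (I * v).im by rw [him]; exact hv)]
    push_cast
    ring
  rw [← hval]
  have hc : ContinuousAt (fun q : ℂ × ℝ => jumpLog (v - q.1) q.2) (0, 0) := by
    unfold jumpLog
    refine ContinuousAt.sub (ContinuousAt.clog (by fun_prop) ?_)
      (ContinuousAt.clog (by fun_prop) ?_) <;> simpa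
  have := hc.tendsto
  simpa using this

lemma tendsto_jumpLog_of_re_neg {v : ℂ} (hv : v.re < 0) :
    Tendsto (fun q : ℂ × ℝ => jumpLog (v - q.1) q.2) (𝓝 (0, 0)) (𝓝 (-(Real.pi * I))) := by
  have him : (I * v).im = v.re := by simp
  have h1 : I * v ∈ slitPlane := Or.inr (by rw [him]; exact hv.ne)
  have h2 : -(I * v) ∈ slitPlane := by
    refine Or.inr ?_
    rw [neg_im, him]
    exact (neg_pos.2 hv).ne'
  have hval : jumpLog v 0 = -(Real.pi * I) := by
    simp only [jumpLog, ofReal_zero, zero_mul, sub_zero, add_zero, log, norm_neg,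
      arg_neg_eq_arg_add_pi_of_im_neg (show (I * v).im < 0 by rw [him]; exact hv)]
    push_cast
    ring
  rw [← hval]
  have hc : ContinuousAt (fun q : ℂ × ℝ => jumpLog (v - q.1) q.2) (0, 0) := by
    unfold jumpLog
    refine ContinuousAt.sub (ContinuousAt.clog (by fun_prop) ?_)
      (ContinuousAt.clog (by fun_prop) ?_) <;> simpa
  have := hc.tendsto
  simpa using this

/-- The jump kernel integrated against `dζ`. -/
lemma integral_deriv_mul_jumpKernel {ζ ζ' : ℝ → ℂ} {a b : ℝ}
    (hd : ∀ x ∈ uIcc a b, HasDerivAt ζ (ζ' x) x) (hc : ContinuousOn ζ' (uIcc a b)) {c : ℂ} {t : ℝ}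
    (ht : 0 < t) (hinj : ∀ x ∈ uIcc a b, (ζ x).re = c.re → ζ x = c) :
    ∫ x in a..b, ζ' x * jumpKernel ζ c t x = jumpLog (ζ b - c) t - jumpLog (ζ a - c) t := by
  have hs1 : ∀ x ∈ uIcc a b, I * (ζ x - c - t * I) ∈ slitPlane := by
    intro x hx
    by_cases h : (ζ x).re = c.re
    · rw [hinj x hx h]
      refine Or.inl ?_
      simpa using ht
    · refine Or.inr ?_
      simpa [sub_eq_zero] using h
  have hs2 : ∀ x ∈ uIcc a b, -(I * (ζ x - c + t * I)) ∈ slitPlane := by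
    intro x hx
    by_cases h : (ζ x).re = c.re
    · rw [hinj x hx h]
      refine Or.inl ?_
      simpa using ht
    · refine Or.inr ?_
      simp only [neg_im, mul_im, I_re, I_im, add_re, sub_re, mul_re, ofReal_re, ofReal_im]
      intro h'
      apply h
      linarith
  have hn1 : ∀ x ∈ uIcc a b, ζ x - (c + t * I) ≠ 0 := fun x hx h =>
    slitPlane_ne_zero (hs1 x hx) (by rw [sub_sub, h, mul_zero])
  have hn2 : ∀ x ∈ uIcc a b, ζ x - (c - t * I) ≠ 0 := fun x hx h =>
    slitPlane_ne_zero (hs2 x hx) (by rw [← sub_add] at h; rw [h]; simp)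
  have hζ : ContinuousOn ζ (uIcc a b) := fun x hx => (hd x hx).continuousAt.continuousWithinAt
  refine intervalIntegral.integral_eq_sub_of_hasDerivAt
    (f := fun x => jumpLog (ζ x - c) t) (fun x hx => ?_) ?_
  · have e1 := (((hd x hx).sub_const c).sub_const (t * I)).const_mul I |>.clog_real (hs1 x hx)
    have e2 := ((((hd x hx).sub_const c).add_const (t * I)).const_mul I).neg.clog_real (hs2 x hx)
    refine (e1.sub e2).congr_deriv ?_
    have a1 := hn1 x hx
    have a2 := hn2 x hx
    have a1' : ζ x - c - t * I ≠ 0 := by rwa [sub_sub]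
    have a2' : ζ x - c + t * I ≠ 0 := by rwa [sub_add]
    rw [jumpKernel, ← sub_sub, ← sub_add, Pi.neg_apply, neg_div_neg_eq,
      mul_div_mul_left _ _ I_ne_zero, mul_div_mul_left _ _ I_ne_zero]
    ring
  · refine ContinuousOn.intervalIntegrable ?_
    exact hc.mul (((hζ.sub continuousOn_const).inv₀ hn1).sub
      ((hζ.sub continuousOn_const).inv₀ hn2))

lemma norm_jumpKernel_le {g : ℝ → ℝ} {ζ : ℝ → ℂ} (hζ : ∀ x, ζ x = x + g x * I)
    (hg : ∀ x y, |g x - g y| ≤ |x - y| / 2) {t : ℝ} (ht : 0 < t) (x₀ x : ℝ) :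
    ‖jumpKernel ζ (ζ x₀) t x‖ ≤ 4 * (t * ((x - x₀) ^ 2 + t ^ 2)⁻¹) := by
  set A := (x - x₀) ^ 2 + t ^ 2 with hA
  have hApos : 0 < A := by positivity
  have hb : (g x - g x₀) ^ 2 ≤ (x - x₀) ^ 2 / 4 := by
    have := pow_le_pow_left₀ (abs_nonneg _) (hg x x₀) 2
    rw [sq_abs, div_pow, sq_abs] at this
    linarith
  have hlow : ∀ s : ℝ, s ^ 2 = t ^ 2 → A / 2 ≤ ‖ζ x - (ζ x₀ + s * I)‖ ^ 2 := by
    intro s hs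
    rw [← normSq_eq_norm_sq, hζ, hζ, normSq_apply]
    simp only [sub_re, add_re, ofReal_re, mul_re, I_re, mul_zero, ofReal_im, I_im, sub_im, add_im,
      mul_im, mul_one, zero_add]
    rw [hA, ← hs]
    nlinarith [sq_nonneg (s - 2 * (g x - g x₀)), sq_nonneg (x - x₀)]
  have h1 := hlow t rfl
  have h2 := hlow (-t) (by ring)
  rw [ofReal_neg, neg_mul, ← sub_eq_add_neg] at h2
  set p := ζ x - (ζ x₀ + t * I)
  set q := ζ x - (ζ x₀ - t * I)
  have hp : 0 < ‖p‖ := by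
    by_contra! h
    have : ‖p‖ = 0 := le_antisymm h (norm_nonneg _)
    rw [this] at h1
    linarith
  have hq : 0 < ‖q‖ := by
    by_contra! h
    have : ‖q‖ = 0 := le_antisymm h (norm_nonneg _)
    rw [this] at h2
    linarith
  have hpq : A / 2 ≤ ‖p‖ * ‖q‖ := by
    refine (pow_le_pow_iff_left₀ (by positivity) (by positivity) two_ne_zero).1 ?_
    rw [mul_pow, pow_two (A / 2)]
    exact mul_le_mul h1 h2 (by positivity) (by positivity)
  have he : jumpKernel ζ (ζ x₀) t x = 2 * t * I / (p * q) := by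
    rw [jumpKernel, inv_sub_inv (norm_pos_iff.1 hp) (norm_pos_iff.1 hq)]
    congr 1
    ring
  rw [he, norm_div, norm_mul, norm_mul, norm_mul, norm_I, norm_real, Real.norm_of_nonneg ht.le,
    ← div_eq_mul_inv, RCLike.norm_ofNat, mul_one, ← mul_div_assoc,
    div_le_div_iff₀ (by positivity) hApos]
  nlinarith

lemma integrable_poisson {t : ℝ} (ht : 0 < t) (x₀ : ℝ) :
    Integrable (fun x => t * ((x - x₀) ^ 2 + t ^ 2)⁻¹) ∧
      ∫ x, t * ((x - x₀) ^ 2 + t ^ 2)⁻¹ = Real.pi := by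
  have h := ProbabilityTheory.integral_cauchyPDFReal_eq_one x₀
    (γ := t.toNNReal) (Real.toNNReal_pos.2 ht).ne'
  have hi := integrable_of_integral_eq_one h
  have he : (fun x => t * ((x - x₀) ^ 2 + t ^ 2)⁻¹) =
      fun x => Real.pi * ProbabilityTheory.cauchyPDFReal x₀ t.toNNReal x := by
    ext x
    rw [ProbabilityTheory.cauchyPDFReal_def]
    have := Real.pi_ne_zero
    rw [Real.coe_toNNReal t ht.le]
    field_simp
  rw [he, integral_const_mul, h, mul_one]
  exact ⟨hi.const_mul _, rfl⟩

/-- Densities vanishing at the origin produce no jump there. -/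
lemma tendsto_integral_mul_jumpKernel_zero {g : ℝ → ℝ} {ζ : ℝ → ℂ} (hζ : ∀ x, ζ x = x + g x * I)
    (hg : ∀ x y, |g x - g y| ≤ |x - y| / 2) {δ : ℝ} {χ : ℝ → ℂ} {M : ℝ}
    (hM : ∀ᵐ x ∂volume.restrict (Ioo (-δ) δ), ‖χ x‖ ≤ M)
    (hχ : ∀ ε > 0, ∃ η > 0, ∀ᵐ x ∂volume.restrict (Ioo (-δ) δ), |x| < η → ‖χ x‖ ≤ ε) :
    Tendsto (fun p : ℝ × ℝ => ∫ x in Ioo (-δ) δ, χ x * jumpKernel ζ (ζ p.1) p.2 x)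
      (𝓝 0 ×ˢ 𝓝[>] 0) (𝓝 0) := by
  wlog hM0 : 0 ≤ M generalizing M
  · exact this (hM.mono fun x hx => hx.trans (le_max_left M 0)) (le_max_right M 0)
  rw [Metric.tendsto_nhds]
  intro ε hε
  have hpi := Real.pi_pos
  obtain ⟨η, hη, hsmall⟩ := hχ (ε / (8 * Real.pi)) (by positivity)
  set B : ℝ := 16 * M * (η ^ 2)⁻¹ * (volume.real (Ioo (-δ) δ)) with hB
  have hB0 : 0 ≤ B := by positivity
  have hx0 : ∀ᶠ p : ℝ × ℝ in 𝓝 0 ×ˢ 𝓝[>] 0, |p.1| < η / 2 := by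
    refine (tendsto_fst (α := ℝ) (β := ℝ)).eventually (p := fun y => |y| < η / 2) ?_
    have := Metric.ball_mem_nhds (0 : ℝ) (half_pos hη)
    filter_upwards [this] with x hx
    simpa using hx
  have ht0 : ∀ᶠ p : ℝ × ℝ in 𝓝 0 ×ˢ 𝓝[>] 0, 0 < p.2 :=
    (tendsto_snd (α := ℝ) (β := ℝ)).eventually (p := fun s => 0 < s) self_mem_nhdsWithin
  have htB : ∀ᶠ p : ℝ × ℝ in 𝓝 0 ×ˢ 𝓝[>] 0, p.2 * (B + 1) < ε / 2 := by
    refine (tendsto_snd (α := ℝ) (β := ℝ)).eventually (p := fun s => s * (B + 1) < ε / 2) ?_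
    have : Tendsto (fun s : ℝ => s * (B + 1)) (𝓝[>] 0) (𝓝 (0 * (B + 1))) :=
      (continuous_mul_const (B + 1)).continuousAt.tendsto.mono_left nhdsWithin_le_nhds
    exact this.eventually (gt_mem_nhds (by rw [zero_mul]; positivity))
  filter_upwards [hx0, ht0, htB] with p hp1 hp2 hp3
  obtain ⟨x₀, t⟩ := p
  simp only at hp1 hp2 hp3 ⊢
  rw [dist_zero_right]
  obtain ⟨hPi, hPv⟩ := integrable_poisson hp2 x₀
  have hbound : ∀ᵐ x ∂volume.restrict (Ioo (-δ) δ), ‖χ x * jumpKernel ζ (ζ x₀) t x‖ ≤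
      ε / (8 * Real.pi) * 4 * (t * ((x - x₀) ^ 2 + t ^ 2)⁻¹) + 16 * M * (η ^ 2)⁻¹ * t := by
    filter_upwards [hM, hsmall] with x hx1 hx2
    rw [norm_mul]
    have hk := norm_jumpKernel_le hζ hg hp2 x₀ x
    have hP : 0 ≤ t * ((x - x₀) ^ 2 + t ^ 2)⁻¹ := by positivity
    by_cases h : |x| < η
    · have h1 := mul_le_mul (hx2 h) hk (norm_nonneg _) (by positivity)
      have h2 : 0 ≤ 16 * M * (η ^ 2)⁻¹ * t := by positivity
      linarith
    · have h1 := mul_le_mul hx1 hk (norm_nonneg _) hM0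
      have h2 : η / 2 ≤ |x - x₀| := by
        have := abs_sub_abs_le_abs_sub x x₀
        push Not at h
        linarith
      have h3 : η ^ 2 / 4 ≤ (x - x₀) ^ 2 + t ^ 2 := by
        have := pow_le_pow_left₀ (by positivity) h2 2
        rw [sq_abs] at this
        nlinarith [sq_nonneg t]
      have h4 : ((x - x₀) ^ 2 + t ^ 2)⁻¹ ≤ 4 * (η ^ 2)⁻¹ := by
        have := inv_anti₀ (by positivity) h3
        rwa [inv_div, div_eq_mul_inv] at this
      have h5 : M * (4 * (t * ((x - x₀) ^ 2 + t ^ 2)⁻¹)) ≤ M * (4 * (t * (4 * (η ^ 2)⁻¹))) := by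
        gcongr
      have h6 : 0 ≤ ε / (8 * Real.pi) * 4 * (t * ((x - x₀) ^ 2 + t ^ 2)⁻¹) := by positivity
      nlinarith
  have hfin : IsFiniteMeasure (volume.restrict (Ioo (-δ) δ)) :=
    isFiniteMeasure_restrict.2 measure_Ioo_lt_top.ne
  calc ‖∫ x in Ioo (-δ) δ, χ x * jumpKernel ζ (ζ x₀) t x‖
      ≤ ∫ x in Ioo (-δ) δ, (ε / (8 * Real.pi) * 4 * (t * ((x - x₀) ^ 2 + t ^ 2)⁻¹) +
          16 * M * (η ^ 2)⁻¹ * t) :=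
        norm_integral_le_of_norm_le ((hPi.integrableOn.const_mul _).add (integrable_const _)) hbound
    _ = ε / (8 * Real.pi) * 4 * (∫ x in Ioo (-δ) δ, (t * ((x - x₀) ^ 2 + t ^ 2)⁻¹)) + t * B := by
        rw [integral_add (hPi.integrableOn.const_mul _) (integrable_const _), integral_const_mul,
          integral_const, hB, measureReal_restrict_apply_univ, smul_eq_mul]
        ring
    _ ≤ ε / (8 * Real.pi) * 4 * Real.pi + t * B := by
        gcongr
        rw [← hPv]
        exact setIntegral_le_integral hPi (Eventually.of_forall fun x => by positivity)
    _ = ε / 2 + t * B := by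
        field_simp
        ring
    _ < ε := by nlinarith

/-- **Jump relation** for Cauchy integrals over a graph, with a density having an
(essential) limit at the origin. -/
lemma tendsto_integral_mul_jumpKernel {g g' : ℝ → ℝ} {ζ : ℝ → ℂ}
    (hζ : ∀ x, ζ x = x + g x * I) (hg : ∀ x y, |g x - g y| ≤ |x - y| / 2)
    (hgd : ∀ x, HasDerivAt g (g' x) x) (hgc : Continuous g') (hg0 : g 0 = 0) (hg'0 : g' 0 = 0)
    {δ : ℝ} (hδ : 0 < δ) {χ : ℝ → ℂ} {M : ℝ} {c : ℂ}
    (hm : AEStronglyMeasurable χ (volume.restrict (Ioo (-δ) δ)))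
    (hM : ∀ᵐ x ∂volume.restrict (Ioo (-δ) δ), ‖χ x‖ ≤ M)
    (hχ : ∀ ε > 0, ∃ η > 0, ∀ᵐ x ∂volume.restrict (Ioo (-δ) δ), |x| < η → ‖χ x - c‖ ≤ ε) :
    Tendsto (fun p : ℝ × ℝ => ∫ x in Ioo (-δ) δ, χ x * jumpKernel ζ (ζ p.1) p.2 x)
      (𝓝 0 ×ˢ 𝓝[>] 0) (𝓝 (2 * Real.pi * I * c)) := by
  set ζ' : ℝ → ℂ := fun x => 1 + g' x * I with hζ'
  have hζd : ∀ x, HasDerivAt ζ (ζ' x) x := by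
    intro x
    have : ζ = fun x : ℝ => (x : ℂ) + g x * I := funext hζ
    rw [this]
    exact (hasDerivAt_id x).ofReal_comp.add ((hgd x).ofReal_comp.mul_const I)
  have hζc : Continuous ζ' := by fun_prop
  have hζcont : Continuous ζ := continuous_iff_continuousAt.2 fun x => (hζd x).continuousAt
  have hre : ∀ x, (ζ x).re = x := fun x => by simp [hζ]
  have hζ0 : ζ 0 = 0 := by simp [hζ, hg0]
  have hne : ∀ (x₀ t x : ℝ), 0 < t → ζ x - (ζ x₀ + t * I) ≠ 0 ∧ ζ x - (ζ x₀ - t * I) ≠ 0 := by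
    intro x₀ t x ht
    constructor <;>
    · intro h
      have h1 : x = x₀ := by simpa [hre, sub_eq_zero] using congrArg re h
      subst h1
      simp [ht.ne'] at h
  have hKc : ∀ (x₀ t : ℝ), 0 < t → Continuous (jumpKernel ζ (ζ x₀) t) := fun x₀ t ht =>
    ((hζcont.sub continuous_const).inv₀ fun x => (hne x₀ t x ht).1).sub
      ((hζcont.sub continuous_const).inv₀ fun x => (hne x₀ t x ht).2)
  have hfin : IsFiniteMeasure (volume.restrict (Ioo (-δ) δ)) :=
    isFiniteMeasure_restrict.2 measure_Ioo_lt_top.ne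
  obtain ⟨M', hM'⟩ : ∃ M', ∀ x ∈ Icc (-δ) δ, ‖ζ' x‖ ≤ M' :=
    isCompact_Icc.exists_bound_of_continuousOn hζc.continuousOn
  have hz := tendsto_integral_mul_jumpKernel_zero hζ hg (δ := δ)
    (χ := fun x => χ x - c * ζ' x) (M := M + ‖c‖ * M') (by
      filter_upwards [hM, ae_restrict_mem measurableSet_Ioo] with x hx hxI
      refine (norm_sub_le _ _).trans (add_le_add hx ?_)
      rw [norm_mul]
      gcongr
      exact hM' x (Ioo_subset_Icc_self hxI)) (by
      intro ε hε
      obtain ⟨η, hη, h1⟩ := hχ (ε / 2) (half_pos hε)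
      have hc0 : ContinuousAt (fun x => c - c * ζ' x) 0 := by fun_prop
      have hv : c - c * ζ' 0 = 0 := by simp [hζ', hg'0]
      obtain ⟨η', hη', h2⟩ := Metric.continuousAt_iff.1 hc0 (ε / 2) (half_pos hε)
      refine ⟨min η η', lt_min hη hη', ?_⟩
      filter_upwards [h1] with x hx hxη
      have a1 := hx (hxη.trans_le (min_le_left _ _))
      have a2 := h2 (x := x) (by simpa using hxη.trans_le (min_le_right _ _))
      rw [hv, dist_zero_right] at a2
      calc ‖χ x - c * ζ' x‖ = ‖(χ x - c) + (c - c * ζ' x)‖ := by congr 1; ring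
        _ ≤ ‖χ x - c‖ + ‖c - c * ζ' x‖ := norm_add_le _ _
        _ ≤ ε := by linarith)
  have hlim : Tendsto (fun p : ℝ × ℝ => c * (jumpLog (ζ δ - ζ p.1) p.2 -
      jumpLog (ζ (-δ) - ζ p.1) p.2)) (𝓝 0 ×ˢ 𝓝[>] 0)
      (𝓝 (c * (Real.pi * I - -(Real.pi * I)))) := by
    have hb : Tendsto (fun p : ℝ × ℝ => (ζ p.1, p.2)) (𝓝 0 ×ˢ 𝓝[>] 0) (𝓝 (0, 0)) := by
      have : Tendsto (fun p : ℝ × ℝ => (ζ p.1, p.2)) (𝓝 (0, 0)) (𝓝 (ζ 0, 0)) :=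
        Continuous.tendsto (by fun_prop) ((0 : ℝ), (0 : ℝ))
      rw [hζ0, nhds_prod_eq] at this
      exact this.mono_left (Filter.prod_mono le_rfl nhdsWithin_le_nhds)
    exact (((tendsto_jumpLog_of_re_pos (by rw [hre]; exact hδ)).comp hb).sub
      ((tendsto_jumpLog_of_re_neg (by rw [hre]; linarith)).comp hb)).const_mul c
  have hsum := hz.add hlim
  rw [show (0 : ℂ) + c * (Real.pi * I - -(Real.pi * I)) = 2 * Real.pi * I * c by ring] at hsum
  refine hsum.congr' ?_
  have ht0 : ∀ᶠ p : ℝ × ℝ in 𝓝 0 ×ˢ 𝓝[>] 0, 0 < p.2 :=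
    (tendsto_snd (α := ℝ) (β := ℝ)).eventually (p := fun s => 0 < s) self_mem_nhdsWithin
  filter_upwards [ht0] with p hp
  rw [← integral_deriv_mul_jumpKernel (fun x _ => hζd x) hζc.continuousOn hp
    (fun x _ h => by rw [hre, hre] at h; rw [h]), intervalIntegral.integral_of_le (by linarith),
    integral_Ioc_eq_integral_Ioo, ← integral_const_mul]
  have i2 : IntegrableOn (fun x => c * (ζ' x * jumpKernel ζ (ζ p.1) p.2 x)) (Ioo (-δ) δ) :=
    ((continuous_const.mul (hζc.mul (hKc p.1 p.2 hp))).integrableOn_Icc).mono_set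
      Ioo_subset_Icc_self
  obtain ⟨M'', hM''⟩ : ∃ M'', ∀ x ∈ Icc (-δ) δ, ‖jumpKernel ζ (ζ p.1) p.2 x‖ ≤ M'' :=
    isCompact_Icc.exists_bound_of_continuousOn (hKc p.1 p.2 hp).continuousOn
  have iχ : IntegrableOn χ (Ioo (-δ) δ) := Integrable.mono' (integrable_const M) hm hM
  have i1 : IntegrableOn (fun x => χ x * jumpKernel ζ (ζ p.1) p.2 x) (Ioo (-δ) δ) := by
    refine Integrable.mul_bdd (c := M'') iχ (hKc p.1 p.2 hp).aestronglyMeasurable ?_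
    filter_upwards [ae_restrict_mem measurableSet_Ioo] with x hx
    exact hM'' x (Ioo_subset_Icc_self hx)
  have i3 : IntegrableOn (fun x => (χ x - c * ζ' x) * jumpKernel ζ (ζ p.1) p.2 x)
      (Ioo (-δ) δ) := by
    refine (i1.sub i2).congr (Eventually.of_forall fun x => ?_)
    simp only [Pi.sub_apply]
    ring
  rw [← integral_add i3 i2]
  congr 1
  ext x
  ring

/-- The part of the square of half-side `δ` which lies above the graph of `g`. -/
def graphRegion (g : ℝ → ℝ) (δ : ℝ) : Set ℂ := {z | |z.re| < δ ∧ g z.re < z.im ∧ z.im < δ}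

lemma isOpen_graphRegion {g : ℝ → ℝ} (hg : Continuous g) (δ : ℝ) : IsOpen (graphRegion g δ) := by
  simp only [graphRegion, Set.ofPred_and]
  exact (isOpen_lt (by fun_prop) continuous_const).inter
    ((isOpen_lt (by fun_prop) (by fun_prop)).inter (isOpen_lt (by fun_prop) continuous_const))

lemma isBounded_graphRegion {g : ℝ → ℝ} (hg : ∀ x, |g x| ≤ |x| / 2) (δ : ℝ) :
    Bornology.IsBounded (graphRegion g δ) := by
  refine (isBounded_ball (x := (0 : ℂ)) (r := δ + δ + 1)).subset fun z hz => ?_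
  rw [mem_ball_zero_iff]
  have h1 := hz.1
  have h2 := abs_le.1 (hg z.re)
  have h3 : |z.im| ≤ δ := abs_le.2 ⟨by linarith [h2.1, hz.2.1, abs_nonneg z.re], hz.2.2.le⟩
  linarith [norm_le_abs_re_add_abs_im z]

lemma areaCauchy_graphRegion {g : ℝ → ℝ} (hgc : Continuous g) (hg : ∀ x, |g x| ≤ |x| / 2)
    {δ : ℝ} (w : ℂ) :
    IntegrableOn (fun x : ℝ => ∫ y in Ioo (g x) δ, ((x : ℂ) + y * I - w)⁻¹) (Ioo (-δ) δ) ∧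
    areaCauchy (graphRegion g δ) w =
      ∫ x in Ioo (-δ) δ, ∫ y in Ioo (g x) δ, ((x : ℂ) + y * I - w)⁻¹ := by
  set D := graphRegion g δ
  have hDm : MeasurableSet D := (isOpen_graphRegion hgc δ).measurableSet
  have hInt : Integrable (D.indicator fun z => (z - w)⁻¹) :=
    (integrable_indicator_iff hDm).2 (integrableOn_sub_inv (isBounded_graphRegion hg δ) w)
  have hmp := (volume_preserving_equiv_real_prod).symm
  have hInt₂ := (hmp.integrable_comp_emb (MeasurableEquiv.measurableEmbedding _)).2 hInt
  have hval : ∀ x : ℝ, (∫ y : ℝ, D.indicator (fun z => (z - w)⁻¹)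
      (measurableEquivRealProd.symm (x, y))) = (Ioo (-δ) δ).indicator
        (fun x : ℝ => ∫ y in Ioo (g x) δ, ((x : ℂ) + y * I - w)⁻¹) x := by
    intro x
    by_cases hx : x ∈ Ioo (-δ) δ
    · rw [indicator_of_mem hx, ← integral_indicator measurableSet_Ioo]
      congr 1
      ext y
      by_cases hy : y ∈ Ioo (g x) δ
      · rw [indicator_of_mem hy, indicator_of_mem]
        · rw [measurableEquivRealProd_symm_apply, mk_eq_add_mul_I]
        · exact ⟨abs_lt.2 hx, hy.1, hy.2⟩
      · rw [indicator_of_notMem hy, indicator_of_notMem]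
        exact fun h => hy ⟨h.2.1, h.2.2⟩
    · rw [indicator_of_notMem hx]
      have : ∀ y : ℝ, D.indicator (fun z => (z - w)⁻¹)
          (measurableEquivRealProd.symm (x, y)) = 0 := fun y =>
        indicator_of_notMem (fun h => hx (abs_lt.1 h.1)) _
      simp only [this, integral_zero]
  rw [Measure.volume_eq_prod] at hInt₂
  have h1 := hInt₂.integral_prod_left
  have h2 := integral_prod _ hInt₂
  simp only [Function.comp_apply, hval] at h1 h2
  refine ⟨(integrable_indicator_iff measurableSet_Ioo).1 h1, ?_⟩
  rw [areaCauchy, ← integral_indicator hDm,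
    ← hmp.integral_comp (MeasurableEquiv.measurableEmbedding _), Measure.volume_eq_prod, h2,
    integral_indicator measurableSet_Ioo]

lemma hasDerivAt_integral_vertical {x a b : ℝ} {w : ℂ} (hx : x ≠ w.re) (hab : a < b) (s : ℝ) :
    HasDerivAt (fun s : ℝ => ∫ y in Ioo a b, ((x : ℂ) + y * I - (w + s * I))⁻¹)
      (((x : ℂ) + a * I - (w + s * I))⁻¹ - ((x : ℂ) + b * I - (w + s * I))⁻¹) s := by
  set k : ℝ → ℂ := fun y => ((x : ℂ) + y * I - w)⁻¹ with hk
  have hne : ∀ y : ℝ, (x : ℂ) + y * I - w ≠ 0 := fun y h => by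
    apply hx
    simpa [sub_eq_zero] using congrArg re h
  have hkc : Continuous k := Continuous.inv₀ (by fun_prop) hne
  set P : ℝ → ℂ := fun u => ∫ y in (0 : ℝ)..u, k y with hP
  have hPd : ∀ u, HasDerivAt P (k u) u := fun u => (hkc.integral_hasStrictDerivAt 0 u).hasDerivAt
  have hshift : ∀ y s : ℝ, ((x : ℂ) + y * I - (w + s * I))⁻¹ = k (y - s) := fun y s => by
    simp only [hk]
    push_cast
    ring_nf
  have hval : ∀ s : ℝ, (∫ y in Ioo a b, ((x : ℂ) + y * I - (w + s * I))⁻¹) =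
      P (b - s) - P (a - s) := by
    intro s
    simp only [hshift]
    rw [← integral_Ioc_eq_integral_Ioo, ← intervalIntegral.integral_of_le hab.le,
      intervalIntegral.integral_comp_sub_right, hP,
      intervalIntegral.integral_interval_sub_left (hkc.intervalIntegrable _ _)
        (hkc.intervalIntegrable _ _)]
  rw [funext hval, hshift, hshift]
  have h1 : ∀ c : ℝ, HasDerivAt (fun s => P (c - s)) (-k (c - s)) s := fun c => by
    have := (hPd (c - s)).scomp s ((hasDerivAt_id s).const_sub c)
    simpa [Function.comp_def] using this
  refine ((h1 b).sub (h1 a)).congr_deriv ?_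
  ring

/-- The Cauchy integral which is the vertical derivative of the area Cauchy transform of the
region above a graph. -/
def graphCauchy (g : ℝ → ℝ) (δ : ℝ) (w : ℂ) : ℂ :=
  ∫ x in Ioo (-δ) δ, (((x : ℂ) + g x * I - w)⁻¹ - ((x : ℂ) + δ * I - w)⁻¹)

lemma hasDerivAt_areaCauchy_graphRegion {g : ℝ → ℝ} (hg : ∀ x y, |g x - g y| ≤ |x - y| / 2)
    (hg0 : g 0 = 0) {δ : ℝ} {w : ℂ} (h2 : w.im < δ) (h3 : w.im ≠ g w.re) :
    HasDerivAt (fun s : ℝ => areaCauchy (graphRegion g δ) (w + s * I)) (graphCauchy g δ w) 0 := by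
  have hgc : Continuous g := by
    refine (LipschitzWith.of_dist_le_mul (K := 1 / 2) fun x y => ?_).continuous
    rw [Real.dist_eq, Real.dist_eq]
    have := hg x y
    push_cast
    linarith
  have hga : ∀ x, |g x| ≤ |x| / 2 := fun x => by simpa [hg0] using hg x 0
  set m := |g w.re - w.im| with hm
  have hmpos : 0 < m := abs_pos.2 (sub_ne_zero.2 h3.symm)
  have hd1 : ∀ x : ℝ, m / 2 ≤ ‖(x : ℂ) + g x * I - w‖ := by
    intro x
    by_cases h : m / 2 ≤ |x - w.re|
    · refine h.trans ?_
      have := abs_re_le_norm ((x : ℂ) + g x * I - w)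
      simpa using this
    · have h4 := abs_im_le_norm ((x : ℂ) + g x * I - w)
      have h5 : ((x : ℂ) + g x * I - w).im = g x - w.im := by simp
      rw [h5] at h4
      have h6 := hg x w.re
      have h7 : m ≤ |g x - w.im| + |g x - g w.re| := by
        rw [hm, abs_sub_comm (g x) (g w.re)]
        have := abs_add_le (g w.re - g x) (g x - w.im)
        rw [sub_add_sub_cancel] at this
        linarith
      push Not at h
      linarith
  have hd2 : ∀ x : ℝ, δ - w.im ≤ ‖(x : ℂ) + δ * I - w‖ := by
    intro x
    have h4 := abs_im_le_norm ((x : ℂ) + δ * I - w)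
    have h5 : ((x : ℂ) + δ * I - w).im = δ - w.im := by simp
    rw [h5] at h4
    exact (le_abs_self _).trans h4
  set ε := min (m / 4) ((δ - w.im) / 2) with hε
  have hεpos : 0 < ε := lt_min (by linarith) (by linarith)
  have hlow : ∀ (v : ℂ) (s : ℝ), |s| < ε → 2 * ε ≤ ‖v - w‖ → ε ≤ ‖v - (w + s * I)‖ := by
    intro v s hs hv
    have h4 := norm_sub_norm_le (v - w) (s * I)
    rw [norm_mul, norm_I, mul_one, norm_real, Real.norm_eq_abs, sub_sub] at h4
    linarith
  have hε1 : 2 * ε ≤ m / 2 := by linarith [min_le_left (m / 4) ((δ - w.im) / 2)]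
  have hε2 : 2 * ε ≤ δ - w.im := by linarith [min_le_right (m / 4) ((δ - w.im) / 2)]
  have hfin : IsFiniteMeasure (volume.restrict (Ioo (-δ) δ)) :=
    isFiniteMeasure_restrict.2 measure_Ioo_lt_top.ne
  have hmain := hasDerivAt_integral_of_dominated_loc_of_deriv_le (𝕜 := ℝ) (x₀ := (0 : ℝ))
    (s := ball (0 : ℝ) ε) (μ := volume.restrict (Ioo (-δ) δ))
    (F := fun s x => ∫ y in Ioo (g x) δ, ((x : ℂ) + y * I - (w + (s : ℝ) * I))⁻¹)
    (F' := fun s x => ((x : ℂ) + g x * I - (w + (s : ℝ) * I))⁻¹ -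
      ((x : ℂ) + δ * I - (w + (s : ℝ) * I))⁻¹) (bound := fun _ => ε⁻¹ + ε⁻¹)
    (ball_mem_nhds _ hεpos)
    (Eventually.of_forall fun s => (areaCauchy_graphRegion hgc hga _).1.aestronglyMeasurable)
    (areaCauchy_graphRegion hgc hga _).1 ?_ ?_ (integrable_const _) ?_
  · have h := hmain.2
    simp only [ofReal_zero, zero_mul, add_zero] at h
    refine h.congr_of_eventuallyEq (Eventually.of_forall fun s => ?_)
    exact (areaCauchy_graphRegion hgc hga _).2
  · exact (by fun_prop : Measurable _).aestronglyMeasurable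
  · refine Eventually.of_forall fun x s hs => (norm_sub_le _ _).trans (add_le_add ?_ ?_)
    · rw [norm_inv]
      exact inv_anti₀ hεpos (hlow _ s (by simpa using hs) (hε1.trans (hd1 x)))
    · rw [norm_inv]
      exact inv_anti₀ hεpos (hlow _ s (by simpa using hs) (hε2.trans (hd2 x)))
  · filter_upwards [ae_restrict_of_ae (Measure.ae_ne volume w.re),
      ae_restrict_mem measurableSet_Ioo] with x hx hxI s _
    refine hasDerivAt_integral_vertical hx ?_ s
    have := (abs_le.1 (hga x)).2
    have := abs_lt.2 hxI
    linarith [abs_nonneg x]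

lemma continuousAt_zero_integral_top {δ : ℝ} (hδ : 0 < δ) :
    ContinuousAt (fun w : ℂ => ∫ x in Ioo (-δ) δ, ((x : ℂ) + δ * I - w)⁻¹) 0 := by
  have hfin : IsFiniteMeasure (volume.restrict (Ioo (-δ) δ)) :=
    isFiniteMeasure_restrict.2 measure_Ioo_lt_top.ne
  have hlow : ∀ w ∈ ball (0 : ℂ) (δ / 2), ∀ x : ℝ, δ / 2 ≤ ‖(x : ℂ) + δ * I - w‖ := by
    intro w hw x
    have h4 := abs_im_le_norm ((x : ℂ) + δ * I - w)
    have h5 : ((x : ℂ) + δ * I - w).im = δ - w.im := by simp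
    have h6 := (abs_le.1 ((abs_im_le_norm w).trans (mem_ball_zero_iff.1 hw).le)).2
    rw [h5] at h4
    linarith [le_abs_self (δ - w.im)]
  have hn : ball (0 : ℂ) (δ / 2) ∈ 𝓝 0 := ball_mem_nhds _ (half_pos hδ)
  refine continuousAt_of_dominated (bound := fun _ => (δ / 2)⁻¹) ?_ ?_ (integrable_const _) ?_
  · exact Eventually.of_forall fun w => (by fun_prop : Measurable _).aestronglyMeasurable
  · filter_upwards [hn] with w hw
    refine Eventually.of_forall fun x => ?_
    rw [norm_inv]
    exact inv_anti₀ (half_pos hδ) (hlow w hw x)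
  · refine Eventually.of_forall fun x => ContinuousAt.inv₀ (by fun_prop) fun h => ?_
    have := hlow 0 (mem_ball_self (half_pos hδ)) x
    rw [h, norm_zero] at this
    linarith

lemma tendsto_graph_add {ζ : ℝ → ℂ} (hζ : Continuous ζ) (hζ0 : ζ 0 = 0) :
    Tendsto (fun p : ℝ × ℝ => ζ p.1 + p.2 * I) (𝓝 0 ×ˢ 𝓝[>] 0) (𝓝 0) := by
  have : Tendsto (fun p : ℝ × ℝ => ζ p.1 + p.2 * I) (𝓝 (0, 0)) (𝓝 (ζ 0 + (0 : ℝ) * I)) :=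
    Continuous.tendsto (f := fun p : ℝ × ℝ => ζ p.1 + p.2 * I) (by fun_prop) ((0 : ℝ), (0 : ℝ))
  rw [hζ0, nhds_prod_eq] at this
  simp only [ofReal_zero, zero_mul, add_zero] at this
  exact this.mono_left (Filter.prod_mono le_rfl nhdsWithin_le_nhds)

lemma tendsto_graph_sub {ζ : ℝ → ℂ} (hζ : Continuous ζ) (hζ0 : ζ 0 = 0) :
    Tendsto (fun p : ℝ × ℝ => ζ p.1 - p.2 * I) (𝓝 0 ×ˢ 𝓝[>] 0) (𝓝 0) := by
  have : Tendsto (fun p : ℝ × ℝ => ζ p.1 - p.2 * I) (𝓝 (0, 0)) (𝓝 (ζ 0 - (0 : ℝ) * I)) :=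
    Continuous.tendsto (f := fun p : ℝ × ℝ => ζ p.1 - p.2 * I) (by fun_prop) ((0 : ℝ), (0 : ℝ))
  rw [hζ0, nhds_prod_eq] at this
  simp only [ofReal_zero, zero_mul, sub_zero] at this
  exact this.mono_left (Filter.prod_mono le_rfl nhdsWithin_le_nhds)

lemma eventually_snd_pos : ∀ᶠ p : ℝ × ℝ in 𝓝 0 ×ˢ 𝓝[>] 0, 0 < p.2 :=
  (tendsto_snd (α := ℝ) (β := ℝ)).eventually (p := fun s => 0 < s) self_mem_nhdsWithin

/-- The open square of half-side `δ`. -/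
def openSquare (δ : ℝ) : Set ℂ := {z | |z.re| < δ ∧ |z.im| < δ}

lemma isOpen_openSquare (δ : ℝ) : IsOpen (openSquare δ) := by
  simp only [openSquare, Set.ofPred_and]
  exact (isOpen_lt (by fun_prop) continuous_const).inter
    (isOpen_lt (by fun_prop) continuous_const)

lemma zero_mem_openSquare {δ : ℝ} (hδ : 0 < δ) : (0 : ℂ) ∈ openSquare δ := by
  simpa [openSquare] using hδ

/-- The jump of the vertical derivative of the area Cauchy transform across a graph. -/
lemma exists_vertical_deriv_areaCauchy {g g' : ℝ → ℝ} {ζ : ℝ → ℂ}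
    (hζ : ∀ x, ζ x = x + g x * I) (hg : ∀ x y, |g x - g y| ≤ |x - y| / 2)
    (hgd : ∀ x, HasDerivAt g (g' x) x) (hgc : Continuous g') (hg0 : g 0 = 0) (hg'0 : g' 0 = 0)
    {δ : ℝ} (hδ : 0 < δ) {Ω : Set ℂ} (hb : Bornology.IsBounded Ω) (ho : IsOpen Ω)
    (hbox : ∀ z ∈ openSquare δ, z ∈ Ω ↔ g z.re < z.im) :
    ∃ V : ℂ → ℂ, (∀ w ∈ openSquare δ, w.im ≠ g w.re →
      HasDerivAt (fun s : ℝ => areaCauchy Ω (w + s * I)) (V w) 0) ∧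
      Tendsto (fun p : ℝ × ℝ => V (ζ p.1 + p.2 * I) - V (ζ p.1 - p.2 * I))
        (𝓝 0 ×ˢ 𝓝[>] 0) (𝓝 (2 * Real.pi * I)) := by
  have hgcont : Continuous g := continuous_iff_continuousAt.2 fun x => (hgd x).continuousAt
  have hζcont : Continuous ζ := by
    rw [funext hζ]
    fun_prop
  have hζ0 : ζ 0 = 0 := by simp [hζ, hg0]
  have hga : ∀ x, |g x| ≤ |x| / 2 := fun x => by simpa [hg0] using hg x 0
  set Q := openSquare δ with hQ
  have hQo : IsOpen Q := isOpen_openSquare δ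
  have hQ0 : (0 : ℂ) ∈ Q := zero_mem_openSquare hδ
  have hD : graphRegion g δ = Ω ∩ Q := by
    ext z
    constructor
    · rintro ⟨h1, h2, h3⟩
      have h4 := abs_le.1 (hga z.re)
      have hzQ : z ∈ Q := ⟨h1, abs_lt.2 ⟨by linarith [h4.1], h3⟩⟩
      exact ⟨(hbox z hzQ).2 h2, hzQ⟩
    · rintro ⟨h1, h2⟩
      exact ⟨h2.1, (hbox z h2).1 h1, (abs_lt.1 h2.2).2⟩
  set A := areaCauchy (Ω \ Q) with hA
  have hsplit : ∀ w, areaCauchy Ω w = areaCauchy (graphRegion g δ) w + A w := by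
    intro w
    rw [hD, hA, ← areaCauchy_union (hb.subset inter_subset_left) (hb.subset Set.sdiff_subset)
      (ho.measurableSet.diff hQo.measurableSet) Set.disjoint_sdiff_inter.symm,
      Set.inter_union_sdiff]
  have hAd : DifferentiableOn ℂ A Q := by
    have := differentiableOn_areaCauchy (hb.subset Set.sdiff_subset)
      (ho.measurableSet.diff hQo.measurableSet) hQo.isClosed_compl
      (fun z hz => hz.2 : Ω \ Q ⊆ Qᶜ)
    rwa [compl_compl] at this
  refine ⟨fun w => graphCauchy g δ w + I * deriv A w, fun w hw hne => ?_, ?_⟩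
  · have h1 := hasDerivAt_areaCauchy_graphRegion hg hg0 (abs_lt.1 hw.2).2 hne
    have h2 : HasDerivAt (fun s : ℝ => A (w + s * I)) (I * deriv A w) 0 := by
      have hl : HasDerivAt (fun s : ℝ => w + s * I) I 0 := by
        have := ((hasDerivAt_id (0 : ℝ)).ofReal_comp.mul_const I).const_add w
        simpa using this
      have hA' : HasDerivAt A (deriv A w) (w + (0 : ℝ) * I) := by
        simpa using ((hAd w hw).differentiableAt (hQo.mem_nhds hw)).hasDerivAt
      have := hA'.scomp (0 : ℝ) hl
      simpa [Function.comp_def] using this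
    refine (h1.add h2).congr_of_eventuallyEq (Eventually.of_forall fun s => ?_)
    exact hsplit _
  · have hplus := tendsto_graph_add hζcont hζ0
    have hminus := tendsto_graph_sub hζcont hζ0
    have hdA : ContinuousAt (deriv A) 0 :=
      (((hAd.deriv hQo) 0 hQ0).differentiableAt (hQo.mem_nhds hQ0)).continuousAt
    have hT := continuousAt_zero_integral_top hδ
    have hjump := tendsto_integral_mul_jumpKernel hζ hg hgd hgc hg0 hg'0 hδ
      (χ := fun _ => 1) (c := 1) (M := 1) aestronglyMeasurable_const
      (Eventually.of_forall fun x => by simp)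
      (fun ε hε => ⟨1, one_pos, Eventually.of_forall fun x _ => by simpa using hε.le⟩)
    have htot := (hjump.sub ((hT.tendsto.comp hplus).sub (hT.tendsto.comp hminus))).add
      (((hdA.tendsto.comp hplus).sub (hdA.tendsto.comp hminus)).const_mul I)
    simp only [sub_self, sub_zero, mul_zero, add_zero, mul_one] at htot
    refine htot.congr' ?_
    have hQp := hplus.eventually (hQo.mem_nhds hQ0)
    have hQm := hminus.eventually (hQo.mem_nhds hQ0)
    filter_upwards [eventually_snd_pos, hQp, hQm] with p hp hp1 hp2
    have hi1 : ∀ w ∈ Q, w.im ≠ g w.re →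
        IntegrableOn (fun x : ℝ => ((x : ℂ) + g x * I - w)⁻¹) (Ioo (-δ) δ) := by
      intro w hw hne
      refine (Continuous.integrableOn_Icc
        (Continuous.inv₀ (by fun_prop) fun x h => hne ?_)).mono_set Ioo_subset_Icc_self
      have h1 : (x : ℂ) + g x * I = w := sub_eq_zero.1 h
      rw [← h1]
      simp
    have hi2 : ∀ w ∈ Q, IntegrableOn (fun x : ℝ => ((x : ℂ) + δ * I - w)⁻¹) (Ioo (-δ) δ) := by
      intro w hw
      refine (Continuous.integrableOn_Icc (Continuous.inv₀ (by fun_prop) fun x h => ?_)).mono_set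
        Ioo_subset_Icc_self
      have h1 : (x : ℂ) + δ * I = w := sub_eq_zero.1 h
      have h2 := (abs_lt.1 hw.2).2
      rw [← h1] at h2
      simp at h2
    have hne1 : (ζ p.1 + p.2 * I).im ≠ g (ζ p.1 + p.2 * I).re := by
      simp [hζ, hp.ne']
    have hne2 : (ζ p.1 - p.2 * I).im ≠ g (ζ p.1 - p.2 * I).re := by
      simp [hζ, hp.ne']
    have e1 : ∀ w ∈ Q, w.im ≠ g w.re → graphCauchy g δ w =
        (∫ x in Ioo (-δ) δ, ((x : ℂ) + g x * I - w)⁻¹) -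
          ∫ x in Ioo (-δ) δ, ((x : ℂ) + δ * I - w)⁻¹ := fun w hw hne =>
      integral_sub (hi1 w hw hne) (hi2 w hw)
    have e2 : (∫ x in Ioo (-δ) δ, jumpKernel ζ (ζ p.1) p.2 x) =
        (∫ x in Ioo (-δ) δ, ((x : ℂ) + g x * I - (ζ p.1 + p.2 * I))⁻¹) -
          ∫ x in Ioo (-δ) δ, ((x : ℂ) + g x * I - (ζ p.1 - p.2 * I))⁻¹ := by
      rw [← integral_sub (hi1 _ hp1 hne1) (hi1 _ hp2 hne2)]
      simp only [jumpKernel, hζ]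
    simp only [one_mul, Function.comp_apply]
    rw [e1 _ hp1 hne1, e1 _ hp2 hne2, e2]
    ring

/-- Cauchy integrals along an arc may be differentiated in the parameter, off the arc. -/
lemma hasDerivAt_integral_deriv_mul_inv {γ : ℝ → ℂ} (hγ : ContDiff ℝ 1 γ) {a b : ℝ} {w₀ : ℂ}
    (h : ∀ θ ∈ uIcc a b, γ θ ≠ w₀) :
    HasDerivAt (fun w => ∫ θ in a..b, deriv γ θ * (γ θ - w)⁻¹)
      (∫ θ in a..b, deriv γ θ * ((γ θ - w₀) ^ 2)⁻¹) w₀ := by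
  have hd : Continuous (deriv γ) := hγ.continuous_deriv le_rfl
  have hK : IsClosed (γ '' uIcc a b) := (isCompact_uIcc.image hγ.continuous).isClosed
  have hw : w₀ ∈ (γ '' uIcc a b)ᶜ := fun ⟨θ, hθ, he⟩ => h θ hθ he
  obtain ⟨ε, hε, hball⟩ := Metric.isOpen_iff.1 hK.isOpen_compl w₀ hw
  have hlow : ∀ θ ∈ uIcc a b, ∀ w ∈ ball w₀ (ε / 2), ε / 2 ≤ ‖γ θ - w‖ := by
    intro θ hθ w hw
    by_contra! hlt
    refine hball (?_ : γ θ ∈ ball w₀ ε) ⟨θ, hθ, rfl⟩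
    rw [mem_ball, dist_eq_norm] at hw ⊢
    calc ‖γ θ - w₀‖ = ‖(γ θ - w) + (w - w₀)‖ := by rw [sub_add_sub_cancel]
      _ ≤ ‖γ θ - w‖ + ‖w - w₀‖ := norm_add_le _ _
      _ < ε := by linarith
  obtain ⟨M, hM⟩ : ∃ M, ∀ θ ∈ uIcc a b, ‖deriv γ θ‖ ≤ M :=
    isCompact_uIcc.exists_bound_of_continuousOn hd.continuousOn
  have hγm : Measurable γ := hγ.continuous.measurable
  have hdm : Measurable (deriv γ) := hd.measurable
  refine (intervalIntegral.hasDerivAt_integral_of_dominated_loc_of_deriv_le (𝕜 := ℂ)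
    (F := fun w θ => deriv γ θ * (γ θ - w)⁻¹)
    (F' := fun w θ => deriv γ θ * ((γ θ - w) ^ 2)⁻¹) (bound := fun _ => M * ((ε / 2) ^ 2)⁻¹)
    (ball_mem_nhds w₀ (half_pos hε)) ?_ ?_ ?_ ?_ intervalIntegrable_const ?_).2
  · exact Eventually.of_forall fun w => (by fun_prop : Measurable _).aestronglyMeasurable
  · refine ContinuousOn.intervalIntegrable (hd.continuousOn.mul
      ((hγ.continuous.continuousOn.sub continuousOn_const).inv₀ fun θ hθ => ?_))
    exact sub_ne_zero.2 (h θ hθ)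
  · exact (by fun_prop : Measurable _).aestronglyMeasurable
  · refine Eventually.of_forall fun θ hθ w hw => ?_
    have hθ' := uIoc_subset_uIcc hθ
    have h1 := hlow θ hθ' w hw
    have hM0 : 0 ≤ M := (norm_nonneg _).trans (hM θ hθ')
    rw [norm_mul, norm_inv, norm_pow]
    gcongr
    exact hM θ hθ'
  · refine Eventually.of_forall fun θ hθ w hw => ?_
    have h1 := hlow θ (uIoc_subset_uIcc hθ) w hw
    have h2 : γ θ - w ≠ 0 := norm_pos_iff.1 ((half_pos hε).trans_le h1)
    have := (((hasDerivAt_id w).const_sub (γ θ)).fun_inv h2).const_mul (deriv γ θ)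
    refine this.congr_deriv ?_
    simp [div_eq_mul_inv]

/-- The winding number of a closed curve is constant on connected open sets off the curve. -/
lemma integral_deriv_mul_inv_eq {γ : ℝ → ℂ} (hγ : ContDiff ℝ 1 γ) {a b : ℝ} (hab : γ a = γ b)
    {Ω : Set ℂ} (ho : IsOpen Ω) (hc : IsPreconnected Ω) (hd : ∀ θ, γ θ ∉ Ω) {w₁ w₂ : ℂ}
    (h₁ : w₁ ∈ Ω) (h₂ : w₂ ∈ Ω) :
    ∫ θ in a..b, deriv γ θ * (γ θ - w₁)⁻¹ = ∫ θ in a..b, deriv γ θ * (γ θ - w₂)⁻¹ := by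
  have hne : ∀ w ∈ Ω, ∀ θ, γ θ - w ≠ 0 := fun w hw θ h =>
    hd θ (by rw [sub_eq_zero.1 h]; exact hw)
  have hder := fun w (hw : w ∈ Ω) => hasDerivAt_integral_deriv_mul_inv hγ (a := a) (b := b)
    (w₀ := w) (fun θ _ => sub_ne_zero.1 (hne w hw θ))
  refine ho.is_const_of_deriv_eq_zero hc
    (fun w hw => (hder w hw).differentiableAt.differentiableWithinAt) (fun w hw => ?_) h₁ h₂
  rw [(hder w hw).deriv]
  have hcd : Continuous (deriv γ) := hγ.continuous_deriv le_rfl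
  rw [intervalIntegral.integral_eq_sub_of_hasDerivAt (f := fun θ => -(γ θ - w)⁻¹), hab, sub_self]
  · rfl
  · intro θ _
    have h1 := ((((hγ.differentiable one_ne_zero) θ).hasDerivAt.sub_const w).fun_inv
      (hne w hw θ)).neg
    refine h1.congr_deriv ?_
    rw [neg_div, neg_neg, div_eq_mul_inv]
  · refine (hcd.mul (Continuous.inv₀ ?_ fun θ => pow_ne_zero 2 (hne w hw θ))).intervalIntegrable _ _
    exact (hγ.continuous.sub continuous_const).pow 2

/-- A connected open set off a closed curve cannot contain both sides of the curve near a
simple point. -/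
lemma not_both_sides {γ : ℝ → ℂ} (hγ : ContDiff ℝ 1 γ) {a b θ₀ η : ℝ} (hab : γ a = γ b)
    (hη : 0 < η) (ha : a ≤ θ₀ - η) (hb : θ₀ + η ≤ b) {u z₀ : ℂ} (hu : ‖u‖ = 1)
    (hz₀ : γ θ₀ = z₀)
    (hinj : ∀ θ ∈ Icc a b, θ ∉ Ioo (θ₀ - η) (θ₀ + η) → γ θ ≠ z₀)
    (hmono : StrictMonoOn (fun θ => (conj u * (γ θ - z₀)).re) (Icc (θ₀ - η) (θ₀ + η)))
    {Ω : Set ℂ} (ho : IsOpen Ω) (hc : IsPreconnected Ω) (hd : ∀ θ, γ θ ∉ Ω)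
    (hp : ∀ᶠ t : ℝ in 𝓝[>] 0, z₀ + u * (t * I) ∈ Ω)
    (hm : ∀ᶠ t : ℝ in 𝓝[>] 0, z₀ - u * (t * I) ∈ Ω) : False := by
  have huu : conj u * u = 1 := by
    rw [mul_comm, mul_conj, normSq_eq_norm_sq, hu]
    simp
  have hu0 : u ≠ 0 := fun h => by simp [h] at hu
  have hγ1 : Differentiable ℝ γ := hγ.differentiable one_ne_zero
  have hcd : Continuous (deriv γ) := hγ.continuous_deriv le_rfl
  set ζ : ℝ → ℂ := fun θ => conj u * (γ θ - z₀) with hζ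
  have hζγ : ∀ θ, γ θ = z₀ + u * ζ θ := fun θ => by
    rw [hζ]
    beta_reduce
    rw [← mul_assoc, mul_comm u, huu]
    ring
  have hζ0 : ζ θ₀ = 0 := by simp [hζ, hz₀]
  have hζd : ∀ θ, HasDerivAt ζ (conj u * deriv γ θ) θ := fun θ =>
    ((hγ1 θ).hasDerivAt.sub_const z₀).const_mul (conj u)
  have hsub : uIcc (θ₀ - η) (θ₀ + η) = Icc (θ₀ - η) (θ₀ + η) := uIcc_of_le (by linarith)
  have hmid : θ₀ ∈ Icc (θ₀ - η) (θ₀ + η) := ⟨by linarith, by linarith⟩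
  set J : ℝ → ℝ → ℂ → ℂ := fun a b w => ∫ θ in a..b, deriv γ θ * (γ θ - w)⁻¹ with hJ
  have hJ1 : ContinuousAt (J a (θ₀ - η)) z₀ :=
    (hasDerivAt_integral_deriv_mul_inv hγ fun θ hθ => by
      rw [uIcc_of_le ha] at hθ
      exact hinj θ ⟨hθ.1, by linarith [hθ.2]⟩ fun h => by linarith [h.1, hθ.2]).continuousAt
  have hJ2 : ContinuousAt (J (θ₀ + η) b) z₀ :=
    (hasDerivAt_integral_deriv_mul_inv hγ fun θ hθ => by
      rw [uIcc_of_le hb] at hθ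
      exact hinj θ ⟨by linarith [hθ.1], hθ.2⟩ fun h => by linarith [h.2, hθ.1]).continuousAt
  have ht : Tendsto (fun t : ℝ => t) (𝓝[>] 0) (𝓝 0) := tendsto_id.mono_left nhdsWithin_le_nhds
  have htp : Tendsto (fun t : ℝ => z₀ + u * (t * I)) (𝓝[>] 0) (𝓝 z₀) := by
    have : Tendsto (fun t : ℝ => z₀ + u * (t * I)) (𝓝 0) (𝓝 (z₀ + u * ((0 : ℝ) * I))) :=
      Continuous.tendsto (f := fun t : ℝ => z₀ + u * (t * I)) (by fun_prop) 0
    simpa using this.mono_left nhdsWithin_le_nhds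
  have htm : Tendsto (fun t : ℝ => z₀ - u * (t * I)) (𝓝[>] 0) (𝓝 z₀) := by
    have : Tendsto (fun t : ℝ => z₀ - u * (t * I)) (𝓝 0) (𝓝 (z₀ - u * ((0 : ℝ) * I))) :=
      Continuous.tendsto (f := fun t : ℝ => z₀ - u * (t * I)) (by fun_prop) 0
    simpa using this.mono_left nhdsWithin_le_nhds
  have hpair : Tendsto (fun t : ℝ => ((0 : ℂ), t)) (𝓝[>] 0) (𝓝 (0, 0)) := by
    rw [nhds_prod_eq]
    exact tendsto_const_nhds.prodMk ht
  have hlogb := (tendsto_jumpLog_of_re_pos (v := ζ (θ₀ + η)) (by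
    have := hmono hmid (right_mem_Icc.2 (by linarith)) (by linarith : θ₀ < θ₀ + η)
    change (ζ θ₀).re < (ζ (θ₀ + η)).re at this
    rwa [hζ0, zero_re] at this)).comp hpair
  have hloga := (tendsto_jumpLog_of_re_neg (v := ζ (θ₀ - η)) (by
    have := hmono (left_mem_Icc.2 (by linarith)) hmid (by linarith : θ₀ - η < θ₀)
    change (ζ (θ₀ - η)).re < (ζ θ₀).re at this
    rwa [hζ0, zero_re] at this)).comp hpair
  have htot := ((hlogb.sub hloga).add
    ((hJ1.tendsto.comp htp).sub (hJ1.tendsto.comp htm))).add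
    ((hJ2.tendsto.comp htp).sub (hJ2.tendsto.comp htm))
  have hzero : Tendsto (fun _ : ℝ => (0 : ℂ)) (𝓝[>] 0)
      (𝓝 (Real.pi * I - -(Real.pi * I) + (J a (θ₀ - η) z₀ - J a (θ₀ - η) z₀) +
        (J (θ₀ + η) b z₀ - J (θ₀ + η) b z₀))) := by
    refine htot.congr' ?_
    filter_upwards [hp, hm, self_mem_nhdsWithin] with t h1 h2 htpos
    have htpos : 0 < t := htpos
    have hne : ∀ w ∈ Ω, ∀ θ, γ θ - w ≠ 0 := fun w hw θ h =>
      hd θ (by rw [sub_eq_zero.1 h]; exact hw)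
    have hii : ∀ w ∈ Ω, ∀ a b : ℝ,
        IntervalIntegrable (fun θ => deriv γ θ * (γ θ - w)⁻¹) volume a b := fun w hw a b =>
      (hcd.mul ((hγ.continuous.sub continuous_const).inv₀ (hne w hw))).intervalIntegrable _ _
    have hsum : ∀ w ∈ Ω, J a b w = J a (θ₀ - η) w + J (θ₀ - η) (θ₀ + η) w + J (θ₀ + η) b w := by
      intro w hw
      simp only [hJ]
      rw [intervalIntegral.integral_add_adjacent_intervals (hii w hw _ _) (hii w hw _ _),
        intervalIntegral.integral_add_adjacent_intervals (hii w hw _ _) (hii w hw _ _)]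
    have hconst : J a b (z₀ + u * (t * I)) = J a b (z₀ - u * (t * I)) :=
      integral_deriv_mul_inv_eq hγ hab ho hc hd h1 h2
    have hmidJ : J (θ₀ - η) (θ₀ + η) (z₀ + u * (t * I)) - J (θ₀ - η) (θ₀ + η) (z₀ - u * (t * I)) =
        jumpLog (ζ (θ₀ + η)) t - jumpLog (ζ (θ₀ - η)) t := by
      have h3 := integral_deriv_mul_jumpKernel (ζ := ζ) (a := θ₀ - η) (b := θ₀ + η)
        (c := 0) (fun θ _ => hζd θ) (by fun_prop) htpos (fun θ hθ h => by
          rw [hsub] at hθ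
          have : θ = θ₀ := hmono.injOn hθ hmid (by
            change (ζ θ).re = (ζ θ₀).re
            rw [h, hζ0])
          rw [this, hζ0])
      rw [sub_zero, sub_zero] at h3
      rw [← h3]
      simp only [hJ]
      rw [← intervalIntegral.integral_sub (hii _ h1 _ _) (hii _ h2 _ _)]
      congr 1
      ext θ
      rw [jumpKernel, hζγ θ]
      have e1 : z₀ + u * ζ θ - (z₀ + u * (t * I)) = u * (ζ θ - (0 + t * I)) := by ring
      have e2 : z₀ + u * ζ θ - (z₀ - u * (t * I)) = u * (ζ θ - (0 - t * I)) := by ring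
      have e3 : conj u = u⁻¹ := eq_inv_of_mul_eq_one_left huu
      rw [e1, e2, mul_inv, mul_inv, e3]
      ring
    simp only [Function.comp_apply, sub_zero]
    rw [← hmidJ]
    linear_combination hconst - hsum _ h1 + hsum _ h2
  have := tendsto_nhds_unique hzero tendsto_const_nhds
  simp [Real.pi_ne_zero] at this

/-- A `C¹` plane curve whose abscissa has derivative bounded below by a positive constant and
dominates the ordinate is a graph over the real line. -/
lemma exists_graph_of_deriv_bounds {k : ℝ → ℂ} (hk : Continuous k) {r : ℝ} (hr : 0 < r)
    (hre : ∀ t, r ≤ (k t).re) (him : ∀ t, |(k t).im| ≤ (k t).re / 2) {ψ : ℝ → ℂ}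
    (hψ : ∀ t, HasDerivAt ψ (k t) t) (hψ0 : ψ 0 = 0) (hk0 : (k 0).im = 0) :
    ∃ g g' φ : ℝ → ℝ, (∀ x y, |g x - g y| ≤ |x - y| / 2) ∧ (∀ x, HasDerivAt g (g' x) x) ∧
      Continuous g' ∧ g 0 = 0 ∧ g' 0 = 0 ∧ Continuous φ ∧ φ 0 = 0 ∧
      StrictMono (fun t => (ψ t).re) ∧ (∀ t, (ψ t).im = g (ψ t).re) ∧
      (∀ x, ψ (φ x) = x + g x * I) := by
  have hX : ∀ t, HasDerivAt (fun t => (ψ t).re) (k t).re t := fun t => by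
    exact (Complex.reCLM.hasFDerivAt (x := ψ t)).comp_hasDerivAt t (hψ t)
  have hY : ∀ t, HasDerivAt (fun t => (ψ t).im) (k t).im t := fun t => by
    exact (Complex.imCLM.hasFDerivAt (x := ψ t)).comp_hasDerivAt t (hψ t)
  set X : ℝ → ℝ := fun t => (ψ t).re with hXd
  have hXc : Continuous X := continuous_iff_continuousAt.2 fun t => (hX t).continuousAt
  have hmono : StrictMono X :=
    strictMono_of_deriv_pos fun t => by rw [(hX t).deriv]; exact hr.trans_le (hre t)
  have hmono2 : Monotone (fun t => X t - r * t) := by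
    refine monotone_of_deriv_nonneg (fun t => ((hX t).sub
      ((hasDerivAt_id t).const_mul r)).differentiableAt) fun t => ?_
    have := ((hX t).sub ((hasDerivAt_id t).const_mul r)).deriv
    have h2 := hre t
    rw [show (fun t => X t - r * t) = X - fun y => r * id y from rfl, this]
    simp; linarith
  have hX0 : X 0 = 0 := by simp [hXd, hψ0]
  have htop : Tendsto X atTop atTop := by
    refine tendsto_atTop_mono' _ ?_ (tendsto_id.const_mul_atTop hr)
    filter_upwards [eventually_ge_atTop 0] with t ht
    have := hmono2 ht
    simp only [hX0] at this
    simp only [id]; linarith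
  have hbot : Tendsto X atBot atBot := by
    refine tendsto_atBot_mono' _ ?_ (tendsto_id.const_mul_atBot hr)
    filter_upwards [eventually_le_atBot 0] with t ht
    have := hmono2 ht
    simp only [hX0] at this
    simp only [id]; linarith
  have hsurj := hXc.surjective htop hbot
  let e := StrictMono.orderIsoOfSurjective X hmono hsurj
  have hφc : Continuous e.symm := e.symm.continuous
  have hXφ : ∀ x, X (e.symm x) = x := fun x => e.apply_symm_apply x
  have hφX : ∀ t, e.symm (X t) = t := fun t => e.symm_apply_apply t
  have hφ : ∀ x, HasDerivAt e.symm ((k (e.symm x)).re)⁻¹ x := fun x =>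
    HasDerivAt.of_local_left_inverse hφc.continuousAt (hX _) (hr.trans_le (hre _)).ne'
      (Eventually.of_forall hXφ)
  have hφ0 : e.symm 0 = 0 := by rw [← hX0]; simpa [hX0] using hφX 0
  have hpos : ∀ t, 0 < (k t).re := fun t => hr.trans_le (hre t)
  have hgd : ∀ x, HasDerivAt (fun x => (ψ (e.symm x)).im)
      ((k (e.symm x)).im * ((k (e.symm x)).re)⁻¹) x := fun x =>
    (hY (e.symm x)).comp x (hφ x)
  refine ⟨fun x => (ψ (e.symm x)).im, fun x => (k (e.symm x)).im * ((k (e.symm x)).re)⁻¹, e.symm,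
    fun x y => ?_, hgd, ?_, by simp [hφ0, hψ0], by simp [hφ0, hk0], hφc, hφ0, hmono,
    fun t => by simp only; rw [hφX], fun x => ?_⟩
  · have := Convex.norm_image_sub_le_of_norm_hasDerivWithin_le (C := 1 / 2)
      (fun x _ => (hgd x).hasDerivWithinAt) (fun x _ => ?_) convex_univ (mem_univ y) (mem_univ x)
    · simp only [Real.norm_eq_abs] at this; linarith
    · rw [norm_mul, Real.norm_eq_abs, Real.norm_eq_abs, abs_inv, abs_of_pos (hpos _),
        ← div_eq_mul_inv, div_le_iff₀ (hpos _)]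
      linarith [him (e.symm x)]
  · exact (Complex.continuous_im.comp (hk.comp hφc)).mul
      ((Complex.continuous_re.comp (hk.comp hφc)).inv₀ fun x => (hpos _).ne')
  · apply Complex.ext
    · simpa using hXφ x
    · simp

/-- Near a point where its velocity is a positive real number, a `C¹` curve is a graph. -/
lemma exists_local_graph {ψ : ℝ → ℂ} (hψ : ContDiff ℝ 1 ψ) {θ₀ r : ℝ} (hψ0 : ψ θ₀ = 0)
    (hr : 0 < r) (hd : deriv ψ θ₀ = r) {η₀ : ℝ} (hη₀ : 0 < η₀) :
    ∃ (g g' : ℝ → ℝ) (η δ : ℝ), (∀ x y, |g x - g y| ≤ |x - y| / 2) ∧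
      (∀ x, HasDerivAt g (g' x) x) ∧ Continuous g' ∧ g 0 = 0 ∧ g' 0 = 0 ∧ 0 < η ∧ η < η₀ ∧
      0 < δ ∧ StrictMonoOn (fun t => (ψ t).re) (Icc (θ₀ - η) (θ₀ + η)) ∧
      (∀ t ∈ Icc (θ₀ - η) (θ₀ + η), (ψ t).im = g (ψ t).re) ∧
      (∀ x, |x| < δ → ∃ t, ψ t = x + g x * I) := by
  have hdc : Continuous (deriv ψ) := hψ.continuous_deriv le_rfl
  have h1 : ∀ᶠ t in 𝓝 θ₀, r / 2 < (deriv ψ t).re := by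
    have := (Complex.continuous_re.comp hdc).continuousAt (x := θ₀)
    refine this.eventually (lt_mem_nhds ?_)
    simp [hd]; linarith
  have h2 : ∀ᶠ t in 𝓝 θ₀, |(deriv ψ t).im| < r / 4 := by
    have := (Complex.continuous_im.comp hdc).abs.continuousAt (x := θ₀)
    refine this.eventually (gt_mem_nhds ?_)
    simp [hd]; linarith
  obtain ⟨ε, hε, hball⟩ := Metric.eventually_nhds_iff.1 (h1.and h2)
  set η := min (ε / 2) (η₀ / 2) with hη
  have hη0 : 0 < η := lt_min (by linarith) (by linarith)
  have hηε : η < ε := (min_le_left _ _).trans_lt (by linarith)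
  have hη1 : η < η₀ := (min_le_right _ _).trans_lt (by linarith)
  set k : ℝ → ℂ := fun t => deriv ψ (θ₀ + max (-η) (min η t)) with hkd
  have hk : Continuous k := hdc.comp (by fun_prop)
  have hcl : ∀ t, dist (θ₀ + max (-η) (min η t)) θ₀ < ε := fun t => by
    rw [Real.dist_eq, add_sub_cancel_left]
    refine lt_of_le_of_lt (abs_le.2 ⟨le_max_left _ _, max_le (by linarith) (min_le_left _ _)⟩) hηε
  have hk0 : k 0 = r := by
    simp only [hkd]
    rw [min_eq_right hη0.le, max_eq_right (by linarith), add_zero, hd]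
  have hkeq : ∀ t ∈ Icc (-η) η, k t = deriv ψ (θ₀ + t) := fun t ht => by
    simp only [hkd]; rw [min_eq_right ht.2, max_eq_right ht.1]
  set Ψ : ℝ → ℂ := fun t => ∫ s in (0 : ℝ)..t, k s with hΨd
  have hΨ : ∀ t, HasDerivAt Ψ (k t) t := fun t => hk.integral_hasStrictDerivAt 0 t |>.hasDerivAt
  have hΨeq : ∀ t ∈ Icc (-η) η, Ψ t = ψ (θ₀ + t) := fun t ht => by
    have hsub : uIcc 0 t ⊆ Icc (-η) η := by
      rw [← uIcc_of_le (by linarith : -η ≤ η)]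
      exact uIcc_subset_uIcc (by rw [uIcc_of_le (by linarith)]; exact ⟨by linarith, hη0.le⟩)
        (by rw [uIcc_of_le (by linarith)]; exact ht)
    have : Ψ t = ∫ s in (0 : ℝ)..t, deriv ψ (θ₀ + s) :=
      intervalIntegral.integral_congr fun s hs => hkeq s (hsub hs)
    rw [this, intervalIntegral.integral_comp_add_left (fun s => deriv ψ s),
      intervalIntegral.integral_deriv_eq_sub
        (fun s _ => (hψ.differentiable one_ne_zero) s) (hdc.intervalIntegrable _ _)]
    simp [hψ0]
  obtain ⟨g, g', φ, hg, hgd, hgc, hg0, hg'0, hφc, hφ0, hm, him, hφ⟩ :=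
    exists_graph_of_deriv_bounds hk (r := r / 2) (by linarith) (fun t => (hball (hcl t)).1.le)
      (fun t => by have := hball (hcl t); simp only [hkd]; linarith [this.1, this.2]) hΨ
      (by simp [hΨd]) (by simp [hk0])
  obtain ⟨δ, hδ, hδb⟩ := Metric.continuousAt_iff.1 (hφc.continuousAt (x := 0)) η hη0
  have hsh : ∀ t ∈ Icc (θ₀ - η) (θ₀ + η), ψ t = Ψ (t - θ₀) := fun t ht => by
    rw [hΨeq _ ⟨by linarith [ht.1], by linarith [ht.2]⟩]; congr 1; ring
  refine ⟨g, g', η, δ, hg, hgd, hgc, hg0, hg'0, hη0, hη1, hδ, fun s hs t ht hst => ?_,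
    fun t ht => ?_, fun x hx => ⟨θ₀ + φ x, ?_⟩⟩
  · simp only [hsh s hs, hsh t ht]
    exact hm (by linarith)
  · rw [hsh t ht, him]
  · have := hδb (x := x) (by simpa using hx)
    rw [hφ0, Real.dist_eq, sub_zero] at this
    rw [← hΨeq _ ⟨(abs_lt.1 this).1.le, (abs_lt.1 this).2.le⟩, hφ]

/-- In the coordinate `z ↦ z₀ + u * z`, the set `Ω` is, within a square, the part lying above the
graph of the `C¹` function `g`, and its boundary is that graph. -/
structure IsGraphChart (Ω : Set ℂ) (z₀ u : ℂ) (g g' : ℝ → ℝ) (δ : ℝ) : Prop where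
  norm_eq_one : ‖u‖ = 1
  pos : 0 < δ
  lip : ∀ x y, |g x - g y| ≤ |x - y| / 2
  hasDerivAt : ∀ x, HasDerivAt g (g' x) x
  continuous_deriv : Continuous g'
  map_zero : g 0 = 0
  deriv_zero : g' 0 = 0
  mem_iff : ∀ z ∈ openSquare δ, z₀ + u * z ∈ Ω ↔ g z.re < z.im
  notMem_closure_iff : ∀ z ∈ openSquare δ, z₀ + u * z ∉ closure Ω ↔ z.im < g z.re

lemma IsPreconnected.subset_or_subset_compl_closure {V Ω : Set ℂ} (hV : IsPreconnected V)
    (ho : IsOpen Ω) (hd : ∀ z ∈ V, z ∉ frontier Ω) : V ⊆ Ω ∨ V ⊆ (closure Ω)ᶜ := by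
  refine hV.subset_or_subset ho isClosed_closure.isOpen_compl
    (disjoint_compl_right.mono_left subset_closure |>.mono_right le_rfl) fun z hz => ?_
  by_cases h : z ∈ closure Ω
  · refine Or.inl (by_contra fun h' => hd z hz ?_)
    rw [ho.frontier_eq]; exact ⟨h, h'⟩
  · exact Or.inr h

lemma isPreconnected_above_graph {g : ℝ → ℝ} (hg : ∀ x y, |g x - g y| ≤ |x - y| / 2)
    (hg0 : g 0 = 0) {δ : ℝ} :
    IsPreconnected {z : ℂ | z ∈ openSquare δ ∧ g z.re < z.im} := by
  have hgc : Continuous g := by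
    refine Metric.continuous_iff.2 fun b ε hε => ⟨ε, hε, fun a ha => ?_⟩
    rw [Real.dist_eq] at *
    have := hg a b
    have := abs_nonneg (a - b)
    linarith
  have hgb : ∀ x, |x| < δ → |g x| < δ := fun x hx => by
    have := hg x 0
    rw [hg0, sub_zero, sub_zero] at this
    have := abs_nonneg x
    linarith
  have himg : {z : ℂ | z ∈ openSquare δ ∧ g z.re < z.im} =
      (fun p : ℝ × ℝ => ((p.1 : ℂ) + ((g p.1 + p.2 * (δ - g p.1) : ℝ) : ℂ) * I)) ''
        (Ioo (-δ) δ ×ˢ Ioo (0 : ℝ) 1) := by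
    ext z
    constructor
    · rintro ⟨⟨h1, h2⟩, h3⟩
      have h4 := abs_lt.1 (hgb _ h1)
      have h5 : 0 < δ - g z.re := by linarith [h4.2]
      refine ⟨(z.re, (z.im - g z.re) / (δ - g z.re)), ⟨abs_lt.1 h1, by
        exact div_pos (by linarith) h5, ?_⟩, ?_⟩
      · rw [div_lt_one h5]; linarith [(abs_lt.1 h2).2]
      · have h6 : (z.im - g z.re) / (δ - g z.re) * (δ - g z.re) = z.im - g z.re :=
          div_mul_cancel₀ _ h5.ne'
        simp only [h6]
        apply Complex.ext <;> simp
    · rintro ⟨⟨x, s⟩, ⟨hx, hs⟩, rfl⟩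
      have h1 : |x| < δ := abs_lt.2 hx
      have h4 := abs_lt.1 (hgb _ h1)
      have h5 : 0 < δ - g x := by linarith [h4.2]
      have h6 : 0 < s * (δ - g x) := mul_pos hs.1 h5
      have h7 : s * (δ - g x) < δ - g x := by nlinarith [hs.2]
      simp only at *
      refine ⟨⟨by simpa using h1, ?_⟩, ?_⟩
      · simp only [add_im, ofReal_im, mul_im, ofReal_re, I_re, I_im, mul_zero, mul_one, zero_add,
          add_zero]
        exact abs_lt.2 ⟨by linarith, by linarith⟩
      · simpa using h6
  rw [himg]
  refine (isPreconnected_Ioo.prod isPreconnected_Ioo).image _ (Continuous.continuousOn ?_)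
  fun_prop

lemma isPreconnected_below_graph {g : ℝ → ℝ} (hg : ∀ x y, |g x - g y| ≤ |x - y| / 2)
    (hg0 : g 0 = 0) {δ : ℝ} :
    IsPreconnected {z : ℂ | z ∈ openSquare δ ∧ z.im < g z.re} := by
  have h := (isPreconnected_above_graph (g := fun x => -g x) (δ := δ)
    (fun x y => by rw [← neg_sub', abs_neg]; exact hg x y) (by simp [hg0])).image conj
    Complex.continuous_conj.continuousOn
  convert h using 1
  ext z
  constructor
  · rintro ⟨⟨h1, h2⟩, h3⟩
    exact ⟨conj z, ⟨⟨by simpa using h1, by simpa using h2⟩, by simpa using h3⟩, by simp⟩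
  · rintro ⟨z, ⟨⟨h1, h2⟩, h3⟩, rfl⟩
    refine ⟨⟨by simpa using h1, by simpa using h2⟩, ?_⟩
    simp at h3 ⊢; linarith

/-- A domain whose boundary is locally the graph of a `C¹` function, and which does not lie on both
sides of it, admits a graph chart. -/
lemma exists_isGraphChart {Ω : Set ℂ} (ho : IsOpen Ω) {z₀ u : ℂ} (hz₀ : z₀ ∈ frontier Ω)
    (hu : ‖u‖ = 1) {g g' : ℝ → ℝ} (hg : ∀ x y, |g x - g y| ≤ |x - y| / 2)
    (hgd : ∀ x, HasDerivAt g (g' x) x) (hgc : Continuous g') (hg0 : g 0 = 0) (hg'0 : g' 0 = 0)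
    {δ : ℝ} (hδ : 0 < δ) (hfr : ∀ z ∈ openSquare δ, z₀ + u * z ∈ frontier Ω ↔ z.im = g z.re)
    (hsides : ¬ ((∀ᶠ t : ℝ in 𝓝[>] 0, z₀ + u * (t * I) ∈ Ω) ∧
      ∀ᶠ t : ℝ in 𝓝[>] 0, z₀ - u * (t * I) ∈ Ω)) :
    ∃ (u' : ℂ) (h h' : ℝ → ℝ), IsGraphChart Ω z₀ u' h h' δ := by
  have hT : Continuous fun z => z₀ + u * z := by fun_prop
  have hcl : ∀ z ∈ frontier Ω, z ∉ Ω ∧ z ∈ closure Ω := fun z hz => by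
    rw [ho.frontier_eq] at hz; exact ⟨hz.2, hz.1⟩
  have hΩcl : ∀ z ∈ Ω, z ∈ closure Ω := fun z hz => subset_closure hz
  set U := {z : ℂ | z ∈ openSquare δ ∧ g z.re < z.im} with hU
  set L := {z : ℂ | z ∈ openSquare δ ∧ z.im < g z.re} with hL
  have hUp := ((isPreconnected_above_graph hg hg0 (δ := δ)).image _ hT.continuousOn
    ).subset_or_subset_compl_closure ho (by
      rintro _ ⟨z, ⟨hz, hz'⟩, rfl⟩ hf
      exact hz'.ne' ((hfr z hz).1 hf))
  have hLp := ((isPreconnected_below_graph hg hg0 (δ := δ)).image _ hT.continuousOn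
    ).subset_or_subset_compl_closure ho (by
      rintro _ ⟨z, ⟨hz, hz'⟩, rfl⟩ hf
      exact hz'.ne ((hfr z hz).1 hf))
  have hsm : ∀ᶠ t : ℝ in 𝓝[>] 0, 0 < t ∧ t < δ := by
    filter_upwards [self_mem_nhdsWithin, mem_nhdsWithin_of_mem_nhds (Iio_mem_nhds hδ)] with t h1 h2
    exact ⟨h1, h2⟩
  rcases hUp with hUp | hUp <;> rcases hLp with hLp | hLp
  · refine (hsides ⟨?_, ?_⟩).elim
    · filter_upwards [hsm] with t ht
      refine hUp ⟨t * I, ⟨⟨by simpa using hδ, ?_⟩, by simpa [hg0] using ht.1⟩, rfl⟩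
      simpa [abs_of_pos ht.1] using ht.2
    · filter_upwards [hsm] with t ht
      refine hLp ⟨-(t * I), ⟨⟨by simpa using hδ, ?_⟩, by simpa [hg0] using ht.1⟩, by
        simp [sub_eq_add_neg]⟩
      simpa [abs_of_pos ht.1] using ht.2
  · refine ⟨u, g, g', hu, hδ, hg, hgd, hgc, hg0, hg'0, fun z hz => ?_, fun z hz => ?_⟩
    · rcases lt_trichotomy (g z.re) z.im with h | h | h
      · exact iff_of_true (hUp ⟨z, ⟨hz, h⟩, rfl⟩) h
      · exact iff_of_false (hcl _ ((hfr z hz).2 h.symm)).1 h.not_lt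
      · exact iff_of_false (fun h' => hLp ⟨z, ⟨hz, h⟩, rfl⟩ (hΩcl _ h')) h.not_gt
    · rcases lt_trichotomy (g z.re) z.im with h | h | h
      · exact iff_of_false (not_not.2 (hΩcl _ (hUp ⟨z, ⟨hz, h⟩, rfl⟩))) h.not_gt
      · exact iff_of_false (not_not.2 (hcl _ ((hfr z hz).2 h.symm)).2) h.not_gt
      · exact iff_of_true (hLp ⟨z, ⟨hz, h⟩, rfl⟩) h
  · have hq : ∀ z ∈ openSquare δ, -z ∈ openSquare δ := fun z hz =>
      ⟨by simpa using hz.1, by simpa using hz.2⟩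
    have he : ∀ z, z₀ + -u * z = z₀ + u * -z := fun z => by ring
    refine ⟨-u, fun x => -g (-x), fun x => g' (-x), by simpa using hu, hδ, fun x y => ?_,
      fun x => ?_, hgc.comp continuous_neg, by simp [hg0], by simp [hg'0], fun z hz => ?_,
      fun z hz => ?_⟩
    · have := hg (-x) (-y)
      rw [← neg_sub', abs_neg] at this ⊢
      exact this
    · simpa [Function.comp_def] using ((hgd (-x)).scomp x (hasDerivAt_neg x)).fun_neg
    · rw [he]
      have hz' := hq z hz
      rcases lt_trichotomy (g (-z).re) (-z).im with h | h | h
      · exact iff_of_false (fun h' => hUp ⟨-z, ⟨hz', h⟩, rfl⟩ (hΩcl _ h')) (by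
          simp at h ⊢; linarith)
      · exact iff_of_false (hcl _ ((hfr _ hz').2 h.symm)).1 (by simp at h ⊢; linarith)
      · exact iff_of_true (hLp ⟨-z, ⟨hz', h⟩, rfl⟩) (by simp at h ⊢; linarith)
    · rw [he]
      have hz' := hq z hz
      rcases lt_trichotomy (g (-z).re) (-z).im with h | h | h
      · exact iff_of_true (hUp ⟨-z, ⟨hz', h⟩, rfl⟩) (by simp at h ⊢; linarith)
      · exact iff_of_false (not_not.2 (hcl _ ((hfr _ hz').2 h.symm)).2) (by
          simp at h ⊢; linarith)
      · exact iff_of_false (not_not.2 (hΩcl _ (hLp ⟨-z, ⟨hz', h⟩, rfl⟩))) (by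
          simp at h ⊢; linarith)
  · exfalso
    have hQ : (fun z => z₀ + u * z) '' openSquare δ ∈ 𝓝 z₀ := by
      have hu0 : u ≠ 0 := by rintro rfl; simp at hu
      have : (fun w => u⁻¹ * (w - z₀)) ⁻¹' openSquare δ ∈ 𝓝 z₀ :=
        ContinuousAt.preimage_mem_nhds (by fun_prop)
          (by simpa using (isOpen_openSquare δ).mem_nhds (zero_mem_openSquare hδ))
      filter_upwards [this] with w hw
      exact ⟨_, hw, by field_simp; ring⟩
    obtain ⟨w, ⟨z, hz, rfl⟩, hw⟩ := mem_closure_iff_nhds.1 (hcl _ hz₀).2 _ hQ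
    rcases lt_trichotomy (g z.re) z.im with h | h | h
    · exact hUp ⟨z, ⟨hz, h⟩, rfl⟩ (hΩcl _ hw)
    · exact (hcl _ ((hfr z hz).2 h.symm)).1 hw
    · exact hLp ⟨z, ⟨hz, h⟩, rfl⟩ (hΩcl _ hw)

lemma Function.Periodic.eq_of_injOn_of_abs_lt {γ : ℝ → ℂ} {T : ℝ} (hT : 0 < T)
    (hp : Function.Periodic γ T) (hinj : InjOn γ (Ico 0 T)) {s t : ℝ} (h : γ s = γ t)
    (hst : |s - t| < T) : s = t := by
  have h1 : toIcoMod hT 0 s = toIcoMod hT 0 t := by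
    refine hinj (by simpa using toIcoMod_mem_Ico hT 0 s) (by simpa using toIcoMod_mem_Ico hT 0 t) ?_
    rw [toIcoMod, toIcoMod, hp.sub_zsmul_eq, hp.sub_zsmul_eq, h]
  obtain ⟨n, hn⟩ := (toIcoMod_eq_toIcoMod hT).1 h1
  rw [zsmul_eq_mul] at hn
  have h2 : |(n : ℝ)| < 1 := by
    have : |(n : ℝ)| * T < T := by
      rw [← abs_of_pos hT, ← abs_mul, ← hn, abs_of_pos hT, abs_sub_comm]; exact hst
    by_contra! h3
    nlinarith
  have h3 : n = 0 := by
    have : |n| < 1 := by exact_mod_cast h2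
    exact Int.abs_lt_one_iff.1 this
  rw [h3] at hn
  simp at hn; linarith

/-- Near each of its points, a smooth boundary is traced by a single arc. -/
lemma HasSmoothBoundary.exists_arc {Ω : Set ℂ} (hsm : HasSmoothBoundary Ω) {z₀ : ℂ}
    (hz₀ : z₀ ∈ frontier Ω) : ∃ (γ : ℝ → ℂ) (θ₀ : ℝ), ContDiff ℝ 1 γ ∧ γ θ₀ = z₀ ∧
      deriv γ θ₀ ≠ 0 ∧ γ (θ₀ - Real.pi) = γ (θ₀ + Real.pi) ∧ (∀ θ, γ θ ∈ frontier Ω) ∧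
      (∀ θ ∈ Icc (θ₀ - Real.pi) (θ₀ + Real.pi), γ θ = z₀ → θ = θ₀) ∧
      ∀ η > 0, ∃ r > 0, ∀ z ∈ frontier Ω, ‖z - z₀‖ < r → ∃ θ ∈ Ioo (θ₀ - η) (θ₀ + η), γ θ = z := by
  obtain ⟨-, n, γ, hγ, hper, hinj, hdne, hdisj, hfr⟩ := hsm
  have hpi := Real.pi_pos
  have h2pi : 0 < 2 * Real.pi := by positivity
  obtain ⟨i, hi⟩ := mem_iUnion.1 (hfr ▸ hz₀)
  obtain ⟨θ₀, hθ₀⟩ := hi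
  have huniq : ∀ θ ∈ Icc (θ₀ - Real.pi) (θ₀ + Real.pi), γ i θ = z₀ → θ = θ₀ := fun θ hθ h =>
    (hper i).eq_of_injOn_of_abs_lt h2pi (hinj i) (h.trans hθ₀.symm)
      ((abs_le.2 ⟨by linarith [hθ.1], by linarith [hθ.2]⟩ : |θ - θ₀| ≤ Real.pi).trans_lt
        (by linarith))
  have hrange : ∀ j a, range (γ j) = γ j '' Icc a (a + 2 * Real.pi) := fun j a =>
    ((hper j).image_Icc h2pi a).symm
  refine ⟨γ i, θ₀, (hγ i).of_le (by exact_mod_cast le_top), hθ₀, hdne i θ₀, ?_, fun θ => ?_,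
    huniq, fun η hη => ?_⟩
  · have := hper i (θ₀ - Real.pi)
    rw [← this]; congr 1; ring
  · rw [hfr]; exact mem_iUnion.2 ⟨i, θ, rfl⟩
  · set K := (⋃ j ∈ {j | j ≠ i}, range (γ j)) ∪
      γ i '' (Icc (θ₀ - Real.pi) (θ₀ + Real.pi) \ Ioo (θ₀ - η) (θ₀ + η)) with hK
    have hKc : IsCompact K := by
      refine IsCompact.union ((toFinite _).isCompact_biUnion fun j _ => ?_) ?_
      · rw [hrange j 0]
        exact isCompact_Icc.image (hγ j).continuous
      · exact (isCompact_Icc.diff isOpen_Ioo).image (hγ i).continuous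
    have hzK : z₀ ∈ Kᶜ := by
      rintro (h | ⟨θ, hθ, h⟩)
      · obtain ⟨j, hj, h⟩ := mem_iUnion₂.1 h
        exact (hdisj hj).le_bot ⟨h, θ₀, hθ₀⟩
      · have := huniq θ hθ.1 h
        subst this
        exact hθ.2 ⟨by linarith, by linarith⟩
    obtain ⟨r, hr, hball⟩ := Metric.isOpen_iff.1 hKc.isClosed.isOpen_compl z₀ hzK
    refine ⟨r, hr, fun z hz hzr => ?_⟩
    have hzn : z ∉ K := hball (by rwa [mem_ball, dist_eq_norm])
    rw [hfr] at hz
    obtain ⟨j, hj⟩ := mem_iUnion.1 hz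
    by_cases hji : j = i
    · subst hji
      rw [hrange j (θ₀ - Real.pi), show θ₀ - Real.pi + 2 * Real.pi = θ₀ + Real.pi by ring] at hj
      obtain ⟨θ, hθ, rfl⟩ := hj
      by_contra h
      exact hzn (Or.inr ⟨θ, ⟨hθ, fun h' => h ⟨θ, h', rfl⟩⟩, rfl⟩)
    · exact (hzn (Or.inl (mem_iUnion₂.2 ⟨j, hji, hj⟩))).elim

/-- A domain with smooth boundary has a graph chart at every boundary point. -/
theorem HasSmoothBoundary.exists_isGraphChart {Ω : Set ℂ} (hsm : HasSmoothBoundary Ω)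
    (ho : IsOpen Ω) (hc : IsPreconnected Ω) {z₀ : ℂ} (hz₀ : z₀ ∈ frontier Ω) :
    ∃ (u : ℂ) (g g' : ℝ → ℝ) (δ : ℝ), IsGraphChart Ω z₀ u g g' δ := by
  obtain ⟨γ, θ₀, hγ, hγ0, hd, hper, hmem, huniq, harc⟩ := hsm.exists_arc hz₀
  set u : ℂ := deriv γ θ₀ / ‖deriv γ θ₀‖ with hud
  have hn : 0 < ‖deriv γ θ₀‖ := norm_pos_iff.2 hd
  have hu : ‖u‖ = 1 := by simp [hud, hn.ne']
  have huu : u * conj u = 1 := by rw [mul_conj, normSq_eq_norm_sq, hu]; simp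
  set ψ : ℝ → ℂ := fun θ => conj u * (γ θ - z₀) with hψd
  have hψ : ContDiff ℝ 1 ψ := contDiff_const.mul (hγ.sub contDiff_const)
  have hψγ : ∀ θ, z₀ + u * ψ θ = γ θ := fun θ => by
    simp only [hψd]; rw [← mul_assoc, huu]; ring
  have hdψ : deriv ψ θ₀ = ((‖deriv γ θ₀‖ : ℝ) : ℂ) := by
    have h1 : HasDerivAt ψ (conj u * deriv γ θ₀) θ₀ :=
      (((hγ.differentiable one_ne_zero) θ₀).hasDerivAt.sub_const z₀).const_mul _
    rw [h1.deriv]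
    have : deriv γ θ₀ = u * ‖deriv γ θ₀‖ := by
      rw [hud, div_mul_cancel₀]; exact_mod_cast hn.ne'
    rw [this, ← mul_assoc, mul_comm (conj u), huu]; simp [hu]
  obtain ⟨g, g', η, δ₁, hg, hgd, hgc, hg0, hg'0, hη, hηπ, hδ₁, hmono, him, hgraph⟩ :=
    exists_local_graph hψ (by simp [hψd, hγ0]) hn hdψ Real.pi_pos
  obtain ⟨r, hr, hloc⟩ := harc η hη
  set δ := min δ₁ (r / 2) with hδd
  have hδ : 0 < δ := lt_min hδ₁ (by linarith)
  have hδr : δ ≤ r / 2 := min_le_right _ _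
  suffices h : ∃ (u' : ℂ) (h h' : ℝ → ℝ), IsGraphChart Ω z₀ u' h h' δ by
    obtain ⟨u', h, h', hch⟩ := h
    exact ⟨u', h, h', δ, hch⟩
  refine _root_.exists_isGraphChart ho hz₀ hu hg hgd hgc hg0 hg'0 hδ (fun z hz => ⟨fun h => ?_,
    fun h => ?_⟩) ?_
  · have hzr : ‖z₀ + u * z - z₀‖ < r := by
      rw [add_sub_cancel_left, norm_mul, hu, one_mul]
      refine (Complex.norm_le_abs_re_add_abs_im z).trans_lt ?_
      linarith [hz.1, hz.2]
    obtain ⟨θ, hθ, he⟩ := hloc _ h hzr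
    have hzψ : z = ψ θ := by
      simp only [hψd]; rw [he, add_sub_cancel_left, ← mul_assoc, mul_comm (conj u), huu, one_mul]
    rw [hzψ]
    exact him θ ⟨hθ.1.le, hθ.2.le⟩
  · obtain ⟨t, ht⟩ := hgraph z.re (hz.1.trans_le (min_le_left _ _))
    have hzt : z = ψ t := by
      rw [ht]; apply Complex.ext <;> simp [h]
    rw [hzt, hψγ]; exact hmem t
  · rintro ⟨hp, hm⟩
    refine not_both_sides hγ hper hη (by linarith) (by linarith) hu hγ0 (fun θ hθ hθ' h => ?_)
      hmono ho hc (fun θ h => ?_) hp hm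
    · exact hθ' (by rw [huniq θ hθ h]; constructor <;> linarith)
    · have := hmem θ
      rw [ho.frontier_eq] at this
      exact this.2 h

lemma HasSmoothBoundary.hausdorffMeasure_frontier_lt_top {Ω : Set ℂ} (hsm : HasSmoothBoundary Ω) :
    μH[1] (frontier Ω) < ⊤ := by
  obtain ⟨-, n, γ, hγ, hper, -, -, -, hfr⟩ := hsm
  rw [hfr]
  refine (measure_iUnion_le _).trans_lt ?_
  rw [tsum_fintype]
  refine ENNReal.sum_lt_top.2 fun i _ => ?_
  rw [← (hper i).image_Icc (by positivity) 0]
  have hc1 : ContDiff ℝ 1 (γ i) := (hγ i).of_le (by exact_mod_cast le_top)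
  obtain ⟨C, hC⟩ := isCompact_Icc.exists_bound_of_continuousOn (s := Icc (0 : ℝ) (0 + 2 * Real.pi))
    (hc1.continuous_deriv le_rfl).continuousOn
  have hL : LipschitzOnWith C.toNNReal (γ i) (Icc 0 (0 + 2 * Real.pi)) :=
    (convex_Icc _ _).lipschitzOnWith_of_nnnorm_deriv_le
      (fun x _ => hc1.differentiable one_ne_zero x) fun x hx => by
        rw [← NNReal.coe_le_coe, coe_nnnorm]
        exact (hC x hx).trans (Real.le_coe_toNNReal C)
  refine (hL.hausdorffMeasure_image_le zero_le_one).trans_lt ?_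
  rw [hausdorffMeasure_real]
  simp only [ENNReal.rpow_one, Real.volume_Icc]
  exact ENNReal.mul_lt_top ENNReal.coe_lt_top ENNReal.ofReal_lt_top

/-- Arclength on the graph of a `C¹` function with horizontal tangent at the origin has a density
with respect to the abscissa, which is close to `1` near the origin. -/
theorem exists_density_hausdorffMeasure_graph {g g' : ℝ → ℝ}
    (hg : ∀ x y, |g x - g y| ≤ |x - y| / 2) (hgd : ∀ x, HasDerivAt g (g' x) x)
    (hgc : Continuous g') (hg'0 : g' 0 = 0) {z₀ u : ℂ} (hu : ‖u‖ = 1) {δ : ℝ} :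
    ∃ ρ : ℝ → ℝ, Measurable ρ ∧ (∀ᵐ x ∂volume.restrict (Ioo (-δ) δ), |ρ x| ≤ 2) ∧
      (∀ ε > 0, ∃ η > 0, ∀ᵐ x ∂volume.restrict (Ioo (-δ) δ), |x| < η → |ρ x - 1| ≤ ε) ∧
      ∀ F : ℂ → ℂ, ∫ z in (fun x : ℝ => z₀ + u * (x + g x * I)) '' Ioo (-δ) δ, F z ∂(μH[1]) =
        ∫ x in Ioo (-δ) δ, ρ x * F (z₀ + u * (x + g x * I)) := by
  have huu : conj u * u = 1 := by rw [mul_comm, mul_conj, normSq_eq_norm_sq, hu]; simp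
  have hgcont : Continuous g := continuous_iff_continuousAt.2 fun x => (hgd x).continuousAt
  set τ : ℝ → ℂ := fun x : ℝ => z₀ + u * (x + g x * I) with hτd
  have hτc : Continuous τ := by fun_prop
  set π : ℂ → ℝ := fun w => (conj u * (w - z₀)).re with hπd
  have hπc : Continuous π := by fun_prop
  have hπτ : ∀ x, π (τ x) = x := fun x => by
    simp only [hπd, hτd]
    rw [add_sub_cancel_left, ← mul_assoc, huu]; simp
  have hinj : Function.Injective τ := fun x y h => by rw [← hπτ x, h, hπτ]
  have hemb : MeasurableEmbedding τ :=
    hτc.measurableEmbedding hinj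
  have hlow : ∀ A : Set ℝ, volume A ≤ μH[1] (τ '' A) := fun A => by
    have hL : LipschitzOnWith 1 π (τ '' A) := LipschitzWith.lipschitzOnWith <|
      LipschitzWith.of_dist_le_mul fun a b => by
        rw [Real.dist_eq, NNReal.coe_one, one_mul, dist_eq_norm]
        simp only [hπd]
        rw [← sub_re, ← mul_sub]
        refine (Complex.abs_re_le_norm _).trans ?_
        rw [norm_mul, RCLike.norm_conj, hu, one_mul]; simp
    have := hL.hausdorffMeasure_image_le (d := 1) zero_le_one
    rw [← hausdorffMeasure_real]
    rw [← image_comp] at this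
    simpa [Function.comp_def, hπτ] using this
  have hup : ∀ (κ : ℝ) (A : Set ℝ), 0 ≤ κ → (∀ x ∈ A, ∀ y ∈ A, |g x - g y| ≤ κ * |x - y|) →
      μH[1] (τ '' A) ≤ ENNReal.ofReal (1 + κ) * volume A := fun κ A hκ h => by
    have hL : LipschitzOnWith (1 + κ).toNNReal τ A := LipschitzOnWith.of_dist_le_mul
      fun x hx y hy => by
        rw [Real.coe_toNNReal _ (by linarith), Real.dist_eq, dist_eq_norm]
        have : τ x - τ y = u * (((x - y : ℝ) : ℂ) + ((g x - g y : ℝ) : ℂ) * I) := by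
          simp only [hτd]; push_cast; ring
        rw [this, norm_mul, hu, one_mul]
        refine (norm_add_le _ _).trans ?_
        rw [norm_mul, norm_I, mul_one, Complex.norm_real, Complex.norm_real]
        simp only [Real.norm_eq_abs]
        linarith [h x hx y hy]
    have := hL.hausdorffMeasure_image_le (d := 1) zero_le_one
    rw [hausdorffMeasure_real] at this
    simpa [ENNReal.ofReal] using this
  set J := Ioo (-δ) δ with hJ
  set ν : Measure ℝ := (Measure.comap τ μH[1]).restrict J with hν
  have hνA : ∀ A, MeasurableSet A → ν A = μH[1] (τ '' (A ∩ J)) := fun A hA => by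
    rw [hν, Measure.restrict_apply hA, hemb.comap_apply]
  have hν2 : ∀ A, MeasurableSet A → ν A ≤ 2 * volume.restrict J A := fun A hA => by
    rw [hνA A hA, Measure.restrict_apply hA]
    refine (hup 1 _ zero_le_one fun x _ y _ => ?_).trans (by norm_num)
    have := hg x y
    have := abs_nonneg (x - y)
    linarith
  have : IsFiniteMeasure ν := ⟨by
    refine (hν2 _ MeasurableSet.univ).trans_lt ?_
    rw [Measure.restrict_apply_univ, hJ, Real.volume_Ioo]
    exact ENNReal.mul_lt_top (by simp) ENNReal.ofReal_lt_top⟩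
  have hac : ν ≪ volume.restrict J := by
    refine Measure.AbsolutelyContinuous.mk fun A hA h => ?_
    have := hν2 A hA
    rw [h, mul_zero] at this
    exact le_antisymm this zero_le
  set θ := ν.rnDeriv (volume.restrict J) with hθ
  have hθm : Measurable θ := Measure.measurable_rnDeriv _ _
  have hwd : (volume.restrict J).withDensity θ = ν := Measure.withDensity_rnDeriv_eq _ _ hac
  have hθν : ∀ A, MeasurableSet A → ∫⁻ x in A, θ x ∂(volume.restrict J) = ν A := fun A hA => by
    rw [← hwd, withDensity_apply _ hA]
  have hθ1 : ∀ᵐ x ∂volume.restrict J, 1 ≤ θ x := by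
    refine ae_le_of_forall_setLIntegral_le_of_sigmaFinite measurable_const fun A hA _ => ?_
    rw [hθν A hA, hνA A hA, lintegral_one, Measure.restrict_apply_univ, Measure.restrict_apply hA]
    exact hlow _
  have hθ2 : ∀ᵐ x ∂volume.restrict J, θ x ≤ 2 := by
    refine ae_le_of_forall_setLIntegral_le_of_sigmaFinite hθm fun A hA _ => ?_
    rw [hθν A hA, lintegral_const, Measure.restrict_apply_univ]
    exact hν2 A hA
  refine ⟨fun x => (θ x).toReal, hθm.ennreal_toReal, ?_, fun ε hε => ?_, fun F => ?_⟩
  · filter_upwards [hθ2] with x hx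
    rw [abs_of_nonneg ENNReal.toReal_nonneg]
    exact ENNReal.toReal_le_of_le_ofReal (by norm_num) (by simpa using hx)
  · obtain ⟨η, hη, hb⟩ := Metric.continuousAt_iff.1 (hgc.continuousAt (x := 0)) ε hε
    refine ⟨η, hη, ?_⟩
    have hloc : ∀ x ∈ Ioo (-η) η, ∀ y ∈ Ioo (-η) η, |g x - g y| ≤ ε * |x - y| :=
      fun x hx y hy => by
        have := Convex.norm_image_sub_le_of_norm_hasDerivWithin_le (C := ε)
          (fun x _ => (hgd x).hasDerivWithinAt) (fun t ht => ?_) (convex_Ioo (-η) η) hy hx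
        · simpa only [Real.norm_eq_abs] using this
        · have := hb (x := t) (by simpa using abs_lt.2 ht)
          rw [hg'0, dist_zero_right] at this
          exact this.le
    have hθε : ∀ᵐ x ∂(volume.restrict J).restrict (Ioo (-η) η), θ x ≤ ENNReal.ofReal (1 + ε) := by
      refine ae_le_of_forall_setLIntegral_le_of_sigmaFinite hθm fun A hA _ => ?_
      rw [Measure.restrict_restrict hA, hθν _ (hA.inter measurableSet_Ioo),
        hνA _ (hA.inter measurableSet_Ioo), lintegral_const, Measure.restrict_apply_univ,
        Measure.restrict_apply (hA.inter measurableSet_Ioo)]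
      exact hup ε _ hε.le fun x hx y hy => hloc x hx.1.2 y hy.1.2
    rw [ae_restrict_iff' measurableSet_Ioo] at hθε
    filter_upwards [hθε, hθ1] with x h1 h2 hx
    have h3 := h1 (abs_lt.1 hx)
    have h4 : (θ x).toReal ≤ 1 + ε := ENNReal.toReal_le_of_le_ofReal (by linarith) h3
    have h5 : 1 ≤ (θ x).toReal := by
      have := ENNReal.toReal_mono (h3.trans_lt ENNReal.ofReal_lt_top).ne h2
      simpa using this
    rw [abs_of_nonneg (by linarith)]; linarith
  · have himg : (μH[1] : Measure ℂ).restrict (τ '' J) = Measure.map τ ν := by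
      ext A hA
      rw [Measure.restrict_apply hA, hemb.map_apply, hνA _ (hτc.measurable hA)]
      congr 1
      ext z
      constructor
      · rintro ⟨h, x, hx, rfl⟩; exact ⟨x, ⟨h, hx⟩, rfl⟩
      · rintro ⟨x, ⟨h, hx⟩, rfl⟩; exact ⟨h, x, hx, rfl⟩
    rw [himg, hemb.integral_map, ← hwd, integral_withDensity_eq_integral_toReal_smul hθm
      (hθ2.mono fun x hx => hx.trans_lt (by simp))]
    simp only [Complex.real_smul, hτd]

lemma mul_conj_of_norm_eq_one {u : ℂ} (hu : ‖u‖ = 1) : u * conj u = 1 := by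
  rw [mul_conj, normSq_eq_norm_sq, hu]; simp

lemma areaCauchy_affine {Ω : Set ℂ} {z₀ u : ℂ} (hu : ‖u‖ = 1) (w : ℂ) :
    areaCauchy Ω (z₀ + u * w) = u⁻¹ * areaCauchy {z | z₀ + u * z ∈ Ω} w := by
  have hu0 : u ≠ 0 := by rintro rfl; simp at hu
  let e₁ : ℂ ≃ₗᵢ[ℝ] ℂ := rotation ⟨u, by simp [Submonoid.unitSphere, hu]⟩
  have h1 : MeasurePreserving (fun z => z₀ + u * z) (volume : Measure ℂ) volume :=
    (measurePreserving_add_left volume z₀).comp e₁.measurePreserving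
  have h2 : MeasurableEmbedding (fun z => z₀ + u * z) :=
    (Homeomorph.addLeft z₀).measurableEmbedding.comp e₁.toHomeomorph.measurableEmbedding
  unfold areaCauchy
  rw [← h1.setIntegral_preimage_emb h2, ← integral_const_mul]
  refine integral_congr_ae (Eventually.of_forall fun z => ?_)
  simp only
  rw [← mul_inv]
  congr 1
  ring

namespace IsGraphChart

variable {Ω : Set ℂ} {z₀ u : ℂ} {g g' : ℝ → ℝ} {δ : ℝ}

lemma continuous_graph (hch : IsGraphChart Ω z₀ u g g' δ) : Continuous g :=
  continuous_iff_continuousAt.2 fun x => (hch.hasDerivAt x).continuousAt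

lemma mem_frontier_iff (hch : IsGraphChart Ω z₀ u g g' δ) (ho : IsOpen Ω) {z : ℂ}
    (hz : z ∈ openSquare δ) : z₀ + u * z ∈ frontier Ω ↔ z.im = g z.re := by
  have h1 := hch.mem_iff z hz
  have h2 := not_iff_not.2 (hch.notMem_closure_iff z hz)
  rw [not_not] at h2
  rw [ho.frontier_eq, Set.mem_sdiff, h1, h2]
  constructor
  · rintro ⟨h3, h4⟩; linarith
  · intro h; constructor <;> linarith

lemma tendsto_nhdsWithin (hch : IsGraphChart Ω z₀ u g g' δ) {F : ℂ → ℂ} {c : ℂ}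
    (hF : Tendsto (fun p : ℝ × ℝ => F (z₀ + u * ((p.1 + g p.1 * I) + p.2 * I)))
      (𝓝 0 ×ˢ 𝓝[>] 0) (𝓝 c)) : Tendsto F (𝓝[Ω] z₀) (𝓝 c) := by
  have huu := mul_conj_of_norm_eq_one hch.norm_eq_one
  have hgc := hch.continuous_graph
  set N : ℂ → ℂ := fun w => conj u * (w - z₀) with hN
  have hNc : Continuous N := by fun_prop
  have hNw : ∀ w, z₀ + u * N w = w := fun w => by
    simp only [hN]; rw [← mul_assoc, huu]; ring
  have hm : Tendsto (fun w => ((N w).re, (N w).im - g (N w).re)) (𝓝[Ω] z₀) (𝓝 0 ×ˢ 𝓝[>] 0) := by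
    refine Tendsto.prodMk ?_ (tendsto_nhdsWithin_iff.2 ⟨?_, ?_⟩)
    · refine tendsto_nhdsWithin_of_tendsto_nhds ?_
      have : Continuous fun w => (N w).re := by fun_prop
      simpa [hN] using this.tendsto z₀
    · refine tendsto_nhdsWithin_of_tendsto_nhds ?_
      have : Continuous fun w => (N w).im - g (N w).re := by fun_prop
      simpa [hN, hch.map_zero] using this.tendsto z₀
    · have : ∀ᶠ w in 𝓝 z₀, N w ∈ openSquare δ :=
        hNc.continuousAt.eventually (by
          simpa [hN] using (isOpen_openSquare δ).mem_nhds (zero_mem_openSquare hch.pos))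
      filter_upwards [mem_nhdsWithin_of_mem_nhds this, self_mem_nhdsWithin] with w h1 h2
      have := (hch.mem_iff _ h1).1 (by rwa [hNw])
      simpa using this
  refine (hF.comp hm).congr fun w => ?_
  simp only [Function.comp]
  congr 1
  rw [show ((N w).re + g (N w).re * I + ((N w).im - g (N w).re : ℝ) * I : ℂ) = N w by
    apply Complex.ext <;> simp, hNw]

lemma eventually_mem_openSquare_add (hch : IsGraphChart Ω z₀ u g g' δ) :
    ∀ᶠ p : ℝ × ℝ in 𝓝 0 ×ˢ 𝓝[>] 0, ((p.1 + g p.1 * I) + p.2 * I : ℂ) ∈ openSquare δ :=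
  have hgc := hch.continuous_graph
  (tendsto_graph_add (ζ := fun x : ℝ => (x + g x * I : ℂ)) (by fun_prop)
    (by simp [hch.map_zero])).eventually
    ((isOpen_openSquare δ).mem_nhds (zero_mem_openSquare hch.pos))

lemma eventually_mem_openSquare_sub (hch : IsGraphChart Ω z₀ u g g' δ) :
    ∀ᶠ p : ℝ × ℝ in 𝓝 0 ×ˢ 𝓝[>] 0, ((p.1 + g p.1 * I) - p.2 * I : ℂ) ∈ openSquare δ :=
  have hgc := hch.continuous_graph
  (tendsto_graph_sub (ζ := fun x : ℝ => (x + g x * I : ℂ)) (by fun_prop)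
    (by simp [hch.map_zero])).eventually
    ((isOpen_openSquare δ).mem_nhds (zero_mem_openSquare hch.pos))

lemma eventually_add_mem (hch : IsGraphChart Ω z₀ u g g' δ) :
    ∀ᶠ p : ℝ × ℝ in 𝓝 0 ×ˢ 𝓝[>] 0, z₀ + u * ((p.1 + g p.1 * I) + p.2 * I) ∈ Ω := by
  filter_upwards [hch.eventually_mem_openSquare_add, eventually_snd_pos] with p h1 h2
  refine (hch.mem_iff _ h1).2 ?_
  simpa using h2

lemma eventually_sub_mem (hch : IsGraphChart Ω z₀ u g g' δ) :
    ∀ᶠ p : ℝ × ℝ in 𝓝 0 ×ˢ 𝓝[>] 0, z₀ + u * ((p.1 + g p.1 * I) - p.2 * I) ∈ (closure Ω)ᶜ := by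
  filter_upwards [hch.eventually_mem_openSquare_sub, eventually_snd_pos] with p h1 h2
  refine (hch.notMem_closure_iff _ h1).2 ?_
  simpa using h2

lemma tendsto_add (hch : IsGraphChart Ω z₀ u g g' δ) :
    Tendsto (fun p : ℝ × ℝ => z₀ + u * ((p.1 + g p.1 * I) + p.2 * I)) (𝓝 0 ×ˢ 𝓝[>] 0)
      (𝓝 z₀) := by
  have hgc := hch.continuous_graph
  simpa using ((tendsto_graph_add (ζ := fun x : ℝ => (x + g x * I : ℂ)) (by fun_prop)
    (by simp [hch.map_zero])).const_mul u).const_add z₀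

lemma tendsto_sub (hch : IsGraphChart Ω z₀ u g g' δ) :
    Tendsto (fun p : ℝ × ℝ => z₀ + u * ((p.1 + g p.1 * I) - p.2 * I)) (𝓝 0 ×ˢ 𝓝[>] 0)
      (𝓝 z₀) := by
  have hgc := hch.continuous_graph
  simpa using ((tendsto_graph_sub (ζ := fun x : ℝ => (x + g x * I : ℂ)) (by fun_prop)
    (by simp [hch.map_zero])).const_mul u).const_add z₀

/-- Jump relation for the derivative of the Cauchy transform of a domain. -/
theorem tendsto_deriv_areaCauchy (hch : IsGraphChart Ω z₀ u g g' δ) (hb : Bornology.IsBounded Ω)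
    (ho : IsOpen Ω) {R : ℂ → ℂ} (hR : AnalyticAt ℂ R z₀)
    (hRC : ∀ w ∈ (closure Ω)ᶜ, areaCauchy Ω w = R w) :
    Tendsto (deriv fun w => areaCauchy Ω w + Real.pi * conj w) (𝓝[Ω] z₀)
      (𝓝 (deriv R z₀ + Real.pi * conj u ^ 2)) := by
  have hu0 : u ≠ 0 := by rintro rfl; simpa using hch.norm_eq_one
  have huu := mul_conj_of_norm_eq_one hch.norm_eq_one
  set Ω' := {z | z₀ + u * z ∈ Ω} with hΩ'
  have hT : Continuous fun z => z₀ + u * z := by fun_prop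
  have ho' : IsOpen Ω' := ho.preimage hT
  have hb' : Bornology.IsBounded Ω' := by
    obtain ⟨r, hr⟩ := hb.subset_closedBall z₀
    refine isBounded_closedBall (x := (0 : ℂ)) (r := r) |>.subset fun z hz => ?_
    have := hr hz
    rw [mem_closedBall, dist_eq_norm, add_sub_cancel_left, norm_mul, hch.norm_eq_one,
      one_mul] at this
    simpa using this
  obtain ⟨V, hV, hjump⟩ := exists_vertical_deriv_areaCauchy (ζ := fun x : ℝ => (x + g x * I : ℂ))
    (fun _ => rfl) hch.lip hch.hasDerivAt hch.continuous_deriv hch.map_zero hch.deriv_zero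
    hch.pos hb' ho' hch.mem_iff
  have hAC : ∀ w, areaCauchy Ω' w = u * areaCauchy Ω (z₀ + u * w) := fun w => by
    rw [areaCauchy_affine hch.norm_eq_one, ← mul_assoc, mul_inv_cancel₀ hu0, one_mul]
  set H : ℂ → ℂ := fun w => areaCauchy Ω w + Real.pi * conj w with hH
  have hHd : DifferentiableOn ℂ H Ω := differentiableOn_areaCauchy_add_conj hb ho
  have hline : ∀ w : ℂ, HasDerivAt (fun s : ℝ => z₀ + u * (w + s * I)) (u * I) 0 := fun w => by
    have h1 : HasDerivAt (fun s : ℝ => (s : ℂ)) 1 0 := Complex.ofRealCLM.hasDerivAt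
    simpa using (((h1.mul_const I).const_add w).const_mul u).const_add z₀
  have hVup : ∀ w ∈ openSquare δ, z₀ + u * w ∈ Ω →
      V w = I * (u ^ 2 * deriv H (z₀ + u * w) + Real.pi) := fun w hw hwΩ => by
    have hgw : w.im ≠ g w.re := ((hch.mem_iff w hw).1 hwΩ).ne'
    have h1 := hV w hw hgw
    have h2 : HasDerivAt H (deriv H (z₀ + u * w)) (z₀ + u * (w + (0 : ℝ) * I)) := by
      simpa using ((hHd _ hwΩ).differentiableAt (ho.mem_nhds hwΩ)).hasDerivAt
    have h3 := h2.scomp (0 : ℝ) (hline w)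
    have h4 : HasDerivAt (fun s : ℝ => conj (z₀ + u * (w + s * I))) (conj (u * I)) 0 :=
      (hline w).star
    have h5 := (h3.sub (h4.const_mul (Real.pi : ℂ))).const_mul u
    refine (h1.unique (h5.congr_of_eventuallyEq (Eventually.of_forall fun s => ?_))).trans ?_
    · simp only [hAC, Function.comp_def, hH, Pi.sub_apply]; ring
    · simp only [smul_eq_mul, map_mul, conj_I]
      linear_combination (Real.pi * I : ℂ) * huu
  obtain ⟨hRd, hRc⟩ : (∀ᶠ w in 𝓝 z₀, DifferentiableAt ℂ R w) ∧ ContinuousAt (deriv R) z₀ :=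
    ⟨hR.eventually_analyticAt.mono fun w hw => hw.differentiableAt, hR.deriv.continuousAt⟩
  have hVdn : ∀ w ∈ openSquare δ, z₀ + u * w ∈ (closure Ω)ᶜ → DifferentiableAt ℂ R (z₀ + u * w) →
      V w = I * (u ^ 2 * deriv R (z₀ + u * w)) := fun w hw hwΩ hd => by
    have hgw : w.im ≠ g w.re := ((hch.notMem_closure_iff w hw).1 hwΩ).ne
    have h1 := hV w hw hgw
    have h2 : HasDerivAt R (deriv R (z₀ + u * w)) (z₀ + u * (w + (0 : ℝ) * I)) := by
      simpa using hd.hasDerivAt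
    have h5 := (h2.scomp (0 : ℝ) (hline w)).const_mul u
    have hnear : ∀ᶠ s : ℝ in 𝓝 0, z₀ + u * (w + s * I) ∈ (closure Ω)ᶜ :=
      (hline w).continuousAt.eventually_mem (isClosed_closure.isOpen_compl.mem_nhds (by
        simpa using hwΩ))
    refine (h1.unique (h5.congr_of_eventuallyEq (hnear.mono fun s hs => ?_))).trans ?_
    · simp only [hAC, Function.comp_def]; rw [hRC _ hs]
    · simp only [smul_eq_mul]; ring
  refine hch.tendsto_nhdsWithin ?_
  have h1 : Tendsto (fun p : ℝ × ℝ => deriv R (z₀ + u * ((p.1 + g p.1 * I) - p.2 * I)))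
      (𝓝 0 ×ˢ 𝓝[>] 0) (𝓝 (deriv R z₀)) := hRc.tendsto.comp hch.tendsto_sub
  have h2 := h1.add (((hjump.const_mul (-I)).sub_const (Real.pi : ℂ)).const_mul (conj u ^ 2))
  have h3 : conj u ^ 2 * (-I * (2 * Real.pi * I) - Real.pi) = Real.pi * conj u ^ 2 := by
    linear_combination (-2 * Real.pi * conj u ^ 2 : ℂ) * I_mul_I
  rw [h3] at h2
  refine h2.congr' ?_
  filter_upwards [hch.eventually_mem_openSquare_add, hch.eventually_mem_openSquare_sub,
    hch.eventually_add_mem, hch.eventually_sub_mem, hch.tendsto_sub.eventually hRd]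
    with p ha hs ha' hs' hd
  rw [hVup _ ha ha', hVdn _ hs hs' hd]
  have h4 : u ^ 2 * conj u ^ 2 = 1 := by rw [← mul_pow, huu, one_pow]
  generalize deriv H _ = X
  generalize deriv R _ = Y
  linear_combination (-conj u ^ 2 * (u ^ 2 * X + Real.pi - u ^ 2 * Y)) * I_mul_I + (X - Y) * h4

end IsGraphChart

lemma integrableOn_of_continuousOn_frontier {Ω : Set ℂ} (hb : Bornology.IsBounded Ω)
    (hfin : μH[1] (frontier Ω) < ⊤) {φ : ℂ → ℂ} (hφ : ContinuousOn φ (frontier Ω)) :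
    IntegrableOn φ (frontier Ω) μH[1] := by
  have hK : IsCompact (frontier Ω) :=
    Metric.isCompact_of_isClosed_isBounded isClosed_frontier
      (hb.closure.subset frontier_subset_closure)
  obtain ⟨M, hM⟩ := hK.exists_bound_of_continuousOn hφ
  have : IsFiniteMeasure ((μH[1] : Measure ℂ).restrict (frontier Ω)) := ⟨by simpa using hfin⟩
  exact Integrable.of_bound (hφ.aestronglyMeasurable hK.measurableSet) M
    ((ae_restrict_iff' hK.measurableSet).2 (Eventually.of_forall hM))

lemma integrableOn_mul_graph_sub_inv {g : ℝ → ℝ} (hg : Continuous g) {δ M : ℝ} {χ : ℝ → ℂ}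
    (hm : AEStronglyMeasurable χ (volume.restrict (Ioo (-δ) δ)))
    (hM : ∀ᵐ x ∂volume.restrict (Ioo (-δ) δ), ‖χ x‖ ≤ M) {c : ℂ}
    (hc : ∀ x : ℝ, (x + g x * I : ℂ) ≠ c) :
    IntegrableOn (fun x : ℝ => χ x * ((x + g x * I : ℂ) - c)⁻¹) (Ioo (-δ) δ) := by
  have h1 : IntegrableOn (fun x : ℝ => ((x + g x * I : ℂ) - c)⁻¹) (Ioo (-δ) δ) := by
    refine (Continuous.integrableOn_Icc ?_).mono_set Ioo_subset_Icc_self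
    exact Continuous.inv₀ (by fun_prop) fun x => sub_ne_zero.2 (hc x)
  exact h1.bdd_mul hm hM

/-- Jump relation for Cauchy integrals with respect to arclength. -/
theorem IsGraphChart.tendsto_cauchyIntegral {Ω : Set ℂ} {z₀ u : ℂ} {g g' : ℝ → ℝ} {δ : ℝ}
    (hch : IsGraphChart Ω z₀ u g g' δ) (hb : Bornology.IsBounded Ω) (ho : IsOpen Ω)
    (hfin : μH[1] (frontier Ω) < ⊤) {φ : ℂ → ℂ} (hφ : ContinuousOn φ (frontier Ω))
    {L : ℂ → ℂ} (hL : ContinuousAt L z₀)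
    (hext : ∀ w ∈ (closure Ω)ᶜ, ∫ z in frontier Ω, φ z * (z - w)⁻¹ ∂(μH[1]) = L w) :
    Tendsto (fun w => ∫ z in frontier Ω, φ z * (z - w)⁻¹ ∂(μH[1])) (𝓝[Ω] z₀)
      (𝓝 (L z₀ + 2 * Real.pi * I * φ z₀ * conj u)) := by
  have hu0 : u ≠ 0 := by rintro rfl; simpa using hch.norm_eq_one
  have huu := mul_conj_of_norm_eq_one hch.norm_eq_one
  have hui : u⁻¹ = conj u := inv_eq_of_mul_eq_one_right huu
  have hgc := hch.continuous_graph
  set ζ : ℝ → ℂ := fun x => x + g x * I with hζ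
  have hζc : Continuous ζ := by fun_prop
  set τ : ℝ → ℂ := fun x => z₀ + u * (x + g x * I) with hτ
  have hτc : Continuous τ := by fun_prop
  obtain ⟨ρ, hρm, hρ2, hρ1, hρ⟩ := exists_density_hausdorffMeasure_graph (z₀ := z₀) (δ := δ)
    hch.lip hch.hasDerivAt hch.continuous_deriv hch.deriv_zero hch.norm_eq_one
  set J := Ioo (-δ) δ with hJ
  set E := τ '' J with hE
  have hgb : ∀ x ∈ J, |g x| < δ := fun x hx => by
    have h1 := hch.lip x 0
    rw [hch.map_zero, sub_zero, sub_zero] at h1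
    have h2 := abs_lt.2 hx
    have := abs_nonneg x
    linarith
  have hζmem : ∀ x ∈ J, ζ x ∈ openSquare δ := fun x hx =>
    ⟨by simpa [hζ] using abs_lt.2 hx, by simpa [hζ] using hgb x hx⟩
  have hEf : ∀ x ∈ J, τ x ∈ frontier Ω := fun x hx =>
    (hch.mem_frontier_iff ho (hζmem x hx)).2 (by simp [hζ])
  set B : Set ℂ := (fun w => conj u * (w - z₀)) ⁻¹' openSquare δ with hB
  have hBo : IsOpen B := (isOpen_openSquare δ).preimage (by fun_prop)
  have hz₀B : z₀ ∈ B := by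
    simpa [hB] using zero_mem_openSquare hch.pos
  have hEB : frontier Ω ∩ B = E := by
    ext w
    constructor
    · rintro ⟨hw, hwB⟩
      have hw' : z₀ + u * (conj u * (w - z₀)) = w := by rw [← mul_assoc, huu]; ring
      have h1 := (hch.mem_frontier_iff ho hwB).1 (by rwa [hw'])
      refine ⟨(conj u * (w - z₀)).re, abs_lt.1 hwB.1, ?_⟩
      simp only [hτ]
      rw [← h1, re_add_im, hw']
    · rintro ⟨x, hx, rfl⟩
      refine ⟨hEf x hx, ?_⟩
      have : conj u * (τ x - z₀) = ζ x := by
        simp only [hτ, hζ]; rw [add_sub_cancel_left, ← mul_assoc, mul_comm (conj u), huu, one_mul]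
      simpa only [hB, mem_preimage, this] using hζmem x hx
  have hφi := integrableOn_of_continuousOn_frontier hb hfin hφ
  have hEm : MeasurableSet E := hEB ▸ isClosed_frontier.measurableSet.inter hBo.measurableSet
  set Ψ : ℂ → ℂ := fun w => ∫ z in frontier Ω \ B, φ z * (z - w)⁻¹ ∂(μH[1]) with hΨ
  have hΨc : ContinuousAt Ψ z₀ := by
    have h1 : DifferentiableOn ℂ Ψ Bᶜᶜ := differentiableOn_cauchyTransform
      (hφi.mono_set sdiff_subset) hBo.isClosed_compl (by
        filter_upwards [ae_restrict_mem (isClosed_frontier.measurableSet.diff hBo.measurableSet)]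
          with z hz using hz.2)
    rw [compl_compl] at h1
    exact (h1.differentiableAt (hBo.mem_nhds hz₀B)).continuousAt
  set χ : ℝ → ℂ := fun x => ρ x * φ (τ x) with hχ
  have hφτ : ContinuousOn (fun x => φ (τ x)) J := hφ.comp hτc.continuousOn hEf
  have hχm : AEStronglyMeasurable χ (volume.restrict J) :=
    (Complex.measurable_ofReal.comp hρm).aestronglyMeasurable.mul
      (hφτ.aestronglyMeasurable measurableSet_Ioo)
  have hK : IsCompact (frontier Ω) :=
    Metric.isCompact_of_isClosed_isBounded isClosed_frontier
      (hb.closure.subset frontier_subset_closure)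
  obtain ⟨M, hM⟩ := hK.exists_bound_of_continuousOn hφ
  have hJmem : ∀ᵐ x ∂volume.restrict J, x ∈ J := ae_restrict_mem measurableSet_Ioo
  have h0J : (0 : ℝ) ∈ J := ⟨by linarith [hch.pos], hch.pos⟩
  have hτ0 : τ 0 = z₀ := by simp [hτ, hch.map_zero]
  have hM0 : 0 ≤ M := (norm_nonneg _).trans (hM _ (hEf 0 h0J))
  have hχM : ∀ᵐ x ∂volume.restrict J, ‖χ x‖ ≤ 2 * M := by
    filter_upwards [hρ2, hJmem] with x h1 h2
    rw [hχ, norm_mul, Complex.norm_real, Real.norm_eq_abs]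
    exact mul_le_mul h1 (hM _ (hEf x h2)) (norm_nonneg _) zero_le_two
  have hχ0 : ∀ ε > 0, ∃ η > 0, ∀ᵐ x ∂volume.restrict J, |x| < η → ‖χ x - φ z₀‖ ≤ ε :=
    fun ε hε => by
      obtain ⟨η₁, hη₁, h1⟩ := hρ1 (ε / 2 / (M + 1)) (by positivity)
      have h2 := (hφτ.continuousAt (isOpen_Ioo.mem_nhds h0J))
      obtain ⟨η₂, hη₂, h2⟩ := Metric.continuousAt_iff.1 h2 (ε / 2) (by positivity)
      refine ⟨min η₁ η₂, lt_min hη₁ hη₂, ?_⟩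
      filter_upwards [h1, hJmem] with x h3 h4 h5
      have h6 := h3 (h5.trans_le (min_le_left _ _))
      have h7 := h2 (x := x) (by simpa using h5.trans_le (min_le_right _ _))
      rw [hτ0, dist_eq_norm] at h7
      have h8 : χ x - φ z₀ = ((ρ x - 1 : ℝ) : ℂ) * φ (τ x) + (φ (τ x) - φ z₀) := by
        simp only [hχ]; push_cast; ring
      have h9 : ε / 2 / (M + 1) * M ≤ ε / 2 := by
        rw [div_mul_eq_mul_div, div_le_iff₀ (by positivity)]; nlinarith
      rw [h8]
      refine (norm_add_le _ _).trans ?_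
      rw [norm_mul, Complex.norm_real, Real.norm_eq_abs]
      have := mul_le_mul h6 (hM _ (hEf x h4)) (norm_nonneg _) (by positivity)
      linarith
  have hjump := tendsto_integral_mul_jumpKernel (ζ := ζ) (fun _ => rfl) hch.lip hch.hasDerivAt
    hch.continuous_deriv hch.map_zero hch.deriv_zero hch.pos hχm hχM hχ0
  -- the Cauchy integral splits into its local part and a continuous remainder
  have hsplit : ∀ c : ℂ, z₀ + u * c ∉ frontier Ω →
      ∫ z in frontier Ω, φ z * (z - (z₀ + u * c))⁻¹ ∂(μH[1]) =
        conj u * (∫ x in J, χ x * (ζ x - c)⁻¹) + Ψ (z₀ + u * c) := fun c hc => by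
    have hInt : IntegrableOn (fun z => φ z * (z - (z₀ + u * c))⁻¹) (frontier Ω) μH[1] :=
      integrableOn_of_continuousOn_frontier hb hfin (hφ.mul (ContinuousOn.inv₀ (by fun_prop)
        fun z hz => sub_ne_zero.2 fun h => hc (h ▸ hz)))
    rw [← Set.inter_union_sdiff (frontier Ω) B, setIntegral_union
      (disjoint_sdiff_right.mono_left inter_subset_right)
      (isClosed_frontier.measurableSet.diff hBo.measurableSet)
      (hInt.mono_set inter_subset_left) (hInt.mono_set sdiff_subset), hEB, hρ, ← integral_const_mul]
    congr 1
    refine integral_congr_ae (Eventually.of_forall fun x => ?_)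
    simp only [hχ, hτ, hζ]
    rw [show z₀ + u * (x + g x * I) - (z₀ + u * c) = u * (x + g x * I - c) by ring, mul_inv, hui]
    ring
  refine hch.tendsto_nhdsWithin ?_
  have h1 : Tendsto (fun p : ℝ × ℝ => L (z₀ + u * ((p.1 + g p.1 * I) - p.2 * I)))
      (𝓝 0 ×ˢ 𝓝[>] 0) (𝓝 (L z₀)) := hL.tendsto.comp hch.tendsto_sub
  have h2 := ((hΨc.tendsto.comp hch.tendsto_add).sub (hΨc.tendsto.comp hch.tendsto_sub))
  have h3 := (h1.add h2).add (hjump.const_mul (conj u))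
  rw [sub_self, add_zero, show conj u * (2 * Real.pi * I * φ z₀) = 2 * Real.pi * I * φ z₀ * conj u
    by ring] at h3
  refine h3.congr' ?_
  filter_upwards [hch.eventually_add_mem, hch.eventually_sub_mem, eventually_snd_pos]
    with p ha hs hp
  have hs' := hext _ hs
  rw [hsplit _ fun h => hs (frontier_subset_closure h)] at hs'
  rw [hsplit _ fun h => by rw [ho.frontier_eq] at h; exact h.2 ha, ← hs']
  have hne : ∀ σ : ℝ, σ ≠ 0 → ∀ x : ℝ, (x + g x * I : ℂ) ≠ ζ p.1 + σ * I := fun σ hσ x h => by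
    have h4 := congrArg Complex.re h
    have h5 := congrArg Complex.im h
    simp [hζ] at h4 h5
    rw [h4] at h5
    exact hσ (by linarith)
  have hp1 := integrableOn_mul_graph_sub_inv hgc hχm hχM (hne p.2 hp.ne')
  have hp2 := integrableOn_mul_graph_sub_inv hgc hχm hχM (hne (-p.2) (neg_ne_zero.2 hp.ne'))
  simp only [ofReal_neg, neg_mul, ← sub_eq_add_neg] at hp2
  have hk : ∫ x in J, χ x * jumpKernel ζ (ζ p.1) p.2 x =
      (∫ x in J, χ x * (ζ x - (ζ p.1 + p.2 * I))⁻¹) -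
        ∫ x in J, χ x * (ζ x - (ζ p.1 - p.2 * I))⁻¹ := by
    rw [← integral_sub hp1 hp2]
    refine integral_congr_ae (Eventually.of_forall fun x => ?_)
    simp only [jumpKernel]; ring
  rw [hk]
  simp only [Function.comp, hζ]
  ring

/-- If the Cauchy transform of `Ω` is, off the closure, a function analytic at a boundary point,
then both agree at that point. -/
lemma IsGraphChart.areaCauchy_eq {Ω : Set ℂ} {z₀ u : ℂ} {g g' : ℝ → ℝ} {δ : ℝ}
    (hch : IsGraphChart Ω z₀ u g g' δ) (hb : Bornology.IsBounded Ω) {R : ℂ → ℂ}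
    (hR : ContinuousAt R z₀) (hRC : ∀ w ∈ (closure Ω)ᶜ, areaCauchy Ω w = R w) :
    areaCauchy Ω z₀ = R z₀ := by
  have h1 := ((continuous_areaCauchy hb).tendsto z₀).comp hch.tendsto_sub
  refine tendsto_nhds_unique h1 ((hR.tendsto.comp hch.tendsto_sub).congr' ?_)
  filter_upwards [hch.eventually_sub_mem] with p hp
  exact (hRC _ hp).symm

/-- The square of the Szegő kernel of a smoothly bounded quadrature domain satisfies a nontrivial
polynomial relation. -/
theorem IsQuadratureDomain.exists_szego_relation {Ω : Set ℂ} (ho : IsOpen Ω) (hc : IsConnected Ω)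
    (hsm : HasSmoothBoundary Ω) (hq : IsQuadratureDomain Ω) {a : ℂ} (ha : a ∈ Ω) {s : ℂ → ℂ}
    (hsd : DifferentiableOn ℂ s Ω) (hsc : ContinuousOn s (closure Ω))
    (hrep : ∀ f : ℂ → ℂ, DifferentiableOn ℂ f Ω → ContinuousOn f (closure Ω) →
      f a = ∫ z in frontier Ω, f z * conj (s z) ∂(μH[1])) :
    ∃ (m : ℕ) (c : Fin m × Fin m → ℂ), c ≠ 0 ∧
      ∀ z ∈ Ω, ∑ p, c p * (z ^ (p.1 : ℕ) * (s z ^ 2) ^ (p.2 : ℕ)) = 0 := by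
  have hb := hsm.1
  have hpi : (Real.pi : ℂ) ≠ 0 := by exact_mod_cast Real.pi_ne_zero
  have hfin := hsm.hausdorffMeasure_frontier_lt_top
  have hnot : ∀ z ∈ frontier Ω, z ∉ Ω := fun z hz h => by
    rw [ho.frontier_eq] at hz; exact hz.2 h
  obtain ⟨p, l, hl, hp, hpl⟩ := hq.exists_areaCauchy_mul_prodSub ho hb
  have hne : ∀ (l' : List ℂ), (∀ b ∈ l', b ∈ Ω) → ∀ z ∉ Ω, prodSub l' z ≠ 0 := fun l' h z hz =>
    prodSub_ne_zero fun h' => hz (h z h')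
  set q := prodSub l with hqd
  have hqdiff : Differentiable ℂ q := differentiable_prodSub l
  set R : ℂ → ℂ := fun w => p w / q w with hR
  have hRC : ∀ w ∈ (closure Ω)ᶜ, areaCauchy Ω w = R w := fun w hw => by
    rw [hR, eq_div_iff (hne l hl w fun h => hw (subset_closure h))]
    exact hpl w hw
  have hRan : ∀ z ∈ frontier Ω, AnalyticAt ℂ R z := fun z hz =>
    (hp.analyticAt z).div (hqdiff.analyticAt z) (hne l hl z (hnot z hz))
  set H : ℂ → ℂ := fun w => areaCauchy Ω w + Real.pi * conj w with hH
  have hHd : DifferentiableOn ℂ H Ω := differentiableOn_areaCauchy_add_conj hb ho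
  have hHc : Continuous H := (continuous_areaCauchy hb).add
    (continuous_const.mul Complex.continuous_conj)
  have hH' : DifferentiableOn ℂ (deriv H) Ω := hHd.deriv ho
  set φ : ℂ → ℂ := fun z => conj (s z) with hφ
  have hφc : ContinuousOn φ (frontier Ω) :=
    Complex.continuous_conj.comp_continuousOn (hsc.mono frontier_subset_closure)
  set Φ : ℂ → ℂ := fun w => ∫ z in frontier Ω, φ z * (z - w)⁻¹ ∂(μH[1]) with hΦ
  have hΦd : DifferentiableOn ℂ Φ Ω :=
    (differentiableOn_cauchyTransform (integrableOn_of_continuousOn_frontier hb hfin hφc)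
      isClosed_frontier (ae_restrict_mem isClosed_frontier.measurableSet)).mono
      fun z hz h => hnot z h hz
  have hΦext : ∀ w ∈ (closure Ω)ᶜ, Φ w = (a - w)⁻¹ := fun w hw => by
    have hd : ∀ z ∈ closure Ω, DifferentiableAt ℂ (fun z => (z - w)⁻¹) z := fun z hz =>
      (differentiableAt_id.sub_const w).inv (sub_ne_zero.2 fun h => hw (h ▸ hz))
    rw [hrep (fun z => (z - w)⁻¹)
      (fun z hz => (hd z (subset_closure hz)).differentiableWithinAt)
      (fun z hz => (hd z hz).continuousAt.continuousWithinAt)]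
    simp only [hΦ, hφ]
    exact integral_congr_ae (Eventually.of_forall fun z => mul_comm _ _)
  set Λ : ℂ → ℂ := fun w => (w - a) * Φ w + 1 with hΛ
  have hΛd : DifferentiableOn ℂ Λ Ω := ((differentiableOn_id.sub_const a).mul hΦd).add_const 1
  set D : ℂ → ℂ := fun w => q w ^ 2 * deriv H w - (deriv p w * q w - p w * deriv q w) with hD
  have hp' : Differentiable ℂ (deriv p) := fun z => (hp.analyticAt z).deriv.differentiableAt
  have hq' : Differentiable ℂ (deriv q) := fun z => (hqdiff.analyticAt z).deriv.differentiableAt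
  have hDd : DifferentiableOn ℂ D Ω :=
    ((hqdiff.pow 2).differentiableOn.mul hH').sub
      ((hp'.mul hqdiff).sub (hp.mul hq')).differentiableOn
  have hcont : ∀ {f : ℂ → ℂ}, Differentiable ℂ f → ∀ z, Tendsto f (𝓝[Ω] z) (𝓝 (f z)) :=
    fun hf z => (hf.continuous.tendsto z).mono_left nhdsWithin_le_nhds
  -- boundary values
  have hbd : ∀ z ∈ frontier Ω, ∃ u : ℂ, u ≠ 0 ∧
      Tendsto D (𝓝[Ω] z) (𝓝 (q z ^ 2 * (Real.pi * u ^ 2))) ∧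
      Tendsto H (𝓝[Ω] z) (𝓝 (R z + Real.pi * conj z)) ∧
      Tendsto Λ (𝓝[Ω] z) (𝓝 ((z - a) * (2 * Real.pi * I * φ z * u))) := fun z hz => by
    obtain ⟨u, g, g', δ, hch⟩ := hsm.exists_isGraphChart ho hc.isPreconnected hz
    have hqz : q z ≠ 0 := hne l hl z (hnot z hz)
    have hza : a - z ≠ 0 := sub_ne_zero.2 fun h => hnot z hz (h ▸ ha)
    refine ⟨conj u, ?_, ?_, ?_, ?_⟩
    · rw [Ne, map_eq_zero]; rintro rfl; simpa using hch.norm_eq_one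
    · have h1 := hch.tendsto_deriv_areaCauchy hb ho (hRan z hz) hRC
      have h2 := ((hcont (hqdiff.pow 2) z).mul h1).sub
        (hcont ((hp'.mul hqdiff).sub (hp.mul hq')) z)
      have h3 : deriv R z = (deriv p z * q z - p z * deriv q z) / q z ^ 2 :=
        ((hp z).hasDerivAt.div (hqdiff z).hasDerivAt hqz).deriv
      have h4 : q z ^ 2 * (Real.pi * conj u ^ 2) = q z ^ 2 * (deriv R z + Real.pi * conj u ^ 2) -
          (deriv p z * q z - p z * deriv q z) := by
        rw [h3]
        field_simp
        ring
      rw [h4]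
      exact h2
    · have h1 : Tendsto H (𝓝[Ω] z) (𝓝 (areaCauchy Ω z + Real.pi * conj z)) :=
        (hHc.tendsto z).mono_left nhdsWithin_le_nhds
      rwa [hch.areaCauchy_eq hb (hRan z hz).continuousAt hRC] at h1
    · have h1 := hch.tendsto_cauchyIntegral hb ho hfin hφc (L := fun w => (a - w)⁻¹)
        (ContinuousAt.inv₀ (by fun_prop) hza) hΦext
      have h2 := ((hcont (differentiable_id.sub_const a) z).mul h1).add_const (1 : ℂ)
      have h3 : (z - a) * (2 * Real.pi * I * φ z * conj u) =
          (z - a) * ((a - z)⁻¹ + 2 * Real.pi * I * φ z * conj u) + 1 := by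
        field_simp
        ring
      rw [h3]
      exact h2
  obtain ⟨lZ, k, hlZ, hkd, hk⟩ := exists_prodSub_eq_mul hb ho hc hDd fun z hz => by
    obtain ⟨u, hu, h1, -⟩ := hbd z hz
    exact ⟨_, mul_ne_zero (pow_ne_zero 2 (hne l hl z (hnot z hz)))
      (mul_ne_zero hpi (pow_ne_zero 2 hu)), h1⟩
  set Z := prodSub lZ with hZ
  have hZd : Differentiable ℂ Z := differentiable_prodSub lZ
  refine exists_relation hb ho hc (h := fun z => s z ^ 2)
    (e₁ := fun z => (Real.pi : ℂ)⁻¹ * ((z - a) ^ 2 * Z z * (q z * H z - p z)))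
    (e₂ := fun z => -(4 * Real.pi : ℂ)⁻¹ * (q z ^ 3 * Λ z ^ 2 * k z))
    (hsd.pow 2) ?_ ?_ (l ++ (List.replicate 2 a ++ lZ)) ?_ fun z hz => ⟨s z ^ 2, ?_, ?_, ?_⟩
  · exact (((((differentiable_id.sub_const a).pow 2).mul hZd).differentiableOn).mul
      ((hqdiff.differentiableOn.mul hHd).sub hp.differentiableOn)).const_mul _
  · exact (((hqdiff.pow 3).differentiableOn.mul (hΛd.pow 2)).mul hkd).const_mul _
  · intro b hb'
    rw [List.mem_append, List.mem_append] at hb'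
    rcases hb' with h | h | h
    · exact hl b h
    · rw [List.eq_of_mem_replicate h]; exact ha
    · exact hlZ b h
  · exact ((hsc z (frontier_subset_closure hz)).mono subset_closure).tendsto.pow 2
  all_goals
    obtain ⟨u, hu, hD1, hH1, hΛ1⟩ := hbd z hz
    have hqz : q z ≠ 0 := hne l hl z (hnot z hz)
    rw [prodSub_append, prodSub_append, prodSub_replicate, ← hqd, ← hZ]
  · have h1 := ((hcont (((differentiable_id.sub_const a).pow 2).mul hZd) z).mul
      (((hcont hqdiff z).mul hH1).sub (hcont hp z))).const_mul (Real.pi : ℂ)⁻¹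
    have h2 : (q z * ((z - a) ^ 2 * Z z)) * conj z =
        (Real.pi : ℂ)⁻¹ * ((z - a) ^ 2 * Z z * (q z * (R z + Real.pi * conj z) - p z)) := by
      simp only [hR]
      field_simp
      ring
    rw [h2]
    exact h1
  · have hDne : q z ^ 2 * (Real.pi * u ^ 2) ≠ 0 :=
      mul_ne_zero (pow_ne_zero 2 hqz) (mul_ne_zero hpi (pow_ne_zero 2 hu))
    have hk1 : Tendsto k (𝓝[Ω] z) (𝓝 (Z z / (q z ^ 2 * (Real.pi * u ^ 2)))) := by
      refine ((hcont hZd z).div hD1 hDne).congr' ?_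
      filter_upwards [hD1.eventually_ne hDne, self_mem_nhdsWithin] with w hw hwΩ
      simp only [Pi.div_apply]
      rw [hk w hwΩ, mul_div_cancel_left₀ _ hw]
    have h1 := ((((hcont hqdiff z).pow 3).mul (hΛ1.pow 2)).mul hk1).const_mul
      (-(4 * Real.pi : ℂ)⁻¹)
    convert h1 using 2
    simp only [hφ, map_pow]
    field_simp
    rw [I_sq]
    ring

/-- A polynomial relation between `z` and a power of `h z` is a polynomial relation between `z`
and `h z`. -/
lemma exists_mvPolynomial_of_relation {Ω : Set ℂ} {h : ℂ → ℂ} {m : ℕ} {c : Fin m × Fin m → ℂ}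
    (hc : c ≠ 0) (hrel : ∀ z ∈ Ω, ∑ p, c p * (z ^ (p.1 : ℕ) * (h z ^ 2) ^ (p.2 : ℕ)) = 0) :
    ∃ P : MvPolynomial (Fin 2) ℂ, P ≠ 0 ∧ ∀ z ∈ Ω, MvPolynomial.eval ![z, h z] P = 0 := by
  classical
  set e : Fin m × Fin m → (Fin 2 →₀ ℕ) := fun p =>
    Finsupp.single 0 (p.1 : ℕ) + Finsupp.single 1 (2 * (p.2 : ℕ)) with he
  have hinj : Function.Injective e := fun p p' h => by
    have h0 := DFunLike.congr_fun h 0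
    have h1 := DFunLike.congr_fun h 1
    simp [he] at h0 h1
    exact Prod.ext (Fin.ext h0) (Fin.ext h1)
  obtain ⟨p₀, hp₀⟩ := Function.ne_iff.1 hc
  refine ⟨∑ p, MvPolynomial.monomial (e p) (c p), fun h0 => hp₀ ?_, fun z hz => ?_⟩
  · have := congrArg (MvPolynomial.coeff (e p₀)) h0
    simpa [MvPolynomial.coeff_sum, MvPolynomial.coeff_monomial, hinj.eq_iff] using this
  · rw [map_sum, ← hrel z hz]
    refine Finset.sum_congr rfl fun p _ => ?_
    rw [MvPolynomial.eval_monomial, he]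
    rw [Finsupp.prod_add_index' (by simp) (by intros; rw [pow_add]),
      Finsupp.prod_single_index (by simp), Finsupp.prod_single_index (by simp)]
    simp [pow_mul]

end Helpers

/-- the Szegő kernel of a smoothly bounded quadrature domain of finite area is an
algebraic function of `z` for each fixed `w`. -/
theorem stmt_6 (Ω : Set ℂ) (hΩ : IsFinConnDomain Ω) (hA : volume Ω < ⊤)
    (hsm : HasSmoothBoundary Ω) (hq : IsQuadratureDomain Ω)
    (S : ℂ → ℂ → ℂ)
    (hS1 : ∀ w ∈ Ω, DifferentiableOn ℂ (fun z => S z w) Ω ∧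
      ContinuousOn (fun z => S z w) (closure Ω))
    (hS2 : ∀ f : ℂ → ℂ, DifferentiableOn ℂ f Ω → ContinuousOn f (closure Ω) →
      ∀ w ∈ Ω, f w = ∫ z in frontier Ω, f z * conj (S z w) ∂(μH[1])) :
    ∀ w ∈ Ω, ∃ P : MvPolynomial (Fin 2) ℂ, P ≠ 0 ∧
      ∀ z ∈ Ω, MvPolynomial.eval ![z, S z w] P = 0 := by
  intro w hw
  obtain ⟨m, c, hc, hrel⟩ := hq.exists_szego_relation hΩ.1 hΩ.2.1 hsm hw (hS1 w hw).1 (hS1 w hw).2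
    (fun f hf hf' => hS2 f hf hf' w hw)
  exact exists_mvPolynomial_of_relation hc hrel
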